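/- Let (s_{1,1}, …, s_{1,m}) = N(σ_1, …, σ_m) be a Nikishin system and n = (n_0, …, n_m) ∈ ℤ₊^{m+1}. Then there exist a permutation λ of {0, …, m} with n_{λ(0)} ≥ n_{λ(1)} ≥ ⋯ ≥ n_{λ(m)} and measures ρ_1, …, ρ_m with ρ_k ∈ M(Δ_k') for some interval Δ_k' ⊆ Δ_k, forming a Nikishin system (r_{1,1}, …, r_{1,m}) = N(ρ_1, …, ρ_m), such that: for all real polynomials p_0, …, p_m with deg p_k ≤ n_k − 1 there exist real polynomials q_0, …, q_m with deg q_k ≤ n_{λ(k)} − 1 satisfying, for every z ∈ ℂ ∖ Δ_1, p_0(z) + Σ_{k=1}^m p_k(z)·ŝ_{1,k}(z) = (q_0(z) + Σ_{k=1}^m q_k(z)·r̂_{1,k}(z)) · ŝ_{1,λ(0)}(z), where ŝ_{1,0} ≡ 1. -/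

import Mathlib

open MeasureTheory Set Polynomial Filter

noncomputable section

/-- A signed Borel measure on `ℝ`, represented by a pair of (nonnegative) measures
(a "positive part" and a "negative part"). -/
structure SignedM where
  pos : MeasureTheory.Measure ℝ
  neg : MeasureTheory.Measure ℝ

namespace SignedM

/-- Integral of a complex-valued function against a signed measure. -/
def cintegral (s : SignedM) (f : ℝ → ℂ) : ℂ :=
  (∫ x, f x ∂s.pos) - ∫ x, f x ∂s.neg

/-- Integral of a real-valued function against a signed measure. -/
def rintegral (s : SignedM) (f : ℝ → ℝ) : ℝ :=
  (∫ x, f x ∂s.pos) - ∫ x, f x ∂s.neg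

/-- The Cauchy transform `ŝ(z) = ∫ ds(x)/(z - x)` at a complex point. -/
def cauchy (s : SignedM) (z : ℂ) : ℂ :=
  s.cintegral fun x => (z - (x : ℂ))⁻¹

/-- The Cauchy transform at a real point (real-valued). -/
def cauchyR (s : SignedM) (x : ℝ) : ℝ :=
  s.rintegral fun t => (x - t)⁻¹

/-- The total variation `|s|` (for the constant-sign representation used here). -/
def mass (s : SignedM) : ℝ :=
  (s.pos Set.univ).toReal + (s.neg Set.univ).toReal

/-- The (topological) support of a nonnegative measure. -/
def msupport (μ : MeasureTheory.Measure ℝ) : Set ℝ :=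
  {x | ∀ U : Set ℝ, IsOpen U → x ∈ U → μ U ≠ 0}

/-- The support of a signed measure. -/
def supp (s : SignedM) : Set ℝ := msupport s.pos ∪ msupport s.neg

/-- The signed measure `g·s` with (real, possibly sign-changing) density `g` w.r.t. `s`. -/
def withDensityR (s : SignedM) (g : ℝ → ℝ) : SignedM where
  pos := s.pos.withDensity (fun x => ENNReal.ofReal (g x)) +
    s.neg.withDensity (fun x => ENNReal.ofReal (-g x))
  neg := s.pos.withDensity (fun x => ENNReal.ofReal (-g x)) +
    s.neg.withDensity (fun x => ENNReal.ofReal (g x))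

/-- The product `⟨a, b⟩`: the measure with density `b̂` with respect to `a`. -/
def nik (a b : SignedM) : SignedM := a.withDensityR b.cauchyR

end SignedM

/-- `s ∈ M(Δ)`: a finite Borel measure with constant sign, whose support is compact and
consists of infinitely many points, `Δ` being the smallest closed interval containing it. -/
structure IsM (s : SignedM) (Δ : Set ℝ) : Prop where
  posFinite : MeasureTheory.IsFiniteMeasure s.pos
  negFinite : MeasureTheory.IsFiniteMeasure s.neg
  constSign : s.pos = 0 ∨ s.neg = 0
  compactSupp : IsCompact s.supp
  infiniteSupp : s.supp.Infinite
  hullEq : Δ = Set.Icc (sInf s.supp) (sSup s.supp)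

/-- A set of reals, viewed inside `ℂ`. -/
def cSet (Δ : Set ℝ) : Set ℂ := (fun x : ℝ => (x : ℂ)) '' Δ

/-- `τ` is the inverse measure of `s`: `1/ŝ(z) = z/|s| + b + τ̂(z)` on `ℂ ∖ Δ`. -/
def IsInverse (s τ : SignedM) (Δ : Set ℝ) : Prop :=
  ∃ b : ℝ, ∀ z : ℂ, z ∉ cSet Δ →
    (s.cauchy z)⁻¹ = z / (s.mass : ℂ) + (b : ℂ) + τ.cauchy z

/-- The iterated products `s_{j,k} = ⟨σ_j, σ_{j+1}, …, σ_k⟩` of a Nikishin system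
(`s_{j,k} = σ_j` when `j ≥ k`). -/
def nikSys (σ : ℕ → SignedM) : ℕ → ℕ → SignedM
  | j, k => if h : j < k then (σ j).nik (nikSys σ (j + 1) k) else σ j
  termination_by j k => k - j
  decreasing_by omega

/-- `ŝ_{1,k}` as a real function, with the convention `ŝ_{1,0} ≡ 1`. -/
def sh1R (σ : ℕ → SignedM) (k : ℕ) (x : ℝ) : ℝ :=
  if k = 0 then 1 else (nikSys σ 1 k).cauchyR x

/-- `ŝ_{1,k}` as a complex function, with the convention `ŝ_{1,0} ≡ 1`. -/
def sh1C (σ : ℕ → SignedM) (k : ℕ) (z : ℂ) : ℂ :=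
  if k = 0 then 1 else (nikSys σ 1 k).cauchy z

/-- `A = (a_0, …, a_{m₁})` is a mixed type vector polynomial relative to the pair of
Nikishin systems generated by `σ1 = (σ₀¹, …, σ_{m₁}¹)` and `σ2 = (σ₀², …, σ_{m₂}²)`
(with `σ₀¹ = σ₀²`) and the multi-index `n = (n1; n2)`: the `a_k` are real polynomials,
not all zero, `deg a_k ≤ n_{1,k} − 1`, and for each `i ≤ m₂` there is a polynomial `d_i`
with `Σ_k a_k(z) ∫ ŝ²_{1,i}(x) ŝ¹_{1,k}(x) dσ₀²(x)/(z−x) − d_i(z) = O(1/z^{n_{2,i}+1})`. -/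
def IsMixedVP (σ1 σ2 : ℕ → SignedM) (m1 m2 : ℕ) (n1 n2 : ℕ → ℕ)
    (a : ℕ → Polynomial ℝ) : Prop :=
  (¬ ∀ k ≤ m1, a k = 0) ∧
  (∀ k ≤ m1, (a k).degree < (n1 k : WithBot ℕ)) ∧
  (∀ i ≤ m2, ∃ d : Polynomial ℝ, ∃ C R : ℝ, ∀ z : ℂ, R ≤ ‖z‖ →
    ‖(∑ k ∈ Finset.range (m1 + 1), aeval z (a k) *
        (σ2 0).cintegral (fun x =>
          ((sh1R σ2 i x * sh1R σ1 k x : ℝ) : ℂ) * (z - (x : ℂ))⁻¹)) -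
      aeval z d‖ ≤ C / ‖z‖ ^ (n2 i + 1))

/-- A measure of constant sign on `ℝ`, given by its total variation and its sign. -/
structure CSM where
  μ : MeasureTheory.Measure ℝ
  ε : ℝ

/-- `s` is a nonzero finite constant sign measure with infinite support, carried by the compact
interval `Δ`. -/
structure CSM.On (s : CSM) (Δ : Set ℝ) : Prop where
  cpt : IsCompact Δ
  cvx : Δ.OrdConnected
  fin : IsFiniteMeasure s.μ
  sgn : s.ε = 1 ∨ s.ε = -1
  null : s.μ Δᶜ = 0
  inf : s.μ.support.Infinite

/-- The Cauchy transform of the density `F` against `s`. -/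
def ctr (s : CSM) (F : ℂ → ℂ) (z : ℂ) : ℂ :=
  s.ε * ∫ x : ℝ, F x * (z - x)⁻¹ ∂s.μ

/-- `F` is continuous and real-valued on the set of reals `Δ`. -/
structure CR (F : ℂ → ℂ) (Δ : Set ℝ) : Prop where
  cont : ContinuousOn (fun x : ℝ => F x) Δ
  real : ∀ x ∈ Δ, (F x).im = 0

/-- `F` is continuous off `Δ`, and real-valued on the real points off `Δ`. -/
structure Reg (F : ℂ → ℂ) (Δ : Set ℝ) : Prop where
  cont : ContinuousOn F (cSet Δ)ᶜ
  real : ∀ x : ℝ, x ∉ Δ → (F x).im = 0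

lemma mem_cSet_ofReal {Δ : Set ℝ} {x : ℝ} : (x : ℂ) ∈ cSet Δ ↔ x ∈ Δ := by
  simp [cSet]

lemma notMem_cSet_of_im {Δ : Set ℝ} {z : ℂ} (hz : z.im ≠ 0) : z ∉ cSet Δ := by
  rintro ⟨x, _, rfl⟩
  simp at hz

lemma notMem_cSet {Δ : Set ℝ} {z : ℂ} (hz : z ∉ cSet Δ) {x : ℝ} (hx : x ∈ Δ) :
    z - x ≠ 0 := by
  intro h
  exact hz ⟨x, hx, by rw [sub_eq_zero] at h; exact h.symm⟩

lemma isClosed_cSet {Δ : Set ℝ} (h : IsCompact Δ) : IsClosed (cSet Δ) :=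
  (h.image Complex.continuous_ofReal).isClosed

lemma isOpen_compl_cSet {Δ : Set ℝ} (h : IsCompact Δ) : IsOpen (cSet Δ)ᶜ :=
  (isClosed_cSet h).isOpen_compl

lemma Reg.cr {F : ℂ → ℂ} {Δ Δ' : Set ℝ} (h : Reg F Δ) (hd : Disjoint Δ Δ') : CR F Δ' where
  cont := by
    refine h.cont.comp Complex.continuous_ofReal.continuousOn ?_
    intro x hx
    simp only [mem_compl_iff, mem_cSet_ofReal]
    exact fun h' => hd.le_bot ⟨h', hx⟩
  real x hx := h.real x fun h' => hd.le_bot ⟨h', hx⟩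

lemma CR.mul {F G : ℂ → ℂ} {Δ : Set ℝ} (hF : CR F Δ) (hG : CR G Δ) :
    CR (fun z => F z * G z) Δ where
  cont := hF.cont.mul hG.cont
  real x hx := by simp [Complex.mul_im, hF.real x hx, hG.real x hx]

lemma CR.add {F G : ℂ → ℂ} {Δ : Set ℝ} (hF : CR F Δ) (hG : CR G Δ) :
    CR (fun z => F z + G z) Δ where
  cont := hF.cont.add hG.cont
  real x hx := by simp [hF.real x hx, hG.real x hx]

lemma Reg.add {F G : ℂ → ℂ} {Δ : Set ℝ} (hF : Reg F Δ) (hG : Reg G Δ) :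
    Reg (fun z => F z + G z) Δ where
  cont := hF.cont.add hG.cont
  real x hx := by simp [hF.real x hx, hG.real x hx]

lemma Reg.mul {F G : ℂ → ℂ} {Δ : Set ℝ} (hF : Reg F Δ) (hG : Reg G Δ) :
    Reg (fun z => F z * G z) Δ where
  cont := hF.cont.mul hG.cont
  real x hx := by simp [Complex.mul_im, hF.real x hx, hG.real x hx]

lemma Reg.neg {F : ℂ → ℂ} {Δ : Set ℝ} (hF : Reg F Δ) : Reg (fun z => -F z) Δ where
  cont := hF.cont.neg
  real x hx := by simp [hF.real x hx]

lemma aeval_ofReal_eq (T : ℝ[X]) (x : ℝ) : aeval (x : ℂ) T = ((T.eval x : ℝ) : ℂ) := by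
  rw [← Complex.coe_algebraMap, aeval_algebraMap_apply]
  simp

lemma Reg.poly (T : ℝ[X]) (Δ : Set ℝ) : Reg (fun z => aeval z T) Δ where
  cont := (Polynomial.continuous_aeval T).continuousOn
  real x _ := by simp [aeval_ofReal_eq]

lemma CR.poly (T : ℝ[X]) (Δ : Set ℝ) : CR (fun z => aeval z T) Δ :=
  (Reg.poly T ∅).cr (by simp)

lemma Reg.const (c : ℝ) (Δ : Set ℝ) : Reg (fun _ => (c : ℂ)) Δ where
  cont := continuousOn_const
  real x _ := by simp

lemma Reg.one (Δ : Set ℝ) : Reg (fun _ => (1 : ℂ)) Δ where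
  cont := continuousOn_const
  real x _ := by simp

lemma CR.one (Δ : Set ℝ) : CR (fun _ => (1 : ℂ)) Δ :=
  (Reg.one ∅).cr (by simp)

lemma CR.eq_re {F : ℂ → ℂ} {Δ : Set ℝ} (h : CR F Δ) {x : ℝ} (hx : x ∈ Δ) :
    F x = ((F x).re : ℂ) :=
  Complex.ext (by simp) (by simp [h.real x hx])

namespace CSM.On

variable {s w μ : CSM} {Δ Δ' : Set ℝ}

lemma ae_mem (h : s.On Δ) : ∀ᵐ x ∂s.μ, x ∈ Δ := h.null

lemma ε_ne (h : s.On Δ) : s.ε ≠ 0 := by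
  rcases h.sgn with h | h <;> simp [h]

lemma restrict (h : s.On Δ) : s.μ.restrict Δ = s.μ := Measure.restrict_eq_self_of_ae_mem h.ae_mem

lemma integrable {E : Type*} [NormedAddCommGroup E] (h : s.On Δ)
    {f : ℝ → E} (hf : ContinuousOn f Δ) : Integrable f s.μ := by
  have := h.fin
  have h1 : IntegrableOn f Δ s.μ := hf.integrableOn_compact h.cpt
  rwa [IntegrableOn, h.restrict] at h1

lemma integral_congr {E : Type*} [NormedAddCommGroup E] [NormedSpace ℝ E] (h : s.On Δ)
    {f g : ℝ → E} (hf : ∀ x ∈ Δ, f x = g x) : ∫ x, f x ∂s.μ = ∫ x, g x ∂s.μ :=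
  integral_congr_ae (h.ae_mem.mono hf)

lemma ctr_congr (h : s.On Δ) {F G : ℂ → ℂ} (hf : ∀ x : ℝ, x ∈ Δ → F x = G x) (z : ℂ) :
    ctr s F z = ctr s G z := by
  unfold ctr
  rw [h.integral_congr]
  intro x hx
  simp only [hf x hx]

lemma support_subset (h : s.On Δ) : s.μ.support ⊆ Δ := by
  apply Measure.support_subset_of_isClosed h.cpt.isClosed
  rw [mem_ae_iff]
  exact h.null

lemma cont_kernel (F : ℂ → ℂ) (hF : ContinuousOn (fun x : ℝ => F x) Δ) {z : ℂ} (hz : z ∉ cSet Δ) :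
    ContinuousOn (fun x : ℝ => F x * (z - x)⁻¹) Δ := by
  refine hF.mul (ContinuousOn.inv₀ (by fun_prop) ?_)
  intro x hx
  exact notMem_cSet hz hx

lemma integrable_kernel (h : s.On Δ) {F : ℂ → ℂ} (hF : ContinuousOn (fun x : ℝ => F x) Δ)
    {z : ℂ} (hz : z ∉ cSet Δ) :
    Integrable (fun x : ℝ => F x * (z - x)⁻¹) s.μ :=
  h.integrable (cont_kernel F hF hz)

lemma exists_bound (h : s.On Δ) {F : ℂ → ℂ} (hF : ContinuousOn (fun x : ℝ => F x) Δ) :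
    ∃ C : ℝ, 0 ≤ C ∧ ∀ x : ℝ, x ∈ Δ → ‖F x‖ ≤ C := by
  obtain ⟨C, hC⟩ := h.cpt.exists_bound_of_continuousOn hF
  exact ⟨max C 0, le_max_right _ _, fun x hx => (hC x hx).trans (le_max_left _ _)⟩

lemma reg_ctr (h : s.On Δ) {F : ℂ → ℂ} (hF : CR F Δ) : Reg (ctr s F) Δ where
  cont := by
    have := h.fin
    intro z hz
    refine ContinuousAt.continuousWithinAt ?_
    refine continuousAt_const.mul ?_
    obtain ⟨C, hC0, hC⟩ := h.exists_bound hF.cont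
    obtain ⟨d, hd, hball⟩ := Metric.isOpen_iff.1 (isOpen_compl_cSet h.cpt) z hz
    refine continuousAt_of_dominated (bound := fun _ => C * (d / 2)⁻¹) ?_ ?_
      (integrable_const _) ?_
    · filter_upwards [(isOpen_compl_cSet h.cpt).mem_nhds hz] with w hw
      exact (h.integrable_kernel hF.cont hw).aestronglyMeasurable
    · filter_upwards [Metric.ball_mem_nhds z (half_pos hd)] with w hw
      filter_upwards [h.ae_mem] with x hx
      rw [norm_mul, norm_inv]
      have h1 : d / 2 ≤ ‖w - x‖ := by
        by_contra! h2
        have h3 : ‖(x : ℂ) - z‖ < d := by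
          have : ‖(x : ℂ) - z‖ ≤ ‖w - z‖ + ‖w - x‖ := by
            rw [show (x : ℂ) - z = (w - z) - (w - x) by ring]
            exact norm_sub_le _ _
          rw [Metric.mem_ball, dist_eq_norm] at hw
          linarith
        have h4 := hball (Metric.mem_ball.2 (by rw [dist_eq_norm]; exact h3))
        exact h4 (mem_cSet_ofReal.2 hx)
      gcongr
      exact hC x hx
    · filter_upwards [h.ae_mem] with x hx
      refine continuousAt_const.mul (ContinuousAt.inv₀ (by fun_prop) (notMem_cSet hz hx))
  real x hx := by
    unfold ctr
    have : ∫ t : ℝ, F t * ((x : ℂ) - t)⁻¹ ∂s.μ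
        = ((∫ t : ℝ, (F t).re * (x - t)⁻¹ ∂s.μ : ℝ) : ℂ) := by
      rw [← integral_complex_ofReal]
      refine h.integral_congr fun t ht => ?_
      push_cast
      rw [← hF.eq_re ht]
    rw [this]
    simp [Complex.mul_im]

lemma ctr_add (h : s.On Δ) {F G : ℂ → ℂ} (hF : ContinuousOn (fun x : ℝ => F x) Δ)
    (hG : ContinuousOn (fun x : ℝ => G x) Δ) {z : ℂ} (hz : z ∉ cSet Δ) :
    ctr s (fun w => F w + G w) z = ctr s F z + ctr s G z := by
  unfold ctr
  rw [← mul_add, ← integral_add (h.integrable_kernel hF hz) (h.integrable_kernel hG hz)]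
  simp only [add_mul]

lemma ctr_const_mul (c : ℂ) (F : ℂ → ℂ) (z : ℂ) :
    ctr s (fun w => c * F w) z = c * ctr s F z := by
  unfold ctr
  simp only [mul_assoc, integral_const_mul]
  ring

lemma ctr_sum (h : s.On Δ) {ι : Type*} (S : Finset ι) {F : ι → ℂ → ℂ}
    (hF : ∀ i ∈ S, ContinuousOn (fun x : ℝ => F i x) Δ) {z : ℂ} (hz : z ∉ cSet Δ) :
    ctr s (fun w => ∑ i ∈ S, F i w) z = ∑ i ∈ S, ctr s (F i) z := by
  unfold ctr
  rw [← Finset.mul_sum, ← integral_finsetSum _ fun i hi => h.integrable_kernel (hF i hi) hz]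
  simp only [Finset.sum_mul]

/-- The product formula for Cauchy transforms of measures on disjoint intervals. -/
lemma ctr_mul_ctr (hw : w.On Δ) (hμ : μ.On Δ') (hd : Disjoint Δ Δ') {f g : ℂ → ℂ}
    (hf : CR f Δ) (hg : CR g Δ') {z : ℂ} (hz : z ∉ cSet Δ) (hz' : z ∉ cSet Δ') :
    ctr w f z * ctr μ g z =
      ctr w (fun y => f y * ctr μ g y) z + ctr μ (fun y => g y * ctr w f y) z := by
  have := hw.fin
  have := hμ.fin
  have hne : ∀ x ∈ Δ, ∀ y ∈ Δ', (x : ℂ) - y ≠ 0 := fun x hx y hy =>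
    notMem_cSet (by rw [mem_cSet_ofReal]; exact fun h => hd.le_bot ⟨hx, h⟩) hy
  have hinteg : Integrable (fun p : ℝ × ℝ =>
      f p.1 * (z - p.1)⁻¹ * (g p.2 * ((p.1 : ℂ) - p.2)⁻¹)) (w.μ.prod μ.μ) := by
    have hc : ContinuousOn (fun p : ℝ × ℝ =>
      f p.1 * (z - p.1)⁻¹ * (g p.2 * ((p.1 : ℂ) - p.2)⁻¹)) (Δ ×ˢ Δ') := by
      refine ContinuousOn.mul ?_ (ContinuousOn.mul ?_ ?_)
      · exact (cont_kernel f hf.cont hz).comp continuousOn_fst (fun p hp => hp.1)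
      · exact hg.cont.comp continuousOn_snd (fun p hp => hp.2)
      · refine ContinuousOn.inv₀ (by fun_prop) ?_
        intro p hp
        exact hne _ hp.1 _ hp.2
    have h1 := hc.integrableOn_compact (μ := w.μ.prod μ.μ) (hw.cpt.prod hμ.cpt)
    rwa [IntegrableOn, ← Measure.prod_restrict, hw.restrict, hμ.restrict] at h1
  have e1 : ctr w (fun y => f y * ctr μ g y) z = w.ε * μ.ε *
      ∫ x : ℝ, ∫ y : ℝ, f x * (z - x)⁻¹ * (g y * ((x : ℂ) - y)⁻¹) ∂μ.μ ∂w.μ := by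
    unfold ctr
    simp only [integral_const_mul]
    rw [mul_assoc]
    congr 1
    rw [← integral_const_mul]
    congr 1
    funext x
    ring
  have e2 : ctr μ (fun y => g y * ctr w f y) z = w.ε * μ.ε *
      ∫ y : ℝ, ∫ x : ℝ, (g y * (z - y)⁻¹) * (f x * ((y : ℂ) - x)⁻¹) ∂w.μ ∂μ.μ := by
    unfold ctr
    simp only [integral_const_mul]
    rw [mul_comm (w.ε : ℂ), mul_assoc]
    congr 1
    rw [← integral_const_mul]
    congr 1
    funext x
    ring
  have e3 : ctr w f z * ctr μ g z = w.ε * μ.ε *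
      ∫ y : ℝ, ∫ x : ℝ, (g y * (z - y)⁻¹) * (f x * (z - x)⁻¹) ∂w.μ ∂μ.μ := by
    unfold ctr
    simp only [integral_const_mul, integral_mul_const]
    ring
  rw [e1, integral_integral_swap hinteg, e2, e3, ← mul_add]
  congr 1
  rw [← integral_add]
  · refine hμ.integral_congr fun y hy => ?_
    have hyw : (y : ℂ) ∉ cSet Δ := by
      rw [mem_cSet_ofReal]; exact fun h => hd.le_bot ⟨h, hy⟩
    rw [← integral_add]
    · refine hw.integral_congr fun x hx => ?_
      have h1 := notMem_cSet hz hx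
      have h2 := notMem_cSet hz' hy
      have h3 := hne x hx y hy
      have h4 : (y : ℂ) - x ≠ 0 := by rw [← neg_sub]; exact neg_ne_zero.2 h3
      have h5 : ((y : ℂ) - x)⁻¹ = - ((x : ℂ) - y)⁻¹ := by rw [← neg_sub, inv_neg]
      rw [h5]
      field_simp
      ring
    · refine hw.integrable (ContinuousOn.mul (cont_kernel f hf.cont hz) ?_)
      refine continuousOn_const.mul (ContinuousOn.inv₀ (by fun_prop) fun x hx => hne x hx y hy)
    · exact hw.integrable (continuousOn_const.mul (cont_kernel f hf.cont hyw))
  · exact hinteg.integral_prod_right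
  · have : (fun y : ℝ => ∫ x : ℝ, (g y * (z - y)⁻¹) * (f x * ((y : ℂ) - x)⁻¹) ∂w.μ)
        = fun y : ℝ => (g y * (w.ε : ℂ)⁻¹ * ctr w f y) * (z - y)⁻¹ := by
      have : (w.ε : ℂ) ≠ 0 := by exact_mod_cast hw.ε_ne
      ext y
      unfold ctr
      rw [integral_const_mul]
      field_simp
    rw [this]
    refine hμ.integrable (cont_kernel (fun y => g y * (w.ε : ℂ)⁻¹ * ctr w f y) ?_ hz')
    exact (hg.cont.mul continuousOn_const).mul ((hw.reg_ctr hf).cr hd).cont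

/-- Multiplying the density by a polynomial changes the Cauchy transform by a polynomial. -/
lemma exists_ctr_poly (h : s.On Δ) {F : ℂ → ℂ} (hF : CR F Δ) (n : ℕ) :
    ∀ T : ℝ[X], T.degree ≤ n → ∃ R : ℝ[X], R.degree < n ∧ ∀ z ∉ cSet Δ,
      ctr s (fun w => aeval w T * F w) z = aeval z T * ctr s F z - aeval z R := by
  induction n with
  | zero =>
    intro T hT
    refine ⟨0, by simp, fun z hz => ?_⟩
    rw [eq_C_of_degree_le_zero (p := T) (by simpa using hT)]
    simp [ctr_const_mul]
  | succ n ih =>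
    intro T hT
    have hd : T.divX.degree ≤ n := by
      rw [degree_le_iff_coeff_zero] at hT ⊢
      intro k hk
      rw [coeff_divX]
      exact hT _ (by exact_mod_cast Nat.succ_lt_succ (by exact_mod_cast hk))
    obtain ⟨R, hR, hRz⟩ := ih _ hd
    refine ⟨X * R + C (s.ε * ∫ x : ℝ, T.divX.eval x * (F x).re ∂s.μ), ?_, ?_⟩
    · refine (degree_add_le _ _).trans_lt (max_lt ?_ ?_)
      · rw [degree_mul, degree_X, add_comm]
        push_cast
        by_cases h0 : R = 0
        · simp only [h0, degree_zero, WithBot.bot_add]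
          exact WithBot.bot_lt_coe (n + 1)
        · rw [degree_eq_natDegree h0] at hR ⊢
          have : R.natDegree < n := by exact_mod_cast hR
          exact_mod_cast Nat.succ_lt_succ this
      · exact degree_C_le.trans_lt (by exact_mod_cast Nat.succ_pos n)
    · intro z hz
      have hT' : ∀ w : ℂ, aeval w T = w * aeval w T.divX + (T.coeff 0 : ℂ) := by
        intro w
        have := congrArg (aeval w) (divX_mul_X_add T)
        rw [← this, map_add, map_mul, aeval_X, aeval_C, mul_comm]
        rfl
      have hcF : ContinuousOn (fun x : ℝ => aeval (x : ℂ) T.divX * F x) Δ :=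
        ((CR.poly _ _).mul hF).cont
      have e1 : ctr s (fun w => aeval w T * F w) z
          = z * ctr s (fun w => aeval w T.divX * F w) z - s.ε * ∫ x : ℝ, aeval (x : ℂ) T.divX * F x ∂s.μ
            + T.coeff 0 * ctr s F z := by
        have : ctr s (fun w => aeval w T * F w) z
          = ctr s (fun w => w * (aeval w T.divX * F w) + T.coeff 0 * F w) z := by
          congr 1; ext w; rw [hT']; ring
        rw [this, h.ctr_add (by exact Complex.continuous_ofReal.continuousOn.mul hcF)
          (by exact continuousOn_const.mul hF.cont) hz, ctr_const_mul]
        congr 1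
        unfold ctr
        rw [mul_left_comm, ← mul_sub]
        congr 1
        rw [← integral_const_mul, ← integral_sub]
        · refine h.integral_congr fun x hx => ?_
          have := notMem_cSet hz hx
          field_simp
          ring
        · exact (h.integrable_kernel (F := fun w => aeval w T.divX * F w) hcF hz).const_mul z
        · exact h.integrable hcF
      have e2 : ∫ x : ℝ, aeval (x : ℂ) T.divX * F x ∂s.μ
          = ((∫ x : ℝ, T.divX.eval x * (F x).re ∂s.μ : ℝ) : ℂ) := by
        rw [← integral_complex_ofReal]
        refine h.integral_congr fun t ht => ?_
        push_cast
        rw [← hF.eq_re ht, aeval_ofReal_eq]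
      rw [e1, hRz z hz, hT' z, e2]
      simp
      ring

/-- Multiplication of a constant sign measure by a real continuous density without zeros. -/
lemma exists_dens (h : s.On Δ) {g : ℂ → ℂ} (hg : CR g Δ) (h0 : ∀ x : ℝ, x ∈ Δ → g x ≠ 0) :
    ∃ s' : CSM, s'.On Δ ∧ ∀ F z, ctr s' F z = ctr s (fun w => g w * F w) z := by
  classical
  have := h.fin
  set G : ℝ → ℝ := fun x => (g x).re with hG
  have hGc : ContinuousOn G Δ := Complex.continuous_re.comp_continuousOn hg.cont
  have hG0 : ∀ x ∈ Δ, G x ≠ 0 := by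
    intro x hx hx0
    apply h0 x hx
    rw [hg.eq_re hx]
    exact_mod_cast hx0
  obtain ⟨δ, hδ, hδG⟩ : ∃ δ : ℝ, (δ = 1 ∨ δ = -1) ∧ ∀ x ∈ Δ, 0 < δ * G x := by
    by_cases hp : ∀ x ∈ Δ, 0 < G x
    · exact ⟨1, Or.inl rfl, by simpa using hp⟩
    · push Not at hp
      obtain ⟨y, hy, hy0⟩ := hp
      refine ⟨-1, Or.inr rfl, fun x hx => ?_⟩
      by_contra! hx0
      have hpc : IsPreconnected Δ := h.cvx.isPreconnected
      obtain ⟨u, hu, hu0⟩ := hpc.intermediate_value hy hx hGc (show (0 : ℝ) ∈ Icc (G y) (G x) from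
        ⟨hy0, by linarith⟩)
      exact hG0 u hu hu0
  have hδ2 : δ * δ = 1 := by rcases hδ with h | h <;> simp [h]
  set D : ℝ → NNReal := fun x => Real.toNNReal (Δ.indicator (fun x => δ * G x) x) with hD
  have hDm : Measurable D := by
    refine Measurable.real_toNNReal ?_
    have hc : ContinuousOn (fun x => δ * G x) Δ := continuousOn_const.mul hGc
    exact hc.measurable_piecewise continuousOn_const h.cpt.measurableSet
  have hDv : ∀ x ∈ Δ, (D x : ℝ) = δ * G x := by
    intro x hx
    simp only [hD, indicator_of_mem hx]
    exact Real.coe_toNNReal _ (hδG x hx).le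
  have hac : s.μ.withDensity (fun x => (D x : ENNReal)) ≪ s.μ := withDensity_absolutelyContinuous _ _
  have hac' : s.μ ≪ s.μ.withDensity (fun x => (D x : ENNReal)) := by
    refine withDensity_absolutelyContinuous' (by fun_prop) ?_
    filter_upwards [h.ae_mem] with x hx
    have := hδG x hx
    rw [← hDv x hx] at this
    simpa using (NNReal.coe_pos.1 this).ne'
  refine ⟨⟨s.μ.withDensity (fun x => D x), s.ε * δ⟩, ⟨h.cpt, h.cvx, ?_, ?_, ?_, ?_⟩, ?_⟩
  · obtain ⟨C, hC⟩ := h.cpt.exists_bound_of_continuousOn hGc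
    refine isFiniteMeasure_withDensity ?_
    have : ∫⁻ x, (D x : ENNReal) ∂s.μ ≤ ∫⁻ _, ENNReal.ofReal C ∂s.μ := by
      refine lintegral_mono_ae ?_
      filter_upwards [h.ae_mem] with x hx
      have h1 : (D x : ENNReal) = ENNReal.ofReal (D x) := by simp
      rw [h1]
      refine ENNReal.ofReal_le_ofReal ?_
      rw [hDv x hx]
      refine le_trans ?_ (hC x hx)
      rw [Real.norm_eq_abs]
      rcases hδ with h | h <;> rw [h]
      · simpa using le_abs_self _
      · simpa using neg_le_abs _
    refine (this.trans_lt ?_).ne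
    simp [ENNReal.mul_lt_top_iff, measure_lt_top]
  · rcases h.sgn with h | h <;> rcases hδ with h' | h' <;> simp [h, h']
  · exact hac h.null
  · have : s.μ.support ⊆ (s.μ.withDensity (fun x => (D x : ENNReal))).support :=
      hac'.support_mono
    exact h.inf.mono this
  · intro F z
    unfold ctr
    simp only
    have hcont : ∀ x ∈ Δ, D x • (F x * (z - x)⁻¹) = δ * (g x * F x * (z - x)⁻¹) := by
      intro x hx
      have : D x • (F x * (z - x)⁻¹) = ((D x : ℝ) : ℂ) * (F x * (z - x)⁻¹) := by
        rw [NNReal.smul_def, Complex.real_smul]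
      rw [this, hDv x hx, hg.eq_re hx]
      push_cast
      ring
    rw [integral_withDensity_eq_integral_smul hDm, h.integral_congr hcont, integral_const_mul]
    rw [← mul_assoc]
    congr 1
    push_cast
    rw [mul_assoc]
    have : (δ : ℂ) * δ = 1 := by exact_mod_cast hδ2
    rw [this, mul_one]

lemma norm_ctr_le (h : s.On Δ) {F : ℂ → ℂ} (hF : ContinuousOn (fun x : ℝ => F x) Δ) :
    ∃ C : ℝ, 0 ≤ C ∧ ∀ z : ℂ, z.im ≠ 0 → ‖ctr s F z‖ ≤ C * |z.im|⁻¹ := by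
  have := h.fin
  obtain ⟨C, hC0, hC⟩ := h.exists_bound hF
  refine ⟨C * s.μ.real univ, by positivity, fun z hz => ?_⟩
  unfold ctr
  have hε : ‖(s.ε : ℂ)‖ = 1 := by rcases h.sgn with h | h <;> simp [h]
  rw [norm_mul, hε, one_mul]
  have : ‖∫ x : ℝ, F x * (z - x)⁻¹ ∂s.μ‖ ≤ C * |z.im|⁻¹ * s.μ.real univ := by
    refine norm_integral_le_of_norm_le_const ?_
    filter_upwards [h.ae_mem] with x hx
    rw [norm_mul, norm_inv]
    have : |z.im| ≤ ‖z - x‖ := by simpa using Complex.abs_im_le_norm (z - x)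
    have : 0 < |z.im| := abs_pos.2 hz
    gcongr
    exact hC x hx
  linarith [this]

lemma tendsto_mul_ctr (h : s.On Δ) {F : ℂ → ℂ} (hF : ContinuousOn (fun x : ℝ => F x) Δ) :
    Tendsto (fun y : ℝ => (Complex.I * y) * ctr s F (Complex.I * y)) atTop
      (nhds (s.ε * ∫ x : ℝ, F x ∂s.μ)) := by
  have := h.fin
  have e : ∀ y : ℝ, (Complex.I * y) * ctr s F (Complex.I * y)
      = s.ε * ∫ x : ℝ, F x * ((Complex.I * y) * (Complex.I * y - x)⁻¹) ∂s.μ := by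
    intro y
    unfold ctr
    rw [mul_left_comm, ← integral_const_mul]
    congr 2
    funext x
    ring
  simp only [e]
  refine Tendsto.const_mul _ ?_
  refine tendsto_integral_filter_of_dominated_convergence (fun x => ‖F x‖) ?_ ?_
    (h.integrable hF).norm ?_
  · filter_upwards [eventually_gt_atTop 0] with y hy
    have := h.integrable_kernel hF (z := Complex.I * y)
      (notMem_cSet_of_im (by simpa using hy.ne'))
    have := (this.const_mul (Complex.I * y)).aestronglyMeasurable
    refine this.congr (Eventually.of_forall fun x => ?_)
    simp only
    ring
  · filter_upwards [eventually_gt_atTop 0] with y hy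
    filter_upwards with x
    rw [norm_mul]
    refine mul_le_of_le_one_right (norm_nonneg _) ?_
    rw [norm_mul, norm_inv, ← div_eq_mul_inv]
    refine div_le_one_of_le₀ ?_ (norm_nonneg _)
    have : |(Complex.I * y - x).im| ≤ ‖Complex.I * y - x‖ := Complex.abs_im_le_norm _
    simpa using this
  · filter_upwards with x
    have : Tendsto (fun y : ℝ => Complex.I * y * (Complex.I * y - x)⁻¹) atTop (nhds 1) := by
      have h1 : Tendsto (fun y : ℝ => 1 + x * (Complex.I * y - x)⁻¹) atTop (nhds (1 + x * 0)) := by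
        refine Tendsto.const_add _ (Tendsto.const_mul _ ?_)
        rw [tendsto_zero_iff_norm_tendsto_zero]
        refine squeeze_zero' (Eventually.of_forall fun _ => norm_nonneg _) ?_ tendsto_inv_atTop_zero
        filter_upwards [eventually_gt_atTop 0] with y hy
        rw [norm_inv]
        gcongr
        have : |(Complex.I * y - x).im| ≤ ‖Complex.I * y - x‖ := Complex.abs_im_le_norm _
        simp at this
        exact (le_abs_self _).trans this
      simp only [mul_zero, add_zero] at h1
      refine h1.congr' ?_
      filter_upwards [eventually_gt_atTop 0] with y hy
      have : Complex.I * y - x ≠ 0 := by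
        intro h
        have := congrArg Complex.im h
        simp at this
        exact hy.ne' this
      field_simp
      ring
    simpa using this.const_mul (F x)

end CSM.On

/-- The functions `φ i`, `i ∈ U`, form a Chebyshev system on `D`. -/
def Cheb {ι : Type*} (φ : ι → ℝ → ℝ) (U : Set ι) (D : Set ℝ) : Prop :=
  ∀ (S : Finset ι) (T : Finset ℝ), ↑S ⊆ U → ↑T ⊆ D → S.card ≤ T.card →
    ∀ c : ι → ℝ, (∀ t ∈ T, ∑ i ∈ S, c i * φ i t = 0) → ∀ i ∈ S, c i = 0

lemma Cheb.det_ne_zero {ι : Type*} {φ : ι → ℝ → ℝ} {U : Set ι} {D : Set ℝ} (h : Cheb φ U D)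
    {p : ℕ} {e : Fin p → ι} (he : Function.Injective e) (heU : ∀ i, e i ∈ U) {t : Fin p → ℝ}
    (ht : Function.Injective t) (htD : ∀ i, t i ∈ D) :
    (Matrix.of fun i j => φ (e j) (t i)).det ≠ 0 := by
  classical
  intro h0
  obtain ⟨v, hv, hv0⟩ := Matrix.exists_mulVec_eq_zero_iff.2 h0
  apply hv
  have key := h (Finset.univ.image e) (Finset.univ.image t) (by
    intro x; simp; rintro i rfl; exact heU i) (by
    intro x; simp; rintro i rfl; exact htD i) (by
    rw [Finset.card_image_of_injective _ he, Finset.card_image_of_injective _ ht])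
    (Function.extend e v 0) (by
      intro x hx
      simp only [Finset.mem_image, Finset.mem_univ, true_and] at hx
      obtain ⟨i, rfl⟩ := hx
      rw [Finset.sum_image fun a _ b _ h => he h]
      have := congrFun hv0 i
      simp only [Matrix.mulVec, dotProduct, Matrix.of_apply, Pi.zero_apply] at this
      rw [← this]
      refine Finset.sum_congr rfl fun j _ => ?_
      rw [he.extend_apply, mul_comm])
  funext i
  have := key (e i) (Finset.mem_image_of_mem _ (Finset.mem_univ i))
  rwa [he.extend_apply] at this

lemma Cheb.mul {ι : Type*} {φ : ι → ℝ → ℝ} {U : Set ι} {D : Set ℝ} (h : Cheb φ U D)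
    {θ : ℝ → ℝ} (hθ : ∀ t ∈ D, θ t ≠ 0) : Cheb (fun i t => θ t * φ i t) U D := by
  intro S T hS hT hc c h0
  refine h S T hS hT hc c fun t ht => ?_
  have := h0 t ht
  simp only [mul_left_comm _ (θ t), ← Finset.mul_sum] at this
  exact (mul_eq_zero.1 this).resolve_left (hθ t (hT ht))

lemma cheb_cauchy {D Δ : Set ℝ} (hd : Disjoint D Δ) :
    Cheb (fun x t : ℝ => (x - t)⁻¹) D Δ := by
  classical
  intro S T hS hT hc c h0 x hx
  set Q : ℝ[X] := ∑ x ∈ S, C (c x) * ∏ y ∈ S.erase x, (C y - X) with hQ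
  have hne : ∀ x ∈ S, ∀ t ∈ T, x - t ≠ 0 := fun x hx t ht h =>
    hd.le_bot ⟨hS hx, by rw [sub_eq_zero.1 h]; exact hT ht⟩
  have hdeg : Q.degree < T.card := by
    refine lt_of_le_of_lt (degree_sum_le _ _) ?_
    rw [Finset.sup_lt_iff (by exact WithBot.bot_lt_coe _)]
    intro y hy
    refine lt_of_le_of_lt (degree_mul_le _ _) ?_
    have h1 : (∏ y ∈ S.erase y, (C y - X) : ℝ[X]).degree ≤ ((S.card - 1 : ℕ) : WithBot ℕ) := by
      rw [degree_prod]
      refine (Finset.sum_le_card_nsmul _ _ 1 ?_).trans ?_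
      · intro z _
        rw [← neg_sub, degree_neg, degree_X_sub_C]
      · rw [Finset.card_erase_of_mem hy]
        simp
    refine lt_of_le_of_lt (add_le_add degree_C_le h1) ?_
    rw [zero_add]
    have := Finset.card_pos.2 ⟨y, hy⟩
    exact_mod_cast (by omega : S.card - 1 < T.card)
  have hQ0 : Q = 0 := by
    refine Polynomial.eq_zero_of_degree_lt_of_eval_finset_eq_zero T hdeg fun t ht => ?_
    have h1 : Q.eval t = (∏ y ∈ S, (y - t)) * ∑ x ∈ S, c x * (x - t)⁻¹ := by
      rw [hQ, eval_finsetSum, Finset.mul_sum]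
      refine Finset.sum_congr rfl fun y hy => ?_
      rw [eval_mul, eval_prod, ← Finset.mul_prod_erase S _ hy]
      have := hne y hy t ht
      simp only [eval_C, eval_sub, eval_X]
      field_simp
    rw [h1, h0 t ht, mul_zero]
  have h2 : Q.eval x = c x * ∏ y ∈ S.erase x, (y - x) := by
    rw [hQ, eval_finsetSum, Finset.sum_eq_single x]
    · simp [eval_prod]
    · intro y hy hyx
      rw [eval_mul, eval_prod, Finset.prod_eq_zero (i := x)]
      · simp
      · simp [hx, Ne.symm hyx]
      · simp
    · exact fun h => absurd hx h
  rw [hQ0, eval_zero] at h2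
  refine (mul_eq_zero.1 h2.symm).resolve_right ?_
  refine Finset.prod_ne_zero_iff.2 fun y hy => ?_
  exact sub_ne_zero.2 (Finset.ne_of_mem_erase hy)

lemma exists_sign_det {p : ℕ} {Δ : Set ℝ} (hΔ : Δ.OrdConnected) {φ : Fin p → ℝ → ℝ}
    (hc : ∀ i, ContinuousOn (φ i) Δ)
    (h : ∀ t : Fin p → ℝ, Function.Injective t → (∀ i, t i ∈ Δ) →
      (Matrix.of fun i j => φ j (t i)).det ≠ 0) :
    ∃ δ : ℝ, δ ≠ 0 ∧ ∀ t : Fin p → ℝ, StrictMono t → (∀ i, t i ∈ Δ) →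
      0 < δ * (Matrix.of fun i j => φ j (t i)).det := by
  set K : Set (Fin p → ℝ) := {t | StrictMono t ∧ ∀ i, t i ∈ Δ} with hK
  have hconv : Convex ℝ K := by
    intro x hx y hy a b ha hb hab
    refine ⟨fun i j hij => ?_, fun i => ?_⟩
    · have h1 := hx.1 hij
      have h2 := hy.1 hij
      simp only [Pi.add_apply, Pi.smul_apply, smul_eq_mul]
      rcases ha.eq_or_lt with rfl | ha
      · have : b = 1 := by linarith
        subst this
        linarith
      · nlinarith [mul_lt_mul_of_pos_left h1 ha, mul_le_mul_of_nonneg_left h2.le hb]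
    · exact hΔ.convex (hx.2 i) (hy.2 i) ha hb hab
  have hcont : ContinuousOn (fun t : Fin p → ℝ => (Matrix.of fun i j => φ j (t i)).det) K := by
    simp only [Matrix.det_apply]
    refine continuousOn_finsetSum _ fun σ _ => ?_
    refine ContinuousOn.const_smul ?_ _
    refine continuousOn_finsetProd _ fun i _ => ?_
    exact (hc i).comp (continuous_apply _).continuousOn fun t ht => ht.2 _
  have hne : ∀ t ∈ K, (Matrix.of fun i j => φ j (t i)).det ≠ 0 := fun t ht => h t ht.1.injective ht.2
  by_cases hp : ∀ t ∈ K, 0 < (Matrix.of fun i j => φ j (t i)).det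
  · exact ⟨1, one_ne_zero, fun t h1 h2 => by simpa using hp t ⟨h1, h2⟩⟩
  · push Not at hp
    obtain ⟨y, hy, hy0⟩ := hp
    refine ⟨-1, by norm_num, fun x h1 h2 => ?_⟩
    by_contra! hx0
    obtain ⟨u, hu, hu0⟩ := hconv.isPreconnected.intermediate_value hy (show x ∈ K from ⟨h1, h2⟩) hcont
      (show (0 : ℝ) ∈ Icc _ _ from ⟨hy0, by linarith⟩)
    exact hne u hu hu0

lemma exists_sign_det_mul_det {p : ℕ} {Δ : Set ℝ} (hΔ : Δ.OrdConnected) {φ ψ : Fin p → ℝ → ℝ}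
    (hc : ∀ i, ContinuousOn (φ i) Δ) (hc' : ∀ i, ContinuousOn (ψ i) Δ)
    (h : ∀ t : Fin p → ℝ, Function.Injective t → (∀ i, t i ∈ Δ) →
      (Matrix.of fun i j => φ j (t i)).det ≠ 0)
    (h' : ∀ t : Fin p → ℝ, Function.Injective t → (∀ i, t i ∈ Δ) →
      (Matrix.of fun i j => ψ j (t i)).det ≠ 0) :
    ∃ δ : ℝ, δ ≠ 0 ∧ ∀ t : Fin p → ℝ, (∀ i, t i ∈ Δ) →
      (Function.Injective t → 0 < δ * ((Matrix.of fun i j => φ j (t i)).det *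
        (Matrix.of fun i j => ψ j (t i)).det)) ∧
      0 ≤ δ * ((Matrix.of fun i j => φ j (t i)).det * (Matrix.of fun i j => ψ j (t i)).det) := by
  obtain ⟨δ, hδ, hδ'⟩ := exists_sign_det hΔ hc h
  obtain ⟨γ, hγ, hγ'⟩ := exists_sign_det hΔ hc' h'
  have key : ∀ t : Fin p → ℝ, (∀ i, t i ∈ Δ) →
      (Function.Injective t → 0 < δ * γ * ((Matrix.of fun i j => φ j (t i)).det *
        (Matrix.of fun i j => ψ j (t i)).det)) := by
    intro t ht hi
    set π := Tuple.sort t with hπ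
    have hm : StrictMono (t ∘ π) :=
      (Tuple.monotone_sort t).strictMono_of_injective (hi.comp π.injective)
    have h1 := hδ' _ hm fun i => ht _
    have h2 := hγ' _ hm fun i => ht _
    have e1 : (Matrix.of fun i j => φ j ((t ∘ π) i)) =
      (Matrix.of fun i j => φ j (t i)).submatrix π id := by ext; simp
    have e2 : (Matrix.of fun i j => ψ j ((t ∘ π) i)) =
      (Matrix.of fun i j => ψ j (t i)).submatrix π id := by ext; simp
    rw [e1, Matrix.det_permute] at h1
    rw [e2, Matrix.det_permute] at h2
    have h3 := mul_pos h1 h2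
    have h4 : ((Equiv.Perm.sign π : ℤ) : ℝ) * ((Equiv.Perm.sign π : ℤ) : ℝ) = 1 := by
      rcases Int.units_eq_one_or (Equiv.Perm.sign π) with h | h <;> simp [h]
    have h5 : ∀ a b x y σ : ℝ, a * (σ * x) * (b * (σ * y)) = a * b * (x * y) * (σ * σ) := by
      intros; ring
    rwa [h5, h4, mul_one] at h3
  refine ⟨δ * γ, mul_ne_zero hδ hγ, fun t ht => ⟨key t ht, ?_⟩⟩
  by_cases hi : Function.Injective t
  · exact (key t ht hi).le
  · rw [Function.Injective] at hi
    push Not at hi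
    obtain ⟨i, j, hij, hne⟩ := hi
    rw [Matrix.det_zero_of_row_eq hne (by funext k; simp [hij])]
    simp

lemma integral_det_mul_prod {p : ℕ} (μ : Measure ℝ) [IsFiniteMeasure μ] {φ g : Fin p → ℝ → ℝ}
    (hinteg : ∀ i j, Integrable (fun x => φ i x * g j x) μ) :
    Integrable (fun t : Fin p → ℝ => (Matrix.of fun i j => φ j (t i)).det * ∏ i, g i (t i))
      (Measure.pi fun _ => μ) ∧
    ∫ t : Fin p → ℝ, (Matrix.of fun i j => φ j (t i)).det * ∏ i, g i (t i)
      ∂(Measure.pi fun _ => μ) = (Matrix.of fun i j => ∫ x, φ j x * g i x ∂μ).det := by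
  have e : (fun t : Fin p → ℝ => (Matrix.of fun i j => φ j (t i)).det * ∏ i, g i (t i)) =
      fun t : Fin p → ℝ => ∑ σ : Equiv.Perm (Fin p), ((Equiv.Perm.sign σ : ℤ) : ℝ) *
        ∏ i, (φ (σ i) (t i) * g i (t i)) := by
    funext t
    rw [← Matrix.det_transpose, Matrix.det_apply', Finset.sum_mul]
    refine Finset.sum_congr rfl fun σ _ => ?_
    rw [mul_assoc, ← Finset.prod_mul_distrib]
    rfl
  have hi : ∀ σ : Equiv.Perm (Fin p), Integrable (fun t : Fin p → ℝ =>
      ((Equiv.Perm.sign σ : ℤ) : ℝ) * ∏ i, (φ (σ i) (t i) * g i (t i)))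
      (Measure.pi fun _ => μ) := fun σ =>
    (Integrable.fintype_prod (f := fun i x => φ (σ i) x * g i x) fun i => hinteg _ _).const_mul _
  refine ⟨?_, ?_⟩
  · rw [e]
    exact integrable_finsetSum _ fun σ _ => hi σ
  · rw [e, integral_finsetSum _ fun σ _ => hi σ, ← Matrix.det_transpose, Matrix.det_apply']
    refine Finset.sum_congr rfl fun σ _ => ?_
    rw [integral_const_mul, integral_fintype_prod_eq_prod (fun i x => φ (σ i) x * g i x)]
    rfl

namespace CSM.On

variable {s : CSM} {Δ : Set ℝ}

lemma gram_fin (h : s.On Δ) {p : ℕ} {φ ψ : Fin p → ℝ → ℝ}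
    (hc : ∀ i, ContinuousOn (φ i) Δ) (hc' : ∀ i, ContinuousOn (ψ i) Δ)
    (hφ : ∀ t : Fin p → ℝ, Function.Injective t → (∀ i, t i ∈ Δ) →
      (Matrix.of fun i j => φ j (t i)).det ≠ 0)
    (hψ : ∀ t : Fin p → ℝ, Function.Injective t → (∀ i, t i ∈ Δ) →
      (Matrix.of fun i j => ψ j (t i)).det ≠ 0) :
    (Matrix.of fun i j => ∫ x, φ j x * ψ i x ∂s.μ).det ≠ 0 := by
  classical
  have := h.fin
  intro h0
  set A : (Fin p → ℝ) → ℝ := fun t => (Matrix.of fun i j => φ j (t i)).det with hA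
  set B : (Fin p → ℝ) → ℝ := fun t => (Matrix.of fun i j => ψ j (t i)).det with hB
  have hBe : ∀ t, B t = ∑ σ : Equiv.Perm (Fin p), ((Equiv.Perm.sign σ : ℤ) : ℝ) *
      ∏ i, ψ (σ i) (t i) := by
    intro t
    rw [hB]
    simp only
    rw [← Matrix.det_transpose, Matrix.det_apply']
    rfl
  have hinteg : ∀ i j, Integrable (fun x => φ i x * ψ j x) s.μ := fun i j =>
    h.integrable ((hc i).mul (hc' j))
  have hAσ := fun σ : Equiv.Perm (Fin p) =>
    integral_det_mul_prod s.μ (φ := φ) (g := fun i => ψ (σ i)) fun i j => hinteg _ _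
  have e : (fun t => A t * B t) = fun t => ∑ σ : Equiv.Perm (Fin p), ((Equiv.Perm.sign σ : ℤ) : ℝ) *
      (A t * ∏ i, ψ (σ i) (t i)) := by
    funext t
    rw [hBe, Finset.mul_sum]
    exact Finset.sum_congr rfl fun σ _ => by ring
  have hABi : Integrable (fun t => A t * B t) (Measure.pi fun _ => s.μ) := by
    rw [e]
    exact integrable_finsetSum _ fun σ _ => (hAσ σ).1.const_mul _
  have hAB0 : ∫ t, A t * B t ∂(Measure.pi fun _ => s.μ) = 0 := by
    rw [e, integral_finsetSum _ fun σ _ => (hAσ σ).1.const_mul _]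
    refine Finset.sum_eq_zero fun σ _ => ?_
    rw [integral_const_mul, (hAσ σ).2]
    have : (Matrix.of fun i j => ∫ x, φ j x * ψ (σ i) x ∂s.μ) =
      (Matrix.of fun i j => ∫ x, φ j x * ψ i x ∂s.μ).submatrix σ id := by ext; simp
    rw [this, Matrix.det_permute, h0, mul_zero, mul_zero]
  obtain ⟨δ, hδ, hδ'⟩ := exists_sign_det_mul_det h.cvx hc hc' hφ hψ
  have hae : ∀ᵐ t ∂(Measure.pi fun _ : Fin p => s.μ), ∀ i, t i ∈ Δ := by
    rw [eventually_all]
    intro i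
    exact (Measure.quasiMeasurePreserving_eval (fun _ : Fin p => s.μ) i).ae h.ae_mem
  have hnn : 0 ≤ᵐ[Measure.pi fun _ : Fin p => s.μ] fun t => δ * (A t * B t) := by
    filter_upwards [hae] with t ht
    exact (hδ' t ht).2
  have hz : ∫ t, δ * (A t * B t) ∂(Measure.pi fun _ : Fin p => s.μ) = 0 := by
    rw [integral_const_mul, hAB0, mul_zero]
  rw [integral_eq_zero_iff_of_nonneg_ae hnn (hABi.const_mul _)] at hz
  obtain ⟨F, hF, hFc⟩ := h.inf.exists_subset_card_eq p
  set u : Fin p → ℝ := fun i => (F.equivFin.symm (Fin.cast hFc.symm i) : ℝ) with hu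
  have huinj : Function.Injective u := by
    intro i j hij
    have := F.equivFin.symm.injective (Subtype.ext hij)
    simpa using this
  have husupp : ∀ i, u i ∈ s.μ.support := fun i => hF (F.equivFin.symm _).2
  obtain ⟨V, hV, hVd⟩ := (Set.finite_range u).t2_separation
  have hpos : 0 < (Measure.pi fun _ : Fin p => s.μ) (Set.univ.pi fun i => V (u i)) := by
    rw [Measure.pi_pi]
    refine pos_iff_ne_zero.2 (Finset.prod_ne_zero_iff.2 fun i _ => ?_)
    exact ((Measure.mem_support_iff_forall _).1 (husupp i) _
      ((hV (u i)).2.mem_nhds (hV (u i)).1)).ne'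
  refine hpos.ne' (measure_mono_null (fun t ht => ?_) (hz.and hae))
  rintro ⟨h1, h2⟩
  refine ((hδ' t h2).1 fun i j hij => ?_).ne' h1
  by_contra hne
  have h3 := hVd ⟨i, rfl⟩ ⟨j, rfl⟩ (huinj.ne hne)
  have h4 := ht i trivial
  rw [hij] at h4
  exact h3.le_bot ⟨h4, ht j trivial⟩

/-- Nondegeneracy of the Gram matrix of two Chebyshev systems. -/
lemma gram (h : s.On Δ) {ι κ : Type*} {φ : ι → ℝ → ℝ} {ψ : κ → ℝ → ℝ} {U : Set ι} {V : Set κ}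
    (hφ : Cheb φ U Δ) (hψ : Cheb ψ V Δ) (hc : ∀ i ∈ U, ContinuousOn (φ i) Δ)
    (hc' : ∀ i ∈ V, ContinuousOn (ψ i) Δ) {S : Finset ι} {T : Finset κ} (hS : ↑S ⊆ U)
    (hT : ↑T ⊆ V) (hcard : T.card ≤ S.card) {c : κ → ℝ}
    (h0 : ∀ i ∈ S, ∑ j ∈ T, c j * ∫ x, φ i x * ψ j x ∂s.μ = 0) : ∀ j ∈ T, c j = 0 := by
  obtain ⟨S', hS', hc1⟩ := Finset.exists_subset_card_eq hcard
  set p := T.card with hp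
  set e : Fin p → ι := fun i => (S'.equivFin.symm (Fin.cast hc1.symm i) : ι) with he
  set f : Fin p → κ := fun i => (T.equivFin.symm i : κ) with hf
  have heinj : Function.Injective e := by
    intro i j hij
    have := S'.equivFin.symm.injective (Subtype.ext hij)
    simpa using this
  have hfinj : Function.Injective f := by
    intro i j hij
    have := T.equivFin.symm.injective (Subtype.ext hij)
    simpa using this
  have heS : ∀ i, e i ∈ S := fun i => hS' (S'.equivFin.symm _).2
  have hfT : ∀ i, f i ∈ T := fun i => (T.equivFin.symm _).2
  have hdet := h.gram_fin (φ := fun i => φ (e i)) (ψ := fun i => ψ (f i))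
    (fun i => hc _ (hS (heS i))) (fun i => hc' _ (hT (hfT i)))
    (fun t ht htD => hφ.det_ne_zero heinj (fun i => hS (heS i)) ht htD)
    (fun t ht htD => hψ.det_ne_zero hfinj (fun i => hT (hfT i)) ht htD)
  have hv := Matrix.eq_zero_of_vecMul_eq_zero hdet (v := fun i => c (f i)) (by
    funext i
    have := h0 (e i) (heS i)
    rw [← Finset.sum_coe_sort T, ← Equiv.sum_comp T.equivFin.symm] at this
    exact this)
  intro j hj
  have := congrFun hv (T.equivFin ⟨j, hj⟩)
  simpa [hf] using this

/-- Cauchy transforms of a Chebyshev system, together with the constant `1`, form a Chebyshev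
system. -/
lemma cheb_lift (h : s.On Δ) {κ : Type*} {ψ : κ → ℝ → ℝ} {V : Set κ} (hψ : Cheb ψ V Δ)
    (hc : ∀ i ∈ V, ContinuousOn (ψ i) Δ) {D : Set ℝ} (hd : Disjoint D Δ) {g : κ → ℝ → ℝ} {o : κ}
    (ho : ∀ x, g o x = 1) (hoV : o ∉ V) {γ : ℝ} (hγ : γ ≠ 0)
    (hg : ∀ k ∈ V, ∀ x ∈ D, g k x = γ * ∫ t, ψ k t * (x - t)⁻¹ ∂s.μ) :
    Cheb g (insert o V) D := by
  classical
  have hker : ∀ x ∈ D, ContinuousOn (fun t : ℝ => (x - t)⁻¹) Δ := fun x hx =>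
    ContinuousOn.inv₀ (by fun_prop) fun t ht h0 =>
      hd.le_bot ⟨hx, by rw [sub_eq_zero.1 h0]; exact ht⟩
  intro S T hS hT hcard c h0
  by_cases hoS : o ∈ S
  · obtain ⟨x0, hx0⟩ : T.Nonempty := by
      rw [← Finset.card_pos]
      exact (Finset.card_pos.2 ⟨o, hoS⟩).trans_le hcard
    have hx0D := hT hx0
    have hSV : ∀ k ∈ S.erase o, k ∈ V := fun k hk =>
      (hS (Finset.mem_of_mem_erase hk)).resolve_left (Finset.ne_of_mem_erase hk)
    have key : ∀ k ∈ S.erase o, c k = 0 := by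
      refine h.gram (S := T.erase x0) (U := D)
        (φ := fun x t => (x0 - t)⁻¹ * (x - t)⁻¹) ((cheb_cauchy hd).mul ?_) hψ ?_ hc ?_ ?_ ?_ ?_
      · exact fun t ht => inv_ne_zero fun h0 =>
          hd.le_bot ⟨hx0D, by rw [sub_eq_zero.1 h0]; exact ht⟩
      · exact fun x hx => (hker x0 hx0D).mul (hker x hx)
      · exact fun x hx => hT (Finset.mem_of_mem_erase hx)
      · exact hSV
      · rw [Finset.card_erase_of_mem hoS, Finset.card_erase_of_mem hx0]
        omega
      · intro x hx
        have hxD := hT (Finset.mem_of_mem_erase hx)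
        have h1 := h0 x (Finset.mem_of_mem_erase hx)
        have h2 := h0 x0 hx0
        rw [← Finset.add_sum_erase _ _ hoS, ho] at h1 h2
        have h3 : ∑ k ∈ S.erase o, c k * (g k x - g k x0) = 0 := by
          simp only [mul_sub, Finset.sum_sub_distrib]
          linarith
        have hne : γ * (x0 - x) ≠ 0 :=
          mul_ne_zero hγ (sub_ne_zero.2 (Finset.ne_of_mem_erase hx).symm)
        refine (mul_eq_zero.1 ?_).resolve_left hne
        rw [← h3, Finset.mul_sum]
        refine Finset.sum_congr rfl fun k hk => ?_
        have h6 : (∫ t, ψ k t * (x - t)⁻¹ ∂s.μ) - ∫ t, ψ k t * (x0 - t)⁻¹ ∂s.μ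
            = (x0 - x) * ∫ t, (x0 - t)⁻¹ * (x - t)⁻¹ * ψ k t ∂s.μ := by
          rw [← integral_sub (f := fun t => ψ k t * (x - t)⁻¹) (g := fun t => ψ k t * (x0 - t)⁻¹)
            (h.integrable ((hc k (hSV k hk)).mul (hker x hxD)))
            (h.integrable ((hc k (hSV k hk)).mul (hker x0 hx0D))), ← integral_const_mul]
          refine h.integral_congr fun t ht => ?_
          have h4 : x - t ≠ 0 := fun h0 =>
            hd.le_bot ⟨hxD, by rw [sub_eq_zero.1 h0]; exact ht⟩
          have h5 : x0 - t ≠ 0 := fun h0 =>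
            hd.le_bot ⟨hx0D, by rw [sub_eq_zero.1 h0]; exact ht⟩
          field_simp
          ring
        rw [hg k (hSV k hk) x hxD, hg k (hSV k hk) x0 hx0D, ← mul_sub, h6]
        ring
    intro k hk
    by_cases hko : k = o
    · subst hko
      have h2 := h0 x0 hx0
      rw [← Finset.add_sum_erase _ _ hoS, ho,
        Finset.sum_eq_zero fun k hk => by rw [key k hk, zero_mul]] at h2
      simpa using h2
    · exact key k (Finset.mem_erase.2 ⟨hko, hk⟩)
  · have hSV : ∀ k ∈ S, k ∈ V := fun k hk =>
      (hS hk).resolve_left fun h => hoS (h ▸ hk)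
    refine h.gram (S := T) (U := D) (cheb_cauchy hd) hψ hker hc hT hSV hcard ?_
    intro x hx
    have h1 := h0 x hx
    refine (mul_eq_zero.1 ?_).resolve_left hγ
    rw [← h1, Finset.mul_sum]
    refine Finset.sum_congr rfl fun k hk => ?_
    rw [hg k (hSV k hk) x (hT hx), mul_left_comm]
    congr 3
    funext t
    ring

end CSM.On

section Spectral

variable {H : Type*} [NormedAddCommGroup H] [InnerProductSpace ℂ H] [CompleteSpace H]

lemma exists_spectral_measure {Y : H →L[ℂ] H} (v : H) {Δ : Set ℝ}
    (hΔ : IsCompact Δ) (hspec : spectrum ℝ Y ⊆ Δ) :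
    ∃ ν : Measure ℝ, IsFiniteMeasure ν ∧ ν Δᶜ = 0 ∧ ∀ g : ℝ → ℝ, ContinuousOn g Δ →
      ∫ x, g x ∂ν = (inner ℂ v (cfc g Y v)).re := by
  classical
  have : CompactSpace Δ := isCompact_iff_compactSpace.mp hΔ
  let ext : (Δ → ℝ) → ℝ → ℝ := fun f x => if h : x ∈ Δ then f ⟨x, h⟩ else 0
  have hext : ∀ f : Δ → ℝ, Continuous f → ContinuousOn (ext f) Δ := by
    intro f hf
    rw [continuousOn_iff_continuous_domRestrict]
    convert hf using 1
    funext x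
    simp [ext]
  let Λ : CompactlySupportedContinuousMap Δ ℝ →ₚ[ℝ] ℝ :=
  { toFun f := (inner ℂ v (cfc (ext f) Y v)).re
    map_add' f g := by
      have : cfc (ext (f + g : CompactlySupportedContinuousMap Δ ℝ)) Y
          = cfc (ext f) Y + cfc (ext g) Y := by
        rw [← cfc_add (a := Y) (ext f) (ext g) ((hext f f.continuous).mono hspec)
          ((hext g g.continuous).mono hspec)]
        congr 1
        funext x
        by_cases h : x ∈ Δ <;> simp [ext, h]
      rw [this]
      simp
    map_smul' c f := by
      have : cfc (ext (c • f : CompactlySupportedContinuousMap Δ ℝ)) Y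
          = c • cfc (ext f) Y := by
        rw [← cfc_smul (a := Y) c (ext f) ((hext f f.continuous).mono hspec)]
        congr 1
        funext x
        by_cases h : x ∈ Δ <;> simp [ext, h]
      rw [this]
      simp
    monotone' f g hfg := by
      have h1 : cfc (ext f) Y ≤ cfc (ext g) Y := by
        refine cfc_mono (fun x hx => ?_) ((hext f f.continuous).mono hspec)
          ((hext g g.continuous).mono hspec)
        simp only [ext, hspec hx, dif_pos]
        exact hfg _
      rw [ContinuousLinearMap.le_def] at h1
      have h2 := h1.re_inner_nonneg_right v
      simp only [_root_.sub_apply, inner_sub_right, map_sub] at h2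
      simpa using h2 }
  refine ⟨(RealRMK.rieszMeasure Λ).map Subtype.val, inferInstance, ?_, fun g hg => ?_⟩
  · rw [Measure.map_apply (by fun_prop) hΔ.measurableSet.compl]
    simp
  · have h1 : ∫ x, g x ∂((RealRMK.rieszMeasure Λ).map Subtype.val)
        = ∫ x : Δ, g x ∂(RealRMK.rieszMeasure Λ) := by
      have hm : MeasurableEmbedding (Subtype.val : Δ → ℝ) :=
        MeasurableEmbedding.subtype_coe hΔ.measurableSet
      exact hm.integral_map _
    let g' : CompactlySupportedContinuousMap Δ ℝ :=
    { toFun := fun x => g x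
      continuous_toFun := continuousOn_iff_continuous_domRestrict.1 hg
      hasCompactSupport' := HasCompactSupport.of_compactSpace _ }
    rw [h1]
    have h2 := RealRMK.integral_rieszMeasure Λ g'
    have h3 : Λ g' = (inner ℂ v (cfc (ext g') Y v)).re := rfl
    rw [h3] at h2
    rw [show ∫ x : Δ, g x ∂(RealRMK.rieszMeasure Λ) = _ from h2]
    congr 3
    refine cfc_congr fun x hx => ?_
    simp only [ext, hspec hx, dif_pos]
    rfl

lemma inner_resolvent_eq {Y : H →L[ℂ] H} (hY : IsSelfAdjoint Y) {v : H} {Δ : Set ℝ}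
    {ν : Measure ℝ} [IsFiniteMeasure ν] (hΔ : IsCompact Δ) (h0 : ν Δᶜ = 0)
    (hν : ∀ g : ℝ → ℝ, ContinuousOn g Δ → ∫ x, g x ∂ν = (inner ℂ v (cfc g Y v)).re)
    {z : ℂ} (hz : z.im ≠ 0) {r : H} {q : ℂ} (hr : z • r - Y r = q • v) :
    inner ℂ v r = q * ∫ x : ℝ, (z - x)⁻¹ ∂ν := by
  have hne : ∀ x : ℝ, z - x ≠ 0 := by
    intro x h
    have := congrArg Complex.im h
    simp at this
    exact hz this
  set f : ℝ → ℝ := fun x => ((z - x)⁻¹).re with hf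
  set g : ℝ → ℝ := fun x => ((z - x)⁻¹).im with hg
  have hK : Continuous fun x : ℝ => (z - x)⁻¹ := Continuous.inv₀ (by fun_prop) hne
  have hfc : Continuous f := Complex.continuous_re.comp hK
  have hgc : Continuous g := Complex.continuous_im.comp hK
  have hfg : ∀ x, (z.re - x) * f x - z.im * g x = 1 ∧ (z.re - x) * g x + z.im * f x = 0 := by
    intro x
    have h1 : (z - x) * (z - x)⁻¹ = 1 := mul_inv_cancel₀ (hne x)
    have h2 := congrArg Complex.re h1
    have h3 := congrArg Complex.im h1
    simp only [Complex.mul_re, Complex.mul_im, Complex.sub_re, Complex.sub_im, Complex.ofReal_re,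
      Complex.ofReal_im, sub_zero, Complex.one_re, Complex.one_im] at h2 h3
    exact ⟨h2, by rw [add_comm] at h3; linarith⟩
  have hid : cfc (fun x : ℝ => z.re - x) Y = z.re • (1 : H →L[ℂ] H) - Y := by
    rw [cfc_sub (a := Y) (fun _ => z.re) (fun x => x) (by fun_prop) (by fun_prop), cfc_const _ _ hY,
      cfc_id' ℝ Y hY, Algebra.algebraMap_eq_smul_one]
  have h1 : cfc f Y * (z.re • (1 : H →L[ℂ] H) - Y) - z.im • cfc g Y = 1 := by
    rw [← hid, ← cfc_mul (a := Y) f (fun x => z.re - x) (by fun_prop) (by fun_prop),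
      ← cfc_smul (a := Y) _ _ (by fun_prop),
      ← cfc_sub (a := Y) _ _ (by fun_prop) (by fun_prop), ← cfc_one ℝ Y hY]
    congr 1
    funext x
    simp only [smul_eq_mul, Pi.one_apply]
    linarith [(hfg x).1]
  have h2 : cfc g Y * (z.re • (1 : H →L[ℂ] H) - Y) + z.im • cfc f Y = 0 := by
    rw [← hid, ← cfc_mul (a := Y) g (fun x => z.re - x) (by fun_prop) (by fun_prop),
      ← cfc_smul (a := Y) _ _ (by fun_prop),
      ← cfc_add (a := Y) _ _ (by fun_prop) (by fun_prop), ← cfc_zero ℝ Y]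
    congr 1
    funext x
    simp only [smul_eq_mul, Pi.zero_apply]
    linarith [(hfg x).2]
  have h3 := congrArg (fun A : H →L[ℂ] H => A r) h1
  have h4 := congrArg (fun A : H →L[ℂ] H => A r) h2
  have hap : ∀ A : H →L[ℂ] H, (A * (z.re • (1 : H →L[ℂ] H) - Y)) r = A (z.re • r - Y r) :=
    fun _ => rfl
  have h1r : (1 : H →L[ℂ] H) r = r := rfl
  simp only [_root_.sub_apply, _root_.add_apply, hap, h1r,
    _root_.smul_apply, _root_.zero_apply] at h3 h4
  have hYr : z.re • r - Y r = q • v - (z.im * Complex.I) • r := by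
    rw [← hr]
    have : z • r = z.re • r + (z.im * Complex.I) • r := by
      conv_lhs => rw [← Complex.re_add_im z, add_smul]
      rfl
    rw [this]
    abel
  rw [hYr] at h3 h4
  simp only [map_sub, map_smul] at h3 h4
  have h5 : r = q • (cfc f Y v + Complex.I • cfc g Y v) := by
    have e1 : z.im • (cfc g Y) r = (z.im : ℂ) • (cfc g Y) r := rfl
    have e2 : z.im • (cfc f Y) r = (z.im : ℂ) • (cfc f Y) r := rfl
    rw [e1] at h3
    rw [e2] at h4
    have h6 : r = r + Complex.I • (0 : H) := by simp
    rw [h6, ← h4]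
    nth_rewrite 1 [← h3]
    simp only [smul_add, smul_sub, smul_smul]
    have : Complex.I * (z.im * Complex.I) = - z.im := by
      linear_combination (z.im : ℂ) * Complex.I_mul_I
    rw [this, mul_comm Complex.I q, mul_comm Complex.I (z.im : ℂ)]
    module
  have hreal : ∀ k : ℝ → ℝ, Continuous k → inner ℂ v (cfc k Y v) = ((∫ x, k x ∂ν : ℝ) : ℂ) := by
    intro k hk
    rw [hν k hk.continuousOn]
    have hsa : IsSelfAdjoint (cfc k Y) := cfc_predicate k Y
    have := hsa.isSymmetric v v
    simp only [ContinuousLinearMap.coe_coe] at this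
    refine Complex.ext rfl ?_
    rw [← inner_conj_symm] at this
    have := congrArg Complex.im this
    simp only [Complex.conj_im] at this
    simp only [Complex.ofReal_im]
    linarith
  have hinteg : ∀ k : ℝ → ℝ, Continuous k → Integrable k ν := by
    intro k hk
    have h1 : IntegrableOn k Δ ν := hk.continuousOn.integrableOn_compact hΔ
    rwa [IntegrableOn, Measure.restrict_eq_self_of_ae_mem (by exact h0)] at h1
  rw [h5, inner_smul_right, inner_add_right, inner_smul_right, hreal f hfc, hreal g hgc]
  congr 1
  rw [← integral_complex_ofReal, ← integral_complex_ofReal, ← integral_const_mul, ← integral_add]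
  · congr 1
    funext x
    rw [mul_comm]
    exact Complex.re_add_im _
  · exact (hinteg f hfc).ofReal
  · exact (hinteg g hgc).ofReal.const_mul _

/-- Invertibility of a rank one perturbation. -/
lemma isUnit_add_rankOne {A R : H →L[ℂ] H} (hA : IsSelfAdjoint A)
    (hAR : A * R = 1) {κ : ℝ} {v : H} (h : 1 + κ * inner ℂ v (R v) ≠ 0) :
    IsUnit (A + (κ : ℂ) • InnerProductSpace.rankOne ℂ v v) := by
  set A' := A + (κ : ℂ) • InnerProductSpace.rankOne ℂ v v with hA'
  set β : ℂ := κ / (1 + κ * inner ℂ v (R v)) with hβ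
  have hβ' : κ - β * (1 + κ * inner ℂ v (R v)) = 0 := by
    rw [hβ, div_mul_cancel₀ _ h, sub_self]
  have hARv : ∀ x, A (R x) = x := fun x => congrArg (fun T : H →L[ℂ] H => T x) hAR
  let B : H →L[ℂ] H := R - β • InnerProductSpace.rankOne ℂ (R v) (ContinuousLinearMap.adjoint R v)
  have hAB : A' * B = 1 := by
    ext x
    have e : (A' * B) x = A (R x - (β * inner ℂ (ContinuousLinearMap.adjoint R v) x) • R v)
        + (κ * inner ℂ v (R x - (β * inner ℂ (ContinuousLinearMap.adjoint R v) x) • R v)) • v := by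
      have e0 : (A' * B) x = A' (B x) := rfl
      rw [e0]
      simp only [hA', B, _root_.add_apply, _root_.sub_apply,
        _root_.smul_apply, InnerProductSpace.rankOne_apply, smul_smul]
    rw [e, map_sub, map_smul, hARv, hARv, ContinuousLinearMap.adjoint_inner_left, inner_sub_right,
      inner_smul_right, show (1 : H →L[ℂ] H) x = x from rfl]
    have e2 : x - (β * inner ℂ v (R x)) • v
        + (κ * (inner ℂ v (R x) - β * inner ℂ v (R x) * inner ℂ v (R v))) • v
        = x + (inner ℂ v (R x) * (κ - β * (1 + κ * inner ℂ v (R v)))) • v := by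
      module
    rw [e2, hβ']
    simp
  have hsa : star A' = A' := by
    rw [hA', star_add, hA.star_eq, star_smul]
    congr 2
    · simp
    · rw [ContinuousLinearMap.star_eq_adjoint, InnerProductSpace.adjoint_rankOne]
  have hBA : star B * A' = 1 := by
    have := congrArg star hAB
    rwa [star_mul, hsa, star_one] at this
  exact isUnit_iff_exists.2 ⟨B, hAB, by rw [← left_inv_eq_right_inv hBA hAB]; exact hBA⟩

end Spectral

lemma exists_measure_rankOne {H : Type*} [NormedAddCommGroup H] [InnerProductSpace ℂ H]
    [CompleteSpace H] {X : H →L[ℂ] H} (hX : IsSelfAdjoint X) {v : H} {Δ : Set ℝ}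
    (hΔ : IsCompact Δ) {κ : ℝ}
    (hR : ∀ x : ℝ, x ∉ Δ → ∃ R : H →L[ℂ] H, ((x : ℂ) • (1 : H →L[ℂ] H) - X) * R = 1 ∧
      1 + κ * inner ℂ v (R v) ≠ 0) :
    ∃ ν : Measure ℝ, IsFiniteMeasure ν ∧ ν Δᶜ = 0 ∧ ∀ z : ℂ, z.im ≠ 0 → ∀ r : H,
      z • r - X r = v → inner ℂ v r = (1 + κ * inner ℂ v r) * ∫ x : ℝ, (z - x)⁻¹ ∂ν := by
  set K : H →L[ℂ] H := InnerProductSpace.rankOne ℂ v v with hK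
  have hKs : IsSelfAdjoint K := by
    rw [IsSelfAdjoint, ContinuousLinearMap.star_eq_adjoint, InnerProductSpace.adjoint_rankOne]
  have hκ : IsSelfAdjoint (κ : ℂ) := by simp [IsSelfAdjoint]
  set Y := X - (κ : ℂ) • K with hY
  have hYs : IsSelfAdjoint Y := hX.sub (hκ.smul hKs)
  have hspec : spectrum ℝ Y ⊆ Δ := by
    intro x hx
    by_contra hxΔ
    obtain ⟨R, hR1, hR2⟩ := hR x hxΔ
    have hx' : IsSelfAdjoint (x : ℂ) := by simp [IsSelfAdjoint]
    have := isUnit_add_rankOne ((hx'.smul (IsSelfAdjoint.one _)).sub hX) hR1 hR2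
    apply hx
    rw [spectrum.mem_resolventSet_iff, Algebra.algebraMap_eq_smul_one]
    convert this using 1
    rw [hY]
    have e : x • (1 : H →L[ℂ] H) = (x : ℂ) • (1 : H →L[ℂ] H) := rfl
    rw [e]
    abel
  obtain ⟨ν, hν1, hν2, hν3⟩ := exists_spectral_measure v hΔ hspec
  refine ⟨ν, hν1, hν2, fun z hz r hr => inner_resolvent_eq hYs hΔ hν2 hν3 hz ?_⟩
  have e : Y r = X r - (κ * inner ℂ v r) • v := by
    simp only [hY, _root_.sub_apply, _root_.smul_apply, hK, InnerProductSpace.rankOne_apply,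
      smul_smul]
  rw [e, ← sub_add, hr, add_smul, one_smul]

namespace CSM.On

variable {s : CSM} {Δ : Set ℝ}

lemma exists_mulOp (h : s.On Δ) {F : ℝ → ℂ} (hF : ContinuousOn F Δ) :
    ∃ M : Lp ℂ 2 s.μ →L[ℂ] Lp ℂ 2 s.μ, ∀ f, ∀ᵐ x ∂s.μ, M f x = F x * f x := by
  have := h.fin
  have hm : AEStronglyMeasurable F s.μ := by
    rw [← h.restrict]
    exact hF.aestronglyMeasurable h.cpt.measurableSet
  obtain ⟨C, hC⟩ := h.cpt.exists_bound_of_continuousOn hF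
  have hL : MemLp F ⊤ s.μ := memLp_top_of_bound hm C (by
    filter_upwards [h.ae_mem] with x hx using hC x hx)
  refine ⟨ContinuousLinearMap.holderL s.μ ⊤ 2 2 (ContinuousLinearMap.mul ℂ ℂ) hL.toLp, ?_⟩
  intro f
  have h1 := (ContinuousLinearMap.mul ℂ ℂ).coeFn_holder (r := 2) (f := hL.toLp) (g := f)
  filter_upwards [h1, hL.coeFn_toLp] with x hx hx2
  rw [← hx2]
  exact hx

lemma memLp (h : s.On Δ) {F : ℝ → ℂ} (hF : ContinuousOn F Δ) : MemLp F 2 s.μ := by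
  have := h.fin
  have hm : AEStronglyMeasurable F s.μ := by
    rw [← h.restrict]
    exact hF.aestronglyMeasurable h.cpt.measurableSet
  obtain ⟨C, hC⟩ := h.cpt.exists_bound_of_continuousOn hF
  exact MemLp.of_bound hm C (by filter_upwards [h.ae_mem] with x hx using hC x hx)

lemma exists_inv_measure (h : s.On Δ) {c : ℝ} (hc : c ≠ 0)
    (h0 : ∀ x : ℝ, x ∉ Δ → c + ctr s (fun _ => 1) x ≠ 0) :
    ∃ ν : Measure ℝ, IsFiniteMeasure ν ∧ ν Δᶜ = 0 ∧ ∀ z : ℂ, z.im ≠ 0 →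
      (c + ctr s (fun _ => 1) z) * (c⁻¹ - s.ε * (c⁻¹ * c⁻¹ * ∫ x : ℝ, (z - x)⁻¹ ∂ν)) = 1 := by
  have := h.fin
  obtain ⟨X, hX⟩ := h.exists_mulOp (F := fun x => (x : ℂ)) (by fun_prop)
  have hv := h.memLp (F := fun _ => 1) (by fun_prop)
  set v : Lp ℂ 2 s.μ := hv.toLp with hvdef
  have hve : ∀ᵐ x ∂s.μ, v x = 1 := hv.coeFn_toLp
  have hsa : IsSelfAdjoint X := by
    rw [ContinuousLinearMap.isSelfAdjoint_iff_isSymmetric]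
    intro f g
    rw [L2.inner_def, L2.inner_def]
    apply integral_congr_ae
    filter_upwards [hX f, hX g] with x h1 h2
    simp only [ContinuousLinearMap.coe_coe, h1, h2, RCLike.inner_apply, map_mul, Complex.conj_ofReal]
    ring
  have hinner : ∀ (F : ℝ → ℂ) (r : Lp ℂ 2 s.μ), (∀ᵐ x ∂s.μ, r x = F x) →
      inner ℂ v r = ∫ x, F x ∂s.μ := by
    intro F r hr
    rw [L2.inner_def]
    apply integral_congr_ae
    filter_upwards [hve, hr] with x h1 h2
    simp [h1, h2]
  have hκ : ∀ z : ℂ, 1 + ((s.ε / c : ℝ) : ℂ) * ∫ x : ℝ, (z - x)⁻¹ ∂s.μ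
      = (c : ℂ)⁻¹ * (c + ctr s (fun _ => 1) z) := by
    intro z
    have : (c : ℂ) ≠ 0 := by exact_mod_cast hc
    simp only [ctr, one_mul]
    push_cast
    field_simp
  obtain ⟨ν, hν1, hν2, hν3⟩ := exists_measure_rankOne hsa (v := v) h.cpt (κ := s.ε / c) (by
    intro x hx
    have hne : ∀ y ∈ Δ, (x : ℂ) - y ≠ 0 := by
      intro y hy
      exact notMem_cSet (by rwa [mem_cSet_ofReal]) hy
    obtain ⟨R, hR⟩ := h.exists_mulOp (F := fun y => ((x : ℂ) - y)⁻¹)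
      (ContinuousOn.inv₀ (by fun_prop) hne)
    refine ⟨R, ?_, ?_⟩
    · ext1 f
      apply Lp.ext
      have e : (((x : ℂ) • (1 : Lp ℂ 2 s.μ →L[ℂ] Lp ℂ 2 s.μ) - X) * R) f
        = (x : ℂ) • R f - X (R f) := rfl
      rw [e]
      filter_upwards [hX (R f), hR f, Lp.coeFn_sub ((x : ℂ) • R f) (X (R f)),
        Lp.coeFn_smul (x : ℂ) (R f), h.ae_mem] with y h1 h2 h3 h4 h5
      rw [h3, Pi.sub_apply, h1, h4, Pi.smul_apply, h2]
      have := hne y h5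
      change _ = f y
      rw [smul_eq_mul]
      field_simp
    · rw [hinner (fun y => ((x : ℂ) - y)⁻¹), hκ]
      · refine mul_ne_zero (by simpa using hc) (h0 x hx)
      · filter_upwards [hR v, hve] with y h1 h2
        rw [h1, h2, mul_one])
  refine ⟨ν, hν1, hν2, fun z hz => ?_⟩
  have hne : ∀ y : ℝ, z - y ≠ 0 := fun y hy => hz (by simpa using congrArg Complex.im hy)
  have hr := h.memLp (F := fun y => (z - y)⁻¹)
    (ContinuousOn.inv₀ (by fun_prop) fun y _ => hne y)
  set r : Lp ℂ 2 s.μ := hr.toLp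
  have hre : ∀ᵐ x ∂s.μ, r x = (z - x)⁻¹ := hr.coeFn_toLp
  have key := hν3 z hz r (by
    apply Lp.ext
    filter_upwards [hX r, hre, hve, Lp.coeFn_sub (z • r) (X r),
        Lp.coeFn_smul z r] with y h1 h2 h3 h4 h5
    rw [h4, Pi.sub_apply, h1, h5, Pi.smul_apply, h2, h3, smul_eq_mul, ← sub_mul,
      mul_inv_cancel₀ (hne y)])
  rw [hinner _ _ hre, hκ] at key
  have hc' : (c : ℂ) ≠ 0 := by exact_mod_cast hc
  have e : ctr s (fun _ => 1) z = s.ε * ∫ x : ℝ, (z - x)⁻¹ ∂s.μ := by simp [ctr]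
  set N := ∫ x : ℝ, (z - x)⁻¹ ∂ν
  set m := ∫ x : ℝ, (z - x)⁻¹ ∂s.μ
  set S := ctr s (fun _ => 1) z
  have : (c + S) * ((c:ℂ)⁻¹ - s.ε * ((c:ℂ)⁻¹ * (c:ℂ)⁻¹ * N))
    = (c + S) * (c:ℂ)⁻¹ - s.ε * (c:ℂ)⁻¹ * ((c:ℂ)⁻¹ * (c + S) * N) := by ring
  push_cast
  rw [this, ← key, add_mul, mul_inv_cancel₀ hc', e]
  ring

end CSM.On

lemma natDegree_le_of_norm_aeval_le (e : ℕ) : ∀ {Q : ℝ[X]} {C : ℝ},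
    (∀ᶠ y : ℝ in atTop, ‖aeval (Complex.I * y) Q‖ ≤ C * y ^ e) → Q.natDegree ≤ e := by
  induction e with
  | zero =>
    intro Q C h
    by_contra! hd
    have hd' : 0 < (Q.map (algebraMap ℝ ℂ)).degree := by
      rw [degree_map]
      exact natDegree_pos_iff_degree_pos.1 hd
    have ht := Polynomial.tendsto_norm_atTop (Q.map (algebraMap ℝ ℂ)) hd' (l := atTop)
      (z := fun y : ℝ => Complex.I * y) (by
        simpa using tendsto_abs_atTop_atTop)
    obtain ⟨y, h1, h2⟩ := (h.and (ht.eventually_gt_atTop C)).exists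
    simp only [pow_zero, mul_one, eval_map_algebraMap] at h1 h2
    linarith
  | succ e ih =>
    intro Q C h
    have := @ih Q.divX (C + |Q.coeff 0|) (by
      filter_upwards [h, eventually_ge_atTop 1] with y hy hy1
      have e1 : aeval (Complex.I * y) Q
          = Complex.I * y * aeval (Complex.I * y) Q.divX + Q.coeff 0 := by
        have := congrArg (aeval (Complex.I * (y : ℂ))) (X_mul_divX_add Q)
        simp only [map_add, map_mul, aeval_X, aeval_C, Complex.coe_algebraMap] at this
        exact this.symm
      have e2 : y * ‖aeval (Complex.I * y) Q.divX‖ ≤ C * y ^ (e + 1) + |Q.coeff 0| := by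
        have : ‖Complex.I * y * aeval (Complex.I * y) Q.divX‖
            = y * ‖aeval (Complex.I * y) Q.divX‖ := by
          rw [norm_mul, norm_mul, Complex.norm_I, one_mul, Complex.norm_real, Real.norm_eq_abs,
            abs_of_nonneg (by linarith)]
        rw [← this, eq_sub_of_add_eq e1.symm]
        refine (norm_sub_le _ _).trans ?_
        rw [Complex.norm_real, Real.norm_eq_abs]
        linarith
      have e3 : |Q.coeff 0| ≤ |Q.coeff 0| * y ^ (e + 1) :=
        le_mul_of_one_le_right (abs_nonneg _) (one_le_pow₀ hy1)
      have e4 : y * ‖aeval (Complex.I * y) Q.divX‖ ≤ y * ((C + |Q.coeff 0|) * y ^ e) := by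
        calc _ ≤ _ := e2
          _ ≤ C * y ^ (e + 1) + |Q.coeff 0| * y ^ (e + 1) := by linarith
          _ = _ := by ring
      exact le_of_mul_le_mul_left e4 (by linarith))
    rw [natDegree_divX_eq_natDegree_tsub_one] at this
    omega

lemma eq_zero_of_norm_aeval_le {Q : ℝ[X]} {C : ℝ}
    (h : ∀ᶠ y : ℝ in atTop, ‖aeval (Complex.I * y) Q‖ ≤ C * y⁻¹) : Q = 0 := by
  have h1 := (natDegree_le_of_norm_aeval_le 0 (Q := Q) (C := |C|) (by
    filter_upwards [h, eventually_ge_atTop 1] with y hy hy1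
    refine hy.trans ?_
    rw [pow_zero]
    gcongr
    · exact le_abs_self C
    · exact inv_le_one_of_one_le₀ hy1))
  obtain ⟨a, rfl⟩ := natDegree_eq_zero.1 (Nat.le_zero.1 h1)
  simp only [aeval_C, Complex.coe_algebraMap, Complex.norm_real, Real.norm_eq_abs] at h
  have h2 : Tendsto (fun y : ℝ => C * y⁻¹) atTop (nhds 0) := by
    simpa using tendsto_inv_atTop_zero.const_mul C
  have := ge_of_tendsto h2 h
  rw [abs_nonpos_iff.1 this, map_zero]

/-- Two functions continuous off a real set that agree off the real line are equal. -/
lemma eq_of_eq_im {f g : ℂ → ℂ} {Δ : Set ℝ} (hΔ : IsCompact Δ) (hf : ContinuousOn f (cSet Δ)ᶜ)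
    (hg : ContinuousOn g (cSet Δ)ᶜ) (h : ∀ z : ℂ, z.im ≠ 0 → f z = g z) {z : ℂ}
    (hz : z ∉ cSet Δ) : f z = g z := by
  have hU := (isOpen_compl_cSet hΔ).mem_nhds hz
  have hu : Tendsto (fun y : ℝ => z + Complex.I * y) (nhdsWithin 0 {0}ᶜ) (nhds z) := by
    have : Continuous fun y : ℝ => z + Complex.I * y := by fun_prop
    simpa using (this.tendsto 0).mono_left nhdsWithin_le_nhds
  by_cases hz' : z.im = 0
  · refine tendsto_nhds_unique_of_eventuallyEq ((hf.continuousAt hU).tendsto.comp hu)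
      ((hg.continuousAt hU).tendsto.comp hu) ?_
    filter_upwards [self_mem_nhdsWithin] with y hy
    apply h
    simpa [hz'] using hy
  · exact h z hz'

namespace CSM.On

variable {s : CSM} {Δ : Set ℝ}

lemma ctr_eq_zero_of_eq_poly (h : s.On Δ) {F : ℂ → ℂ} (hF : CR F Δ) {Q : ℝ[X]}
    (hQ : ∀ z : ℂ, z.im ≠ 0 → ctr s F z = aeval z Q) : Q = 0 := by
  obtain ⟨C, hC, h1⟩ := h.norm_ctr_le hF.cont
  apply eq_zero_of_norm_aeval_le (C := C)
  filter_upwards [eventually_gt_atTop 0] with y hy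
  have e : (Complex.I * y).im = y := by simp
  rw [← hQ _ (by rw [e]; exact hy.ne')]
  have := h1 (Complex.I * y) (by rw [e]; exact hy.ne')
  rwa [e, abs_of_pos hy] at this

lemma false_of_ctr_rational (h : s.On Δ) {T P : ℝ[X]} (hT : T ≠ 0) (c : ℝ)
    (hTP : ∀ z : ℂ, z.im ≠ 0 → (c + ctr s (fun _ => 1) z) * aeval z T = aeval z P) : False := by
  obtain ⟨R2, -, hR2⟩ := h.exists_ctr_poly (CR.one Δ) T.natDegree T degree_le_natDegree
  have h1 : ∀ z : ℂ, z.im ≠ 0 → ctr s (fun z => aeval z T) z = aeval z (P - C c * T - R2) := by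
    intro z hz
    have e1 := hR2 z (notMem_cSet_of_im hz)
    have e2 := hTP z hz
    simp only [mul_one] at e1
    simp only [map_sub, map_mul, aeval_C, Complex.coe_algebraMap]
    rw [e1, ← e2]
    ring
  have h2 := h.ctr_eq_zero_of_eq_poly (CR.poly T Δ) h1
  obtain ⟨R3, -, hR3⟩ := h.exists_ctr_poly (CR.poly T Δ) T.natDegree T degree_le_natDegree
  have h3 : ∀ z : ℂ, z.im ≠ 0 → ctr s (fun z => aeval z T * aeval z T) z = aeval z (-R3) := by
    intro z hz
    rw [hR3 z (notMem_cSet_of_im hz), h1 z hz, h2]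
    simp
  have hTT : CR (fun z => aeval z T * aeval z T) Δ := (CR.poly T Δ).mul (CR.poly T Δ)
  have h4 := h.ctr_eq_zero_of_eq_poly hTT h3
  have h5 := h.tendsto_mul_ctr (F := fun z => aeval z T * aeval z T) hTT.cont
  have h6 : (s.ε : ℂ) * ∫ x : ℝ, aeval (x : ℂ) T * aeval (x : ℂ) T ∂s.μ = 0 := by
    refine tendsto_nhds_unique h5 (tendsto_const_nhds.congr' ?_)
    filter_upwards [eventually_gt_atTop 0] with y hy
    rw [h3 _ (by simpa using hy.ne'), h4]
    simp
  have hε : (s.ε : ℂ) ≠ 0 := by exact_mod_cast h.ε_ne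
  have h7 : ∫ x : ℝ, T.eval x * T.eval x ∂s.μ = 0 := by
    have := (mul_eq_zero.1 h6).resolve_left hε
    simp only [aeval_ofReal_eq, ← Complex.ofReal_mul, integral_complex_ofReal] at this
    exact_mod_cast this
  have h8 : Integrable (fun x => T.eval x * T.eval x) s.μ := h.integrable (by fun_prop)
  have h9 := (integral_eq_zero_iff_of_nonneg (fun x => mul_self_nonneg _) h8).1 h7
  have hz : s.μ {x | T.eval x ≠ 0} = 0 := by
    rw [EventuallyEq, ae_iff] at h9
    convert h9 using 2
    ext x
    simp
  have hsub : s.μ.support ⊆ {x | T.IsRoot x} := by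
    intro x hx
    by_contra hne
    have ho : IsOpen {x | T.eval x ≠ 0} := isOpen_ne_fun (by fun_prop) (by fun_prop)
    have := (Measure.mem_support_iff_forall x).1 hx _ (ho.mem_nhds hne)
    exact this.ne' hz
  exact h.inf ((finite_setOfPred_isRoot hT).subset hsub)

/-- Inverse of a shifted Cauchy transform. -/
lemma exists_inv (h : s.On Δ) {c : ℝ} (hc : c ≠ 0)
    (h0 : ∀ x : ℝ, x ∉ Δ → c + ctr s (fun _ => 1) x ≠ 0) :
    ∃ τ : CSM, τ.On Δ ∧ ∀ z ∉ cSet Δ,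
      (c + ctr s (fun _ => 1) z) * ((c⁻¹ : ℝ) + ctr τ (fun _ => 1) z) = 1 := by
  obtain ⟨ν, hν1, hν2, hν3⟩ := h.exists_inv_measure hc h0
  let τ : CSM := ⟨ENNReal.ofReal (c⁻¹ * c⁻¹) • ν, -s.ε⟩
  have hτc : ∀ z, ctr τ (fun _ => 1) z
      = - (s.ε * ((c : ℂ)⁻¹ * (c : ℂ)⁻¹ * ∫ x : ℝ, (z - x)⁻¹ ∂ν)) := by
    intro z
    simp only [ctr, τ, one_mul, integral_smul_measure]
    rw [ENNReal.toReal_ofReal (mul_self_nonneg _), Complex.real_smul]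
    push_cast
    ring
  have hz1 : ∀ z : ℂ, z.im ≠ 0 →
      (c + ctr s (fun _ => 1) z) * ((c⁻¹ : ℝ) + ctr τ (fun _ => 1) z) = 1 := by
    intro z hz
    rw [hτc, ← sub_eq_add_neg]
    have := hν3 z hz
    push_cast at this ⊢
    exact this
  have hfin : IsFiniteMeasure τ.μ := by
    change IsFiniteMeasure (ENNReal.ofReal (c⁻¹ * c⁻¹) • ν)
    exact ν.smul_finite ENNReal.ofReal_ne_top
  have hinf : τ.μ.support.Infinite := by
    intro hf
    set S := hf.toFinset with hS
    have hS0 : τ.μ (S : Set ℝ)ᶜ = 0 := by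
      rw [hS, Finite.coe_toFinset]
      exact Measure.measure_compl_support
    have hinteg : ∀ z : ℂ, ctr τ (fun _ => 1) z = ∑ x ∈ S, (τ.ε * τ.μ.real {x}) * (z - x)⁻¹ := by
      intro z
      simp only [ctr, one_mul]
      rw [← Measure.restrict_eq_self_of_ae_mem (s := (S : Set ℝ)) (μ := τ.μ) hS0,
        setIntegral_finset _ IntegrableOn.finset, Finset.mul_sum]
      refine Finset.sum_congr rfl fun x hx => ?_
      rw [Measure.restrict_eq_self_of_ae_mem (s := (S : Set ℝ)) (μ := τ.μ) hS0,
        Complex.real_smul]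
      ring
    set P : ℝ[X] := ∏ x ∈ S, (X - C x) with hP
    set R : ℝ[X] := ∑ x ∈ S, C (τ.ε * τ.μ.real {x}) * ∏ y ∈ S.erase x, (X - C y) with hR
    have hPR : ∀ z : ℂ, z.im ≠ 0 → ctr τ (fun _ => 1) z * aeval z P = aeval z R := by
      intro z hz
      rw [hinteg, hR, map_sum, Finset.sum_mul]
      refine Finset.sum_congr rfl fun x hx => ?_
      rw [hP, ← Finset.mul_prod_erase S _ hx]
      have hne : z - x ≠ 0 := fun hy => hz (by simpa using congrArg Complex.im hy)
      simp only [map_mul, map_sub, aeval_X, aeval_C, Complex.coe_algebraMap]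
      field_simp
    have hP0 : ∀ z : ℂ, z.im ≠ 0 → aeval z P ≠ 0 := by
      intro z hz
      rw [hP, map_prod]
      refine Finset.prod_ne_zero_iff.2 fun x _ hy => hz ?_
      simpa using congrArg Complex.im hy
    have hTP : ∀ z : ℂ, z.im ≠ 0 →
        (c + ctr s (fun _ => 1) z) * aeval z (C c⁻¹ * P + R) = aeval z P := by
      intro z hz
      rw [map_add, map_mul, ← hPR z hz, aeval_C, Complex.coe_algebraMap, ← add_mul, ← mul_assoc,
        hz1 z hz, one_mul]
    refine h.false_of_ctr_rational (fun h0 => ?_) c hTP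
    have := hTP Complex.I (by simp)
    rw [h0, map_zero, mul_zero] at this
    exact hP0 Complex.I (by simp) this.symm
  have hτ : τ.On Δ := ⟨h.cpt, h.cvx, hfin, by
    rcases h.sgn with h | h <;> simp [τ, h], by simp [τ, hν2], hinf⟩
  refine ⟨τ, hτ, fun z hz => ?_⟩
  refine eq_of_eq_im h.cpt (f := fun z =>
    (c + ctr s (fun _ => 1) z) * ((c⁻¹ : ℝ) + ctr τ (fun _ => 1) z)) (g := fun _ => 1) ?_
    continuousOn_const hz1 hz
  exact (continuousOn_const.add (h.reg_ctr (CR.one Δ)).cont).mul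
    (continuousOn_const.add (hτ.reg_ctr (CR.one Δ)).cont)

end CSM.On

namespace CSM.On

variable {s : CSM} {Δ : Set ℝ}

lemma exists_dens_endpoint (h : s.On Δ) {p : ℝ} (hp : ∀ x ∈ Δ, p ≤ x) :
    ∃ s' : CSM, s'.On Δ ∧ ∀ F z, ctr s' F z = ctr s (fun w => (w - p) * F w) z := by
  have := h.fin
  set D : ℝ → NNReal := fun x => Real.toNNReal (x - p) with hD
  have hDm : Measurable D := by fun_prop
  have hDv : ∀ x ∈ Δ, (D x : ℝ) = x - p := fun x hx =>
    Real.coe_toNNReal _ (by linarith [hp x hx])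
  refine ⟨⟨s.μ.withDensity (fun x => D x), s.ε⟩, ⟨h.cpt, h.cvx, ?_, h.sgn, ?_, ?_⟩, ?_⟩
  · obtain ⟨C, hC⟩ := h.cpt.exists_bound_of_continuousOn (f := fun x : ℝ => x - p) (by fun_prop)
    refine isFiniteMeasure_withDensity ?_
    have : ∫⁻ x, (D x : ENNReal) ∂s.μ ≤ ∫⁻ _, ENNReal.ofReal C ∂s.μ := by
      refine lintegral_mono_ae ?_
      filter_upwards [h.ae_mem] with x hx
      have h1 : (D x : ENNReal) = ENNReal.ofReal (D x) := by simp
      rw [h1]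
      refine ENNReal.ofReal_le_ofReal ?_
      rw [hDv x hx]
      exact (le_abs_self _).trans (hC x hx)
    refine (this.trans_lt ?_).ne
    simp [ENNReal.mul_lt_top_iff, measure_lt_top]
  · exact withDensity_absolutelyContinuous _ _ h.null
  · refine (h.inf.sdiff (finite_singleton p)).mono ?_
    rintro x ⟨hx, hxp⟩
    have hpx : p < x := lt_of_le_of_ne (hp x (h.support_subset hx)) (fun h => hxp h.symm)
    refine (Measure.mem_support_iff_forall x).2 fun U hU => ?_
    have hV := (Measure.mem_support_iff_forall x).1 hx _ (inter_mem hU (Ioi_mem_nhds hpx))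
    rw [pos_iff_ne_zero] at hV ⊢
    intro h0
    apply hV
    rw [withDensity_apply_eq_zero' (by fun_prop)] at h0
    refine measure_mono_null ?_ h0
    rintro y ⟨hyU, hy⟩
    refine ⟨?_, hyU⟩
    simpa [hD] using hy
  · intro F z
    unfold ctr
    simp only
    have hcont : ∀ x ∈ Δ, D x • (F x * (z - x)⁻¹) = ((x - p : ℂ) * F x * (z - x)⁻¹) := by
      intro x hx
      have : D x • (F x * (z - x)⁻¹) = ((D x : ℝ) : ℂ) * (F x * (z - x)⁻¹) := by
        rw [NNReal.smul_def, Complex.real_smul]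
      rw [this, hDv x hx]
      push_cast
      ring
    rw [integral_withDensity_eq_integral_smul hDm, h.integral_congr hcont]

lemma mul_sub_ctr (h : s.On Δ) (p : ℝ) {z : ℂ} (hz : z ∉ cSet Δ) :
    (z - p) * ctr s (fun _ => 1) z
      = ((s.ε * s.μ.real univ : ℝ) : ℂ) + ctr s (fun w => (w - p) * 1) z := by
  have := h.fin
  have e : ∀ x : ℝ, x ∈ Δ → (z - p) * (1 * (z - x)⁻¹) = 1 + (x - p) * 1 * (z - x)⁻¹ := by
    intro x hx
    have := notMem_cSet hz hx
    field_simp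
    ring
  unfold ctr
  rw [← mul_assoc, mul_comm (z - (p : ℂ)), mul_assoc, ← integral_const_mul, h.integral_congr e,
    integral_add (integrable_const _)
      (h.integrable_kernel (F := fun w => (w - p) * 1) (by fun_prop) hz)]
  simp [mul_add]

lemma measure_univ_ne_zero (h : s.On Δ) : s.μ.real univ ≠ 0 := by
  have := h.fin
  intro h0
  rw [measureReal_eq_zero_iff, Measure.measure_univ_eq_zero] at h0
  apply h.inf
  rw [h0]
  simp

lemma nonempty (h : s.On Δ) : Δ.Nonempty :=
  h.inf.nonempty.mono h.support_subset

/-- Inverse of a shifted Cauchy transform, allowing a zero shift. -/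
lemma exists_inv_linear (h : s.On Δ) (c : ℝ)
    (h0 : ∀ x : ℝ, x ∉ Δ → c + ctr s (fun _ => 1) x ≠ 0) :
    ∃ (τ : CSM) (D : ℝ[X]), τ.On Δ ∧ ∀ z ∉ cSet Δ,
      (c + ctr s (fun _ => 1) z) * (aeval z D + ctr τ (fun _ => 1) z) = 1 := by
  by_cases hc : c = 0
  · subst hc
    obtain ⟨p, hpΔ, hp⟩ := h.cpt.exists_isLeast h.nonempty
    obtain ⟨s', hs', hs'c⟩ := h.exists_dens_endpoint hp
    set c' : ℝ := s.ε * s.μ.real univ with hc'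
    have hc'0 : c' ≠ 0 := mul_ne_zero h.ε_ne h.measure_univ_ne_zero
    have key : ∀ z ∉ cSet Δ, c' + ctr s' (fun _ => 1) z = (z - p) * ctr s (fun _ => 1) z := by
      intro z hz
      rw [hs'c, h.mul_sub_ctr p hz]
    obtain ⟨τ, hτ, hτc⟩ := hs'.exists_inv hc'0 (by
      intro x hx
      have hx' : (x : ℂ) ∉ cSet Δ := by rwa [mem_cSet_ofReal]
      rw [key x hx']
      refine mul_ne_zero (notMem_cSet hx' hpΔ) ?_
      simpa using h0 x hx)
    obtain ⟨τ', hτ', hτ'c⟩ := hτ.exists_dens_endpoint hp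
    refine ⟨τ', C c'⁻¹ * (X - C p) + C (τ.ε * τ.μ.real univ), hτ', fun z hz => ?_⟩
    refine Eq.trans ?_ (hτc z hz)
    rw [key z hz, hτ'c]
    have e := hτ.mul_sub_ctr p hz
    rw [eq_sub_of_add_eq' e.symm]
    simp only [map_add, map_mul, map_sub, aeval_C, aeval_X, Complex.coe_algebraMap]
    push_cast
    ring
  · obtain ⟨τ, hτ, hτc⟩ := h.exists_inv hc h0
    exact ⟨τ, C c⁻¹, hτ, fun z hz => by simpa using hτc z hz⟩

end CSM.On

lemma CSM.On.ctr_ofReal {s : CSM} {Δ : Set ℝ} (h : s.On Δ) {F : ℂ → ℂ} (hF : CR F Δ) (x : ℝ) :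
    ctr s F x = ((s.ε * ∫ t : ℝ, (F t).re * (x - t)⁻¹ ∂s.μ : ℝ) : ℂ) := by
  unfold ctr
  push_cast
  rw [← integral_complex_ofReal]
  congr 1
  refine h.integral_congr fun t ht => ?_
  rw [hF.eq_re ht]
  push_cast
  rfl

lemma cheb_singleton {ι : Type*} {φ : ι → ℝ → ℝ} {o : ι} {D : Set ℝ} (ho : ∀ x, φ o x = 1) :
    Cheb φ {o} D := by
  intro S T hS hT hc c h0 i hi
  have hio : i = o := hS hi
  subst hio
  have hS' : S = {i} := by
    ext x
    rw [Finset.mem_singleton]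
    exact ⟨fun hx => hS hx, fun hx => hx ▸ hi⟩
  obtain ⟨t, ht⟩ : T.Nonempty := by
    rw [← Finset.card_pos]
    exact lt_of_lt_of_le (Finset.card_pos.2 ⟨i, hi⟩) hc
  simpa [hS', ho] using h0 t ht

/-- A chain of constant sign measures on consecutively disjoint intervals. -/
structure Sys (m : ℕ) (a : ℕ → CSM) (Δ : ℕ → Set ℝ) : Prop where
  on : ∀ l < m, (a l).On (Δ l)
  disj : ∀ l, l + 1 < m → Disjoint (Δ l) (Δ (l + 1))

/-- Iterated Cauchy transforms of length `d` starting at level `i`. -/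
def iterCtr (a : ℕ → CSM) : ℕ → ℕ → ℂ → ℂ
  | _, 0 => fun _ => 1
  | i, d + 1 => ctr (a i) (iterCtr a (i + 1) d)

/-- The transform of the product measure of levels `i, …, k - 1`. -/
def nikFun (a : ℕ → CSM) (i k : ℕ) : ℂ → ℂ := iterCtr a i (k - i)

/-- Iterated Cauchy transforms in the reverse order. -/
def revCtr (a : ℕ → CSM) (r : ℕ) : ℕ → ℂ → ℂ
  | 0 => fun _ => 1
  | e + 1 => fun z => -ctr (a (r + e)) (revCtr a r e) z

/-- The signed transform of the reversed product of levels `r, …, l - 1`. -/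
def revFun (a : ℕ → CSM) (l r : ℕ) : ℂ → ℂ := revCtr a r (l - r)

/-- Entries of the kernel matrix at level `l`. -/
def kerFun (a : ℕ → CSM) (l r b : ℕ) : ℂ → ℂ :=
  ctr (a l) fun w => revFun a l r w * nikFun a (l + 1) b w

@[simp] lemma nikFun_self (a : ℕ → CSM) (i : ℕ) : nikFun a i i = fun _ => 1 := by
  simp [nikFun, iterCtr]

lemma nikFun_of_lt (a : ℕ → CSM) {i k : ℕ} (h : i < k) :
    nikFun a i k = ctr (a i) (nikFun a (i + 1) k) := by
  obtain ⟨d, rfl⟩ := Nat.exists_eq_add_of_lt h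
  rw [nikFun, nikFun, show i + d + 1 - i = d + 1 by omega, show i + d + 1 - (i + 1) = d by omega]
  rfl

@[simp] lemma revFun_self (a : ℕ → CSM) (i : ℕ) : revFun a i i = fun _ => 1 := by
  simp [revFun, revCtr]

lemma revFun_succ (a : ℕ → CSM) {l r : ℕ} (h : r ≤ l) :
    revFun a (l + 1) r = fun z => -ctr (a l) (revFun a l r) z := by
  obtain ⟨d, rfl⟩ := Nat.exists_eq_add_of_le h
  rw [revFun, revFun, show r + d + 1 - r = d + 1 by omega, show r + d - r = d by omega]
  rfl

namespace Sys

variable {m : ℕ} {a : ℕ → CSM} {Δ : ℕ → Set ℝ}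

lemma nikFun_props (h : Sys m a Δ) (d : ℕ) : ∀ i, i + d ≤ m →
    (0 < d → Reg (nikFun a i (i + d)) (Δ i)) ∧
    ∀ j, j + 1 = i → i ≤ m → CR (nikFun a i (i + d)) (Δ j) := by
  induction d with
  | zero =>
    intro i hi
    refine ⟨by simp, fun j hj hi => ?_⟩
    rw [Nat.add_zero, nikFun_self]
    exact CR.one _
  | succ d ih =>
    intro i hi
    have h1 : Reg (nikFun a i (i + (d + 1))) (Δ i) := by
      rw [nikFun_of_lt a (by omega)]
      refine (h.on i (by omega)).reg_ctr ?_
      have := (ih (i + 1) (by omega)).2 i rfl (by omega)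
      rwa [show i + 1 + d = i + (d + 1) by omega] at this
    refine ⟨fun _ => h1, fun j hj _ => ?_⟩
    subst hj
    exact h1.cr (h.disj j (by omega)).symm

lemma reg_nikFun (h : Sys m a Δ) {i k : ℕ} (hik : i < k) (hk : k ≤ m) :
    Reg (nikFun a i k) (Δ i) := by
  have := (h.nikFun_props (k - i) i (by omega)).1 (by omega)
  rwa [show i + (k - i) = k by omega] at this

lemma cr_nikFun (h : Sys m a Δ) {l k : ℕ} (hlk : l < k) (hk : k ≤ m) :
    CR (nikFun a (l + 1) k) (Δ l) := by
  have := (h.nikFun_props (k - (l + 1)) (l + 1) (by omega)).2 l rfl (by omega)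
  rwa [show l + 1 + (k - (l + 1)) = k by omega] at this

lemma cr_revFun (h : Sys m a Δ) (l : ℕ) : ∀ r, r ≤ l → l < m → CR (revFun a l r) (Δ l) := by
  induction l with
  | zero =>
    intro r hr _
    obtain rfl : r = 0 := by omega
    rw [revFun_self]
    exact CR.one _
  | succ l ih =>
    intro r hr hl
    rcases Nat.lt_or_ge r (l + 1) with h1 | h1
    · rw [revFun_succ a (by omega)]
      exact (((h.on l (by omega)).reg_ctr (ih r (by omega) (by omega))).neg).cr (h.disj l hl)
    · obtain rfl : r = l + 1 := by omega
      rw [revFun_self]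
      exact CR.one _

lemma cr_ker (h : Sys m a Δ) {l r b : ℕ} (hr : r ≤ l) (hb : l < b) (hbm : b ≤ m) :
    CR (fun w => revFun a l r w * nikFun a (l + 1) b w) (Δ l) :=
  (h.cr_revFun l r hr (by omega)).mul (h.cr_nikFun hb hbm)

lemma reg_kerFun (h : Sys m a Δ) {l r b : ℕ} (hr : r ≤ l) (hb : l < b) (hbm : b ≤ m) :
    Reg (kerFun a l r b) (Δ l) :=
  (h.on l (by omega)).reg_ctr (h.cr_ker hr hb hbm)

lemma kerFun_eq (h : Sys m a Δ) {l r k : ℕ} (hr : r ≤ l) (hk : l + 1 < k) (hkm : k ≤ m) {z : ℂ}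
    (hz : z.im ≠ 0) : kerFun a l r k z
      = kerFun a (l + 1) r k z + kerFun a l r (l + 1) z * nikFun a (l + 1) k z := by
  have e := (h.on l (by omega)).ctr_mul_ctr (h.on (l + 1) (by omega)) (h.disj l (by omega))
    (h.cr_revFun l r hr (by omega)) (h.cr_nikFun hk hkm)
    (notMem_cSet_of_im hz) (notMem_cSet_of_im hz)
  unfold kerFun
  rw [nikFun_self, nikFun_of_lt a hk, revFun_succ a hr]
  simp only [mul_one]
  rw [e]
  have e2 : (fun w => -ctr (a l) (revFun a l r) w * nikFun a (l + 1 + 1) k w)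
      = fun w => (-1) * (nikFun a (l + 1 + 1) k w * ctr (a l) (revFun a l r) w) := by
    funext w
    ring
  rw [e2, CSM.On.ctr_const_mul]
  ring

lemma kernel_iff (h : Sys m a Δ) {z : ℂ} (hz : z.im ≠ 0) (c : ℕ → ℂ) (l : ℕ) : l < m →
    ((∀ i ≤ l, ∑ k ∈ Finset.Icc i m, nikFun a i k z * c k = 0) ↔
      ∀ r ≤ l, c r + ∑ b ∈ Finset.Ioc l m, kerFun a l r b z * c b = 0) := by
  have hIcc : ∀ i ≤ m, ∑ k ∈ Finset.Icc i m, nikFun a i k z * c k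
      = c i + ∑ k ∈ Finset.Ioc i m, nikFun a i k z * c k := by
    intro i hi
    rw [← Finset.Ioc_insert_left hi, Finset.sum_insert (by simp)]
    simp
  have hself : ∀ l, l < m → c l + ∑ b ∈ Finset.Ioc l m, kerFun a l l b z * c b
      = ∑ k ∈ Finset.Icc l m, nikFun a l k z * c k := by
    intro l hl
    rw [hIcc l hl.le]
    congr 1
    refine Finset.sum_congr rfl fun b hb => ?_
    rw [nikFun_of_lt a (Finset.mem_Ioc.1 hb).1]
    simp [kerFun]
  induction l with
  | zero =>
    intro hm
    simp only [Nat.le_zero, forall_eq]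
    rw [hself 0 hm]
  | succ l ih =>
    intro hl
    have hN : ∀ r ≤ l, c r + ∑ b ∈ Finset.Ioc l m, kerFun a l r b z * c b
        = (c r + ∑ b ∈ Finset.Ioc (l + 1) m, kerFun a (l + 1) r b z * c b)
          + kerFun a l r (l + 1) z * ∑ k ∈ Finset.Icc (l + 1) m, nikFun a (l + 1) k z * c k := by
      intro r hr
      have : Finset.Ioc l m = insert (l + 1) (Finset.Ioc (l + 1) m) := by
        ext x; simp only [Finset.mem_Ioc, Finset.mem_insert]; omega
      rw [this, Finset.sum_insert (by simp), hIcc (l + 1) (by omega), mul_add, Finset.mul_sum]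
      have e : ∑ b ∈ Finset.Ioc (l + 1) m, kerFun a l r b z * c b
          = ∑ b ∈ Finset.Ioc (l + 1) m, kerFun a (l + 1) r b z * c b
          + ∑ b ∈ Finset.Ioc (l + 1) m,
              kerFun a l r (l + 1) z * (nikFun a (l + 1) b z * c b) := by
        rw [← Finset.sum_add_distrib]
        refine Finset.sum_congr rfl fun b hb => ?_
        rw [h.kerFun_eq hr (Finset.mem_Ioc.1 hb).1 (Finset.mem_Ioc.1 hb).2 hz]
        ring
      rw [e]
      ring
    have h1 : (∀ i ≤ l + 1, ∑ k ∈ Finset.Icc i m, nikFun a i k z * c k = 0) ↔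
        (∀ i ≤ l, ∑ k ∈ Finset.Icc i m, nikFun a i k z * c k = 0) ∧
          ∑ k ∈ Finset.Icc (l + 1) m, nikFun a (l + 1) k z * c k = 0 := by
      constructor
      · intro h
        exact ⟨fun i hi => h i (by omega), h _ le_rfl⟩
      · rintro ⟨h1, h2⟩ i hi
        rcases Nat.lt_or_ge i (l + 1) with h | h
        · exact h1 i (by omega)
        · obtain rfl : i = l + 1 := by omega
          exact h2
    rw [h1, ih (by omega)]
    constructor
    · rintro ⟨h1, h2⟩ r hr
      rcases Nat.lt_or_ge r (l + 1) with h | h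
      · have := hN r (by omega)
        rw [h1 r (by omega), h2, mul_zero, add_zero] at this
        exact this.symm
      · obtain rfl : r = l + 1 := by omega
        rw [hself _ hl, h2]
    · intro h
      have h2 := h _ le_rfl
      rw [hself _ hl] at h2
      refine ⟨fun r hr => ?_, h2⟩
      rw [hN r hr, h r (by omega), h2, mul_zero, add_zero]

lemma cheb_nikFun (h : Sys m a Δ) (d : ℕ) : ∀ l, l + 1 + d = m →
    Cheb (fun b x => (nikFun a (l + 1) b (x : ℂ)).re) (Ioc l m) (Δ l) := by
  induction d with
  | zero =>
    intro l hl
    have : Ioc l m = {l + 1} := by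
      ext x; simp only [mem_Ioc, mem_singleton_iff]; omega
    rw [this]
    exact cheb_singleton (by simp)
  | succ d ih =>
    intro l hl
    have : Ioc l m = insert (l + 1) (Ioc (l + 1) m) := by
      ext x; simp only [mem_Ioc, mem_insert_iff]; omega
    rw [this]
    have hon := h.on (l + 1) (by omega)
    refine hon.cheb_lift (ih (l + 1) (by omega)) (fun b hb => ?_)
      (h.disj l (by omega)) (by simp) (by simp) hon.ε_ne (fun k hk x hx => ?_)
    · exact Complex.continuous_re.comp_continuousOn (h.cr_nikFun hb.1 hb.2).cont
    · rw [nikFun_of_lt a hk.1, hon.ctr_ofReal (h.cr_nikFun hk.1 hk.2), Complex.ofReal_re]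

lemma cheb_revFun (h : Sys m a Δ) (l : ℕ) : l < m →
    Cheb (fun r x => (revFun a l r (x : ℂ)).re) (Iic l) (Δ l) := by
  induction l with
  | zero =>
    intro hl
    have : Iic 0 = {0} := by
      ext x; simp
    rw [this]
    exact cheb_singleton (by simp)
  | succ l ih =>
    intro hl
    have : Iic (l + 1) = insert (l + 1) (Iic l) := by
      ext x; simp only [mem_Iic, mem_insert_iff]; omega
    rw [this]
    have hon := h.on l (by omega)
    refine hon.cheb_lift (ih (by omega)) (fun b hb => ?_)
      (h.disj l (by omega)).symm (by simp) (by simp) (neg_ne_zero.2 hon.ε_ne) (fun k hk x hx => ?_)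
    · exact Complex.continuous_re.comp_continuousOn (h.cr_revFun l b hb (by omega)).cont
    · rw [revFun_succ a hk]
      beta_reduce
      rw [hon.ctr_ofReal (h.cr_revFun l k hk (by omega)), Complex.neg_re,
        Complex.ofReal_re, neg_mul]

lemma kernel_inj_real (h : Sys m a Δ) {l : ℕ} (hl : l < m) {θ : ℝ → ℝ}
    (hθ : ContinuousOn θ (Δ l)) (hθ0 : ∀ x ∈ Δ l, θ x ≠ 0) {κ : ℝ} (hκ : κ ≠ 0)
    {S : Finset ℕ} (hS : S.card ≤ l + 1) {c : ℕ → ℝ}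
    (hc : ∀ k ≤ m, k ∉ S → c k = 0)
    (h0 : ∀ r ≤ l, c r + ∑ b ∈ Finset.Ioc l m, (κ * ∫ x : ℝ, (revFun a l r x).re *
      (θ x * (nikFun a (l + 1) b x).re) ∂(a l).μ) * c b = 0) : ∀ k ≤ m, c k = 0 := by
  have hon := h.on l hl
  set T := (Finset.Iic l) \ S with hT
  set S2 := S ∩ Finset.Ioc l m with hS2
  have hcard : S2.card ≤ T.card := by
    have h1 : T.card + (S ∩ Finset.Iic l).card = l + 1 := by
      rw [hT, Finset.inter_comm, Finset.card_sdiff_add_card_inter]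
      simp
    have h2 : S2.card + (S ∩ Finset.Iic l).card ≤ S.card := by
      rw [← Finset.card_union_of_disjoint]
      · exact Finset.card_le_card (by simp [hS2, Finset.union_subset_iff])
      · rw [Finset.disjoint_left]
        intro x hx hx'
        simp only [hS2, Finset.mem_inter, Finset.mem_Ioc, Finset.mem_Iic] at hx hx'
        omega
    omega
  have hψ := (h.cheb_nikFun (m - (l + 1)) l (by omega)).mul hθ0
  have hsum : ∀ f : ℕ → ℝ, ∑ b ∈ Finset.Ioc l m, f b * c b = ∑ b ∈ S2, f b * c b := by
    intro f
    symm
    refine Finset.sum_subset (by simp [hS2]) fun x hx hx2 => ?_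
    rw [hc x (Finset.mem_Ioc.1 hx).2 fun h => hx2 (by simp only [hS2, Finset.mem_inter]; exact ⟨h, hx⟩),
      mul_zero]
  have hz : ∀ j ∈ S2, c j = 0 := by
    refine hon.gram (U := Iic l) (V := Ioc l m) (h.cheb_revFun l hl) hψ (fun i hi => ?_)
      (fun i hi => ?_) (S := T) ?_ ?_ hcard (fun r hr => ?_)
    · exact Complex.continuous_re.comp_continuousOn (h.cr_revFun l i hi hl).cont
    · exact hθ.mul (Complex.continuous_re.comp_continuousOn (h.cr_nikFun hi.1 hi.2).cont)
    · intro x hx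
      simp only [hT, Finset.coe_sdiff, Finset.coe_Iic] at hx
      exact hx.1
    · intro x hx
      simp only [hS2, Finset.coe_inter, Finset.coe_Ioc] at hx
      exact hx.2
    · simp only [hT, Finset.mem_sdiff, Finset.mem_Iic] at hr
      have := h0 r hr.1
      rw [hc r (by omega) hr.2, zero_add, hsum] at this
      have e : κ * ∑ j ∈ S2, c j * ∫ x : ℝ, (revFun a l r x).re *
          (θ x * (nikFun a (l + 1) j x).re) ∂(a l).μ = 0 := by
        rw [← this, Finset.mul_sum]
        exact Finset.sum_congr rfl fun b hb => by ring
      exact (mul_eq_zero.1 e).resolve_left hκ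
  have hz2 : ∀ r ≤ l, c r = 0 := by
    intro r hr
    have := h0 r hr
    rw [hsum, Finset.sum_eq_zero fun b hb => by rw [hz b hb, mul_zero], add_zero] at this
    exact this
  intro k hk
  rcases Nat.lt_or_ge l k with h1 | h1
  · by_cases hkS : k ∈ S
    · exact hz k (by simp [hS2, hkS, h1, hk])
    · exact hc k hk hkS
  · exact hz2 k h1

lemma kernel_inj (h : Sys m a Δ) {l : ℕ} (hl : l < m) {θ : ℝ → ℝ}
    (hθ : ContinuousOn θ (Δ l)) (hθ0 : ∀ x ∈ Δ l, θ x ≠ 0)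
    {S : Finset ℕ} (hS : S.card ≤ l + 1) {c : ℕ → ℂ}
    (hc : ∀ k ≤ m, k ∉ S → c k = 0)
    (h0 : ∀ r ≤ l, c r + ∑ b ∈ Finset.Ioc l m, ((a l).ε * ∫ x : ℝ, revFun a l r x *
      nikFun a (l + 1) b x * θ x ∂(a l).μ) * c b = 0) : ∀ k ≤ m, c k = 0 := by
  have hon := h.on l hl
  have key : ∀ r ≤ l, ∀ b ∈ Finset.Ioc l m, ((a l).ε * ∫ x : ℝ, revFun a l r x *
      nikFun a (l + 1) b x * θ x ∂(a l).μ : ℂ) = (((a l).ε * ∫ x : ℝ, (revFun a l r x).re *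
      (θ x * (nikFun a (l + 1) b x).re) ∂(a l).μ : ℝ) : ℂ) := by
    intro r hr b hb
    rw [Finset.mem_Ioc] at hb
    push_cast
    rw [← integral_complex_ofReal]
    congr 1
    refine hon.integral_congr fun x hx => ?_
    rw [(h.cr_revFun l r hr hl).eq_re hx, (h.cr_nikFun hb.1 hb.2).eq_re hx]
    push_cast
    simp only [Complex.ofReal_re]
    ring
  have hre := h.kernel_inj_real hl hθ hθ0 hon.ε_ne hS (c := fun k => (c k).re)
    (fun k hk hkS => by simp [hc k hk hkS]) (fun r hr => by
      have := congrArg Complex.re (h0 r hr)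
      rw [Finset.sum_congr rfl fun b hb => by rw [key r hr b hb]] at this
      simpa only [Complex.add_re, Complex.re_sum, Complex.re_ofReal_mul, Complex.zero_re] using this)
  have him := h.kernel_inj_real hl hθ hθ0 hon.ε_ne hS (c := fun k => (c k).im)
    (fun k hk hkS => by simp [hc k hk hkS]) (fun r hr => by
      have := congrArg Complex.im (h0 r hr)
      rw [Finset.sum_congr rfl fun b hb => by rw [key r hr b hb]] at this
      simpa only [Complex.add_im, Complex.im_sum, Complex.im_ofReal_mul, Complex.zero_im] using this)
  exact fun k hk => Complex.ext (hre k hk) (him k hk)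

end Sys

/-- Square matrix whose `j`-th column is a unit vector if `β j ≤ l`, and the `β j`-th column of
`W` otherwise. -/
def kMat (l : ℕ) (W : ℕ → ℕ → ℂ) (β : Fin (l + 1) → ℕ) : Matrix (Fin (l + 1)) (Fin (l + 1)) ℂ :=
  Matrix.of fun r j => if β j ≤ l then (if (r : ℕ) = β j then 1 else 0) else W r (β j)

lemma kMat_mulVec {l m : ℕ} (W : ℕ → ℕ → ℂ) {β : Fin (l + 1) → ℕ} (hm : ∀ j, β j ≤ m)
    (v : Fin (l + 1) → ℂ) (r : Fin (l + 1)) :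
    (kMat l W β).mulVec v r = (∑ j, if β j = r then v j else 0)
      + ∑ b ∈ Finset.Ioc l m, W r b * ∑ j, if β j = b then v j else 0 := by
  simp only [Finset.mul_sum]
  rw [Finset.sum_comm, ← Finset.sum_add_distrib, Matrix.mulVec, dotProduct]
  refine Finset.sum_congr rfl fun j _ => ?_
  simp only [kMat, Matrix.of_apply, mul_ite, mul_zero]
  by_cases hj : β j ≤ l
  · rw [if_pos hj, Finset.sum_eq_zero]
    · by_cases h : (r : ℕ) = β j
      · simp [h]
      · simp [h, Ne.symm h]
    · intro b hb
      rw [if_neg]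
      have := (Finset.mem_Ioc.1 hb).1
      omega
  · rw [if_neg hj, if_neg (by have := r.2; omega), zero_add, Finset.sum_ite_eq, if_pos]
    exact Finset.mem_Ioc.2 ⟨by omega, hm j⟩

lemma Sys.kMat_det_ne_zero {m : ℕ} {a : ℕ → CSM} {Δ : ℕ → Set ℝ} (h : Sys m a Δ) {l : ℕ}
    (hl : l < m) {θ : ℝ → ℝ} (hθ : ContinuousOn θ (Δ l)) (hθ0 : ∀ x ∈ Δ l, θ x ≠ 0)
    {β : Fin (l + 1) → ℕ} (hβ : Function.Injective β) (hm : ∀ j, β j ≤ m) :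
    (kMat l (fun r b => (a l).ε * ∫ x : ℝ, revFun a l r x * nikFun a (l + 1) b x * θ x ∂(a l).μ)
      β).det ≠ 0 := by
  intro h0
  obtain ⟨v, hv, hv0⟩ := Matrix.exists_mulVec_eq_zero_iff.2 h0
  apply hv
  have key := h.kernel_inj hl hθ hθ0 (S := Finset.univ.image β)
    (c := fun b => ∑ j, if β j = b then v j else 0)
    (by simpa using Finset.card_image_le (s := Finset.univ) (f := β)) (fun k hk hkS => by
      refine Finset.sum_eq_zero fun j _ => if_neg fun e => hkS ?_
      rw [← e]
      exact Finset.mem_image_of_mem _ (Finset.mem_univ _)) (fun r hr => by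
      have := congrFun hv0 ⟨r, by omega⟩
      rw [kMat_mulVec _ hm] at this
      exact this)
  funext j
  have := key (β j) (hm j)
  simpa [hβ.eq_iff] using this

lemma det_last_col_eq {l : ℕ} {col : ℕ → Fin (l + 1) → ℂ} {d : ℕ → ℂ} {k : ℕ}
    (h : ∑ j ∈ Finset.range l, d j • col j + d l • col l + col k = 0) :
    (Matrix.of fun r (j : Fin (l + 1)) => col (if (j : ℕ) < l then j else k) r).det
      = -d l * (Matrix.of fun r (j : Fin (l + 1)) => col (if (j : ℕ) < l then j else l) r).det := by
  set M : ℕ → Matrix (Fin (l + 1)) (Fin (l + 1)) ℂ := fun k =>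
    Matrix.of fun r (j : Fin (l + 1)) => col (if (j : ℕ) < l then j else k) r with hM
  have hu : ∀ k, M k = (M l).updateCol (Fin.last l) (col k) := by
    intro k
    ext r j
    rw [Matrix.updateCol_apply]
    by_cases hj : j = Fin.last l
    · subst hj
      simp [hM]
    · have : (j : ℕ) < l := Fin.val_lt_last hj
      simp [hM, hj, this]
  have hc : ∀ k, (M k).det = (M l).cramer (col k) (Fin.last l) := by
    intro k
    rw [hu k, Matrix.cramer_apply]
  have hz : ∀ j < l, (M l).cramer (col j) (Fin.last l) = 0 := by
    intro j hj
    rw [← hc]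
    refine Matrix.det_zero_of_column_eq (i := ⟨j, by omega⟩) (j := Fin.last l)
      (fun h => ?_) fun r => ?_
    · have := congrArg Fin.val h
      simp at this
      omega
    · simp [hM, hj]
  have := congrFun (congrArg (M l).cramer h) (Fin.last l)
  rw [map_add, map_add, map_sum, map_zero, Pi.add_apply, Pi.add_apply, Finset.sum_apply,
    map_smul, Pi.smul_apply, Finset.sum_eq_zero, zero_add, ← hc, ← hc] at this
  · rw [smul_eq_mul, Pi.zero_apply] at this
    linear_combination this
  · intro j hj
    rw [map_smul, Pi.smul_apply, hz j (Finset.mem_range.1 hj), smul_zero]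

lemma exists_back_subst {m : ℕ} {H : ℕ → ℕ → ℂ} (hH : ∀ i ≤ m, H i i = 1) {l : ℕ} (hl : l ≤ m)
    (d0 : ℕ → ℂ) (t : ℕ) : ∃ d : ℕ → ℂ, (∀ j, l < j → d j = d0 j) ∧
      ∀ i ≤ l, l < i + t → ∑ j ∈ Finset.Icc i m, H i j * d j = 0 := by
  induction t with
  | zero => exact ⟨d0, fun _ _ => rfl, fun i hi h => by omega⟩
  | succ t ih =>
    obtain ⟨d, hd, hd2⟩ := ih
    by_cases ht : t ≤ l
    · set i0 := l - t with hi0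
      refine ⟨Function.update d i0 (-∑ j ∈ Finset.Ioc i0 m, H i0 j * d j), fun j hj => ?_,
        fun i hi hit => ?_⟩
      · rw [Function.update_of_ne (by omega), hd j hj]
      · by_cases h : i = i0
        · subst h
          rw [← Finset.Ioc_insert_left (by omega), Finset.sum_insert (by simp), hH _ (by omega),
            Function.update_self, one_mul, neg_add_eq_zero]
          refine Finset.sum_congr rfl fun j hj => ?_
          rw [Function.update_of_ne]
          have := (Finset.mem_Ioc.1 hj).1
          omega
        · rw [← hd2 i hi (by omega)]
          refine Finset.sum_congr rfl fun j hj => ?_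
          rw [Function.update_of_ne]
          have := (Finset.mem_Icc.1 hj).1
          omega
    · exact ⟨d, hd, fun i hi _ => hd2 i hi (by omega)⟩

/-- A triangular representation of the function system generated by `a`, after the permutation
`lam` of its members. -/
structure TriRep (m : ℕ) (a : ℕ → CSM) (Δ : ℕ → Set ℝ) (lam : Equiv.Perm ℕ) (ρ : ℕ → CSM)
    (A : ℕ → ℕ → ℝ[X]) (h : ℕ → ℕ → ℂ → ℂ) : Prop where
  le : ∀ k, lam k ≤ m ↔ k ≤ m
  on : ∀ l < m, (ρ l).On (Δ l)
  self : ∀ l ≤ m, h l l = fun _ => 1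
  step : ∀ l k, l < k → k ≤ m → ∀ z ∉ cSet (Δ l),
    h l k z = aeval z (A l k) + ctr (ρ l) (h (l + 1) k) z
  ker : ∀ l < m, ∀ z : ℂ, z.im ≠ 0 → ∀ c : ℕ → ℂ,
    (∀ i ≤ l, ∑ k ∈ Finset.Icc i m, h i k z * c (lam k) = 0) ↔
      ∀ r ≤ l, c r + ∑ b ∈ Finset.Ioc l m, kerFun a l r b z * c b = 0

lemma Sys.rep {m : ℕ} {a : ℕ → CSM} {Δ : ℕ → Set ℝ} (h : Sys m a Δ) :
    TriRep m a Δ (Equiv.refl ℕ) a (fun _ _ => 0) (nikFun a) where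
  le := fun _ => Iff.rfl
  on := h.on
  self := fun l _ => nikFun_self a l
  step := fun l k hl _ z _ => by simp [nikFun_of_lt a hl]
  ker := fun l hl z hz c => h.kernel_iff hz c l hl

lemma Reg.congr {F G : ℂ → ℂ} {Δ : Set ℝ} (hF : Reg F Δ) (h : ∀ z ∉ cSet Δ, G z = F z) :
    Reg G Δ where
  cont := hF.cont.congr h
  real := fun x hx => by rw [h x (by rwa [mem_cSet_ofReal]), hF.real x hx]

namespace TriRep

variable {m : ℕ} {a : ℕ → CSM} {Δ : ℕ → Set ℝ} {lam : Equiv.Perm ℕ} {ρ : ℕ → CSM}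
  {A : ℕ → ℕ → ℝ[X]} {h : ℕ → ℕ → ℂ → ℂ}

lemma reg_aux (R : TriRep m a Δ lam ρ A h) (hs : Sys m a Δ) (d : ℕ) : ∀ l, l + d + 1 ≤ m →
    CR (h (l + 1) (l + d + 1)) (Δ l) ∧ Reg (h l (l + d + 1)) (Δ l) := by
  induction d with
  | zero =>
    intro l hl
    have h1 : CR (h (l + 1) (l + 0 + 1)) (Δ l) := by
      rw [Nat.add_zero, R.self _ (by omega)]
      exact CR.one _
    exact ⟨h1, ((Reg.poly _ _).add ((R.on l (by omega)).reg_ctr h1)).congr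
      fun z hz => R.step l _ (by omega) hl z hz⟩
  | succ d ih =>
    intro l hl
    have h1 : CR (h (l + 1) (l + (d + 1) + 1)) (Δ l) := by
      have := (ih (l + 1) (by omega)).2.cr (hs.disj l (by omega)).symm
      rwa [show l + 1 + d + 1 = l + (d + 1) + 1 by omega] at this
    exact ⟨h1, ((Reg.poly _ _).add ((R.on l (by omega)).reg_ctr h1)).congr
      fun z hz => R.step l _ (by omega) hl z hz⟩

lemma cr (R : TriRep m a Δ lam ρ A h) (hs : Sys m a Δ) {l k : ℕ} (hl : l < k) (hk : k ≤ m) :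
    CR (h (l + 1) k) (Δ l) := by
  have := (R.reg_aux hs (k - (l + 1)) l (by omega)).1
  rwa [show l + (k - (l + 1)) + 1 = k by omega] at this

lemma reg (R : TriRep m a Δ lam ρ A h) (hs : Sys m a Δ) {l k : ℕ} (hl : l < k) (hk : k ≤ m) :
    Reg (h l k) (Δ l) := by
  have := (R.reg_aux hs (k - (l + 1)) l (by omega)).2
  rwa [show l + (k - (l + 1)) + 1 = k by omega] at this

/-- The labels of the first `l` positions and of position `p`. -/
def lab (lam : Equiv.Perm ℕ) (l p : ℕ) (j : Fin (l + 1)) : ℕ := lam (if (j : ℕ) < l then j else p)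

lemma lab_injective (lam : Equiv.Perm ℕ) {l p : ℕ} (hp : l ≤ p) :
    Function.Injective (lab lam l p) := by
  intro i j hij
  have := lam.injective hij
  have hi := i.2
  have hj := j.2
  ext
  split_ifs at this <;> omega

lemma lab_le (R : TriRep m a Δ lam ρ A h) {l p : ℕ} (hl : l ≤ m) (hp : p ≤ m) (j : Fin (l + 1)) :
    lab lam l p j ≤ m := by
  refine (R.le _).2 ?_
  have := j.2
  split_ifs <;> omega

lemma det_eq (R : TriRep m a Δ lam ρ A h) {l k : ℕ} (hl : l < k) (hk : k ≤ m) {z : ℂ}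
    (hz : z.im ≠ 0) :
    (kMat l (fun r b => kerFun a l r b z) (lab lam l k)).det
      = h l k z * (kMat l (fun r b => kerFun a l r b z) (lab lam l l)).det := by
  obtain ⟨d, hd, hd2⟩ := exists_back_subst (m := m) (H := fun i j => h i j z)
    (fun i hi => by simp [R.self i hi]) (l := l) (by omega) (Pi.single k 1) (l + 1)
  have hdk : d k = 1 := by rw [hd k hl]; simp
  have hd0 : ∀ j, l < j → j ≠ k → d j = 0 := fun j hj hjk => by rw [hd j hj]; simp [hjk]
  have hdl : d l = -h l k z := by
    have := hd2 l le_rfl (by omega)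
    rw [Finset.sum_eq_add_of_mem l k (by simp; omega) (by simp; omega) (by omega) (by
      intro j hj hjk
      rw [Finset.mem_Icc] at hj
      rw [hd0 j (by omega) hjk.2, mul_zero]), R.self l (by omega), hdk] at this
    linear_combination this
  have hN := (R.ker l (by omega) z hz (fun b => d (lam.symm b))).1 (by
    intro i hi
    simpa using hd2 i hi (by omega))
  have e := det_last_col_eq (l := l) (d := d) (k := k) (col := fun p r =>
    if lam p ≤ l then (if (r : ℕ) = lam p then 1 else 0) else kerFun a l r (lam p) z) (by
      funext r
      have h1 := hN r (by omega)
      simp only [Pi.add_apply, Finset.sum_apply, Pi.smul_apply, smul_eq_mul, Pi.zero_apply]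
      set w : ℕ → ℂ := fun b => if b ≤ l then (if (r : ℕ) = b then 1 else 0)
        else kerFun a l r b z with hw
      have h2 : ∑ b ∈ Finset.Iic m, d (lam.symm b) * w b = 0 := by
        have hsplit : Finset.Iic m = Finset.Iic l ∪ Finset.Ioc l m := by
          ext x; simp only [Finset.mem_Iic, Finset.mem_union, Finset.mem_Ioc]; omega
        rw [hsplit, Finset.sum_union (by
          rw [Finset.disjoint_left]; intro x; simp only [Finset.mem_Iic, Finset.mem_Ioc]; omega),
          ← h1]
        congr 1
        · rw [Finset.sum_eq_single_of_mem (r : ℕ) (by simp; omega)]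
          · simp [hw, show (r : ℕ) ≤ l by omega]
          · intro b hb hbr
            simp [hw, Finset.mem_Iic.1 hb, Ne.symm hbr]
        · refine Finset.sum_congr rfl fun b hb => ?_
          have := (Finset.mem_Ioc.1 hb).1
          simp [hw, show ¬ b ≤ l by omega, mul_comm]
      have h3 : ∑ p ∈ Finset.Iic m, d p * w (lam p) = 0 := by
        rw [← h2]
        refine Finset.sum_equiv lam (fun p => by simp [R.le]) fun p _ => by simp
      have h4 : ∑ p ∈ Finset.Iic m, d p * w (lam p)
          = ∑ p ∈ insert k (insert l (Finset.range l)), d p * w (lam p) := by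
        symm
        refine Finset.sum_subset (fun x hx => ?_) fun x hx hx2 => ?_
        · simp only [Finset.mem_insert, Finset.mem_range, Finset.mem_Iic] at hx ⊢
          omega
        · simp only [Finset.mem_insert, Finset.mem_range, not_or] at hx2
          rw [hd0 x (by omega) hx2.1, zero_mul]
      rw [h3, Finset.sum_insert (by simp; omega), Finset.sum_insert (by simp), hdk] at h4
      change ∑ x ∈ Finset.range l, d x * w (lam x) + d l * w (lam l) + w (lam k) = 0
      linear_combination -h4)
  rw [hdl, neg_neg] at e
  exact e

lemma ne_zero (R : TriRep m a Δ lam ρ A h) (hs : Sys m a Δ) {l k : ℕ} (hl : l < k) (hk : k ≤ m)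
    {x : ℝ} (hx : x ∉ Δ l) : h l k x ≠ 0 := by
  have hx' : (x : ℂ) ∉ cSet (Δ l) := by rwa [mem_cSet_ofReal]
  have hon := hs.on l (by omega)
  have hcont : ∀ p, p ≤ m →
      ContinuousOn (fun z => (kMat l (fun r b => kerFun a l r b z) (lab lam l p)).det)
        (cSet (Δ l))ᶜ := by
    intro p hp
    rw [continuousOn_iff_continuous_domRestrict]
    refine Continuous.matrix_det ?_
    refine continuous_matrix fun r j => ?_
    simp only [kMat, Matrix.of_apply]
    split_ifs with h1 h2
    · fun_prop
    · fun_prop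
    · exact continuousOn_iff_continuous_domRestrict.1
        (hs.reg_kerFun (by omega) (by omega) (R.lab_le (by omega) hp j)).cont
  have key := eq_of_eq_im hon.cpt (hcont k hk) ((R.reg hs hl hk).cont.mul (hcont l (by omega)))
    (fun z hz => R.det_eq hl hk hz) hx'
  intro h0
  have hxne : ∀ y ∈ Δ l, x - y ≠ 0 := fun y hy h => hx (by rw [sub_eq_zero.1 h]; exact hy)
  have hdet := hs.kMat_det_ne_zero (l := l) (by omega) (θ := fun y => (x - y)⁻¹)
    (ContinuousOn.inv₀ (by fun_prop) hxne) (fun y hy => inv_ne_zero (hxne y hy))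
    (lab_injective lam hl.le) (R.lab_le (by omega) hk)
  apply hdet
  rw [Pi.mul_apply, h0, zero_mul] at key
  rw [← key]
  simp [kerFun, ctr]

end TriRep

lemma kMat_smul_det {l : ℕ} (W : ℕ → ℕ → ℂ) (z : ℂ) (β : Fin (l + 1) → ℕ) :
    (kMat l (fun r b => z * W r b) β).det
      = (kMat l W β).det * ∏ j, if β j ≤ l then 1 else z := by
  rw [← Matrix.det_diagonal, ← Matrix.det_mul]
  congr 1
  ext r j
  rw [Matrix.mul_diagonal]
  simp only [kMat, Matrix.of_apply]
  by_cases hj : β j ≤ l <;> simp [hj, mul_comm]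

lemma Sys.exists_tendsto_det {m : ℕ} {a : ℕ → CSM} {Δ : ℕ → Set ℝ} (h : Sys m a Δ) {l : ℕ}
    (hl : l < m) {β : Fin (l + 1) → ℕ} (hβ : Function.Injective β) (hm : ∀ j, β j ≤ m) :
    ∃ L : ℂ, L ≠ 0 ∧ Tendsto (fun y : ℝ =>
      (kMat l (fun r b => Complex.I * y * kerFun a l r b (Complex.I * y)) β).det) atTop
        (nhds L) := by
  refine ⟨_, h.kMat_det_ne_zero hl (θ := fun _ => 1) continuousOn_const (fun _ _ => one_ne_zero)
    hβ hm, ?_⟩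
  refine (Continuous.matrix_det continuous_id).continuousAt.tendsto.comp ?_
  refine tendsto_pi_nhds.2 fun r => tendsto_pi_nhds.2 fun j => ?_
  simp only [Matrix.of_apply]
  split_ifs with h1 h2
  · exact tendsto_const_nhds
  · exact tendsto_const_nhds
  · simp only [Complex.ofReal_one, mul_one]
    exact (h.on l hl).tendsto_mul_ctr
      (F := fun w => revFun a l r w * nikFun a (l + 1) (β j) w)
      (h.cr_ker (by omega) (by omega) (hm j)).cont

namespace TriRep

variable {m : ℕ} {a : ℕ → CSM} {Δ : ℕ → Set ℝ} {lam : Equiv.Perm ℕ} {ρ : ℕ → CSM}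
  {A : ℕ → ℕ → ℝ[X]} {h : ℕ → ℕ → ℂ → ℂ}

lemma scaled_eq (R : TriRep m a Δ lam ρ A h) {l k : ℕ} (hl : l < k) (hk : k ≤ m) {z : ℂ}
    (hz : z.im ≠ 0) :
    (kMat l (fun r b => z * kerFun a l r b z) (lab lam l k)).det * (if lam l ≤ l then 1 else z)
      = h l k z * (kMat l (fun r b => z * kerFun a l r b z) (lab lam l l)).det
        * (if lam k ≤ l then 1 else z) := by
  rw [kMat_smul_det, kMat_smul_det, R.det_eq hl hk hz, Fin.prod_univ_castSucc,
    Fin.prod_univ_castSucc]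
  simp only [lab, Fin.val_castSucc, Fin.is_lt, if_true, Fin.val_last, lt_irrefl, if_false]
  ring

lemma growth (R : TriRep m a Δ lam ρ A h) (hs : Sys m a Δ) {l k : ℕ} (hl : l < k) (hk : k ≤ m) :
    ∃ C : ℝ, ∀ᶠ y : ℝ in atTop, ‖h l k (Complex.I * y)‖
      ≤ C * y ^ (if lam k ≤ l ∧ l < lam l then 1 else 0) := by
  obtain ⟨L, hL, hLt⟩ := hs.exists_tendsto_det (l := l) (by omega) (lab_injective lam le_rfl)
    (R.lab_le (by omega) (by omega : l ≤ m))
  obtain ⟨K, hK, hKt⟩ := hs.exists_tendsto_det (l := l) (by omega) (lab_injective lam hl.le)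
    (R.lab_le (by omega) hk)
  have hq := (hKt.div hLt hL).norm
  refine ⟨‖K / L‖ + 1, ?_⟩
  filter_upwards [hq.eventually_lt_const (lt_add_one _), hLt.eventually_ne hL,
    eventually_ge_atTop 1] with y hy hy0 hy1
  have him : (Complex.I * y).im ≠ 0 := by simp; positivity
  have hne : Complex.I * (y : ℂ) ≠ 0 := fun h0 => him (by rw [h0]; rfl)
  have hn : ‖Complex.I * (y : ℂ)‖ = y := by simp [abs_of_nonneg (by linarith : (0 : ℝ) ≤ y)]
  have e := R.scaled_eq hl hk him
  have hh : h l k (Complex.I * y)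
      = (kMat l (fun r b => Complex.I * y * kerFun a l r b (Complex.I * y)) (lab lam l k)).det /
        (kMat l (fun r b => Complex.I * y * kerFun a l r b (Complex.I * y)) (lab lam l l)).det
        * ((if lam l ≤ l then 1 else Complex.I * y) / (if lam k ≤ l then 1 else Complex.I * y)) := by
    have : (if lam k ≤ l then 1 else Complex.I * (y : ℂ)) ≠ 0 := by
      split_ifs
      exacts [one_ne_zero, hne]
    field_simp
    linear_combination -e
  rw [hh, norm_mul]
  have hb : ‖(if lam l ≤ l then 1 else Complex.I * (y : ℂ)) /
      (if lam k ≤ l then 1 else Complex.I * y)‖ ≤ y ^ (if lam k ≤ l ∧ l < lam l then 1 else 0) := by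
    rw [norm_div]
    by_cases h1 : lam l ≤ l <;> by_cases h2 : lam k ≤ l
    · simp [h1, h2, not_lt.2 h1]
    · simp only [h1, h2, if_true, if_false, hn, norm_one, false_and, pow_zero]
      rw [div_le_one (by linarith)]
      exact hy1
    · simp [h1, h2, not_le.1 h1, abs_of_nonneg (by linarith : (0 : ℝ) ≤ y)]
    · simp only [h1, h2, if_false, hn, false_and, pow_zero]
      rw [div_self (by linarith)]
  exact mul_le_mul hy.le hb (norm_nonneg _) (by positivity)

lemma natDegree_le (R : TriRep m a Δ lam ρ A h) (hs : Sys m a Δ) {l k : ℕ} (hl : l < k)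
    (hk : k ≤ m) : (A l k).natDegree ≤ if lam k ≤ l ∧ l < lam l then 1 else 0 := by
  obtain ⟨C, hC⟩ := R.growth hs hl hk
  obtain ⟨C', hC'0, hC'⟩ := (R.on l (by omega)).norm_ctr_le (R.cr hs hl hk).cont
  refine natDegree_le_of_norm_aeval_le _ (C := C + C') ?_
  filter_upwards [hC, eventually_ge_atTop 1] with y hy hy1
  have him : (Complex.I * y).im ≠ 0 := by simp; positivity
  have e := R.step l k hl hk _ (notMem_cSet_of_im him)
  have h2 := hC' _ him
  have hle : C' * |(Complex.I * (y : ℂ)).im|⁻¹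
      ≤ C' * y ^ (if lam k ≤ l ∧ l < lam l then 1 else 0) := by
    refine mul_le_mul_of_nonneg_left ?_ hC'0
    have : |(Complex.I * (y : ℂ)).im|⁻¹ ≤ 1 := by
      simp only [Complex.mul_im, Complex.I_re, Complex.I_im, Complex.ofReal_im, Complex.ofReal_re,
        zero_mul, one_mul, zero_add]
      exact inv_le_one_of_one_le₀ (hy1.trans (le_abs_self y))
    exact this.trans (one_le_pow₀ hy1)
  calc ‖aeval (Complex.I * (y : ℂ)) (A l k)‖
      = ‖h l k (Complex.I * y) - ctr (ρ l) (h (l + 1) k) (Complex.I * y)‖ := by rw [e]; simp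
    _ ≤ _ := norm_sub_le _ _
    _ ≤ _ := by rw [add_mul]; exact add_le_add hy (h2.trans hle)

end TriRep

lemma CSM.On.exists_ctr_poly' {s : CSM} {Δ : Set ℝ} (h : s.On Δ) {F : ℂ → ℂ} (hF : CR F Δ)
    (T : ℝ[X]) : ∃ R : ℝ[X], ∀ z ∉ cSet Δ,
      ctr s (fun w => aeval w T * F w) z = aeval z T * ctr s F z - aeval z R :=
  let ⟨R, _, hR⟩ := h.exists_ctr_poly hF T.natDegree T degree_le_natDegree
  ⟨R, hR⟩

/-- Exchange identity for two consecutive levels. -/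
lemma exists_exchange {w μ τ ν : CSM} {Δ Δ' : Set ℝ} (hw : w.On Δ) (hμ : μ.On Δ') (hτ : τ.On Δ)
    (hν : ν.On Δ') (hd : Disjoint Δ Δ') {c : ℝ} {D : ℝ[X]}
    (hinv : ∀ z ∉ cSet Δ, (c + ctr w (fun _ => 1) z) * (aeval z D + ctr τ (fun _ => 1) z) = 1)
    (hνμ : ∀ F z, ctr ν F z = ctr μ (fun x => -(c + ctr w (fun _ => 1) x) * F x) z)
    {y : ℂ → ℂ} (hy : CR y Δ') (A B : ℝ[X]) :
    ∃ A' B' : ℝ[X],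
      (∀ z ∉ cSet Δ, z ∉ cSet Δ' → aeval z A + ctr w (fun x => aeval x B + ctr μ y x) z
        = (aeval z B + ctr μ y z) * (c + ctr w (fun _ => 1) z) + (aeval z B' + ctr ν y z)) ∧
      ∀ z ∉ cSet Δ, (aeval z A + ctr w (fun x => aeval x B + ctr μ y x) z)
          * (aeval z D + ctr τ (fun _ => 1) z)
        = aeval z A' + ctr τ (fun x => aeval x B' + ctr ν y x) z := by
  have hμy : CR (ctr μ y) Δ := (hμ.reg_ctr hy).cr hd.symm
  have hνy : CR (ctr ν y) Δ := (hν.reg_ctr hy).cr hd.symm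
  have hw1 : CR (ctr w fun _ => 1) Δ' := (hw.reg_ctr (CR.one Δ)).cr hd
  have hτ1 : CR (ctr τ fun _ => 1) Δ' := (hτ.reg_ctr (CR.one Δ)).cr hd
  obtain ⟨Rk, hRk⟩ := hw.exists_ctr_poly' (CR.one Δ) B
  set B' := A - C c * B - Rk with hB'
  obtain ⟨R1, hR1⟩ := hτ.exists_ctr_poly' (CR.one Δ) B'
  obtain ⟨R2, hR2⟩ := hν.exists_ctr_poly' hy D
  have h1 : ∀ z ∉ cSet Δ, z ∉ cSet Δ' → aeval z A + ctr w (fun x => aeval x B + ctr μ y x) z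
      = (aeval z B + ctr μ y z) * (c + ctr w (fun _ => 1) z) + (aeval z B' + ctr ν y z) := by
    intro z hz hz'
    have e1 := hw.ctr_mul_ctr hμ hd (CR.one Δ) hy hz hz'
    have e2 := hRk z hz
    simp only [mul_one] at e2
    simp only [one_mul] at e1
    rw [hw.ctr_add (CR.poly B Δ).cont hμy.cont hz, hνμ, e2]
    have e3 : ctr μ (fun x => -(c + ctr w (fun _ => 1) x) * y x) z
        = -c * ctr μ y z - ctr μ (fun x => y x * ctr w (fun _ => 1) x) z := by
      have e4 : (fun x => -(c + ctr w (fun _ => 1) x) * y x)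
          = fun x => -(c : ℂ) * y x + (-1) * (y x * ctr w (fun _ => 1) x) := by
        funext x; ring
      rw [e4, hμ.ctr_add (F := fun x => -(c : ℂ) * y x)
        (G := fun x => (-1) * (y x * ctr w (fun _ => 1) x)) (continuousOn_const.mul hy.cont)
        (continuousOn_const.mul (hy.mul hw1).cont) hz', CSM.On.ctr_const_mul,
        CSM.On.ctr_const_mul]
      ring
    rw [e3, hB']
    simp only [map_sub, map_mul, aeval_C, Complex.coe_algebraMap]
    linear_combination -e1
  refine ⟨B + D * B' + R1 + R2, B', h1, fun z hz => ?_⟩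
  have hv' : CR (fun x => aeval x B' + ctr ν y x) Δ := (CR.poly B' Δ).add hνy
  have hv : CR (fun x => aeval x B + ctr μ y x) Δ := (CR.poly B Δ).add hμy
  refine eq_of_eq_im (f := fun z => (aeval z A + ctr w (fun x => aeval x B + ctr μ y x) z)
      * (aeval z D + ctr τ (fun _ => 1) z)) (g := fun z => aeval z (B + D * B' + R1 + R2)
      + ctr τ (fun x => aeval x B' + ctr ν y x) z) hw.cpt
    (((Reg.poly A Δ).add (hw.reg_ctr hv)).mul
      ((Reg.poly D Δ).add (hτ.reg_ctr (CR.one Δ)))).cont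
    ((Reg.poly _ Δ).add (hτ.reg_ctr hv')).cont (fun z hz => ?_) hz
  have hzΔ : z ∉ cSet Δ := notMem_cSet_of_im hz
  have hzΔ' : z ∉ cSet Δ' := notMem_cSet_of_im hz
  have e1 := hτ.ctr_mul_ctr hν hd (CR.one Δ) hy hzΔ hzΔ'
  have e2 := hR1 z hzΔ
  have e3 := hR2 z hzΔ'
  simp only [mul_one] at e2
  simp only [one_mul] at e1
  have e4 : ctr ν (fun x => y x * ctr τ (fun _ => 1) x) z
      = -ctr μ y z - ctr ν (fun x => aeval x D * y x) z := by
    have e6 := hμ.ctr_add (F := fun x => (-1) * y x)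
      (G := fun x => (-1) * (-(c + ctr w (fun _ => 1) x) * (aeval x D * y x)))
      (continuousOn_const.mul hy.cont) (continuousOn_const.mul
        (((continuousOn_const.add hw1.cont).neg).mul ((CR.poly D Δ').mul hy).cont)) hzΔ'
    rw [CSM.On.ctr_const_mul, CSM.On.ctr_const_mul] at e6
    rw [hνμ, hνμ]
    refine Eq.trans (hμ.ctr_congr (fun x hx => ?_) z) (e6.trans (by ring))
    have hx' : (x : ℂ) ∉ cSet Δ := by
      rw [mem_cSet_ofReal]
      exact fun h => hd.le_bot ⟨h, hx⟩
    linear_combination (-y x) * hinv x hx'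
  have e5 := hinv z hzΔ
  rw [h1 z hzΔ hzΔ', hτ.ctr_add (CR.poly B' Δ).cont hνy.cont hzΔ, e2]
  simp only [map_add, map_mul]
  linear_combination (aeval z B + ctr μ y z) * e5 + e1 + e4 - e3

lemma sum_Icc_swap {m l i : ℕ} (hi : i ≤ l) (hl : l < m) (f : ℕ → ℂ) :
    ∑ k ∈ Finset.Icc i m, f (Equiv.swap l (l + 1) k) = ∑ k ∈ Finset.Icc i m, f k := by
  refine Finset.sum_equiv (Equiv.swap l (l + 1)) (fun k => ?_) fun _ _ => rfl
  simp only [Finset.mem_Icc, Equiv.swap_apply_def]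
  split_ifs <;> omega

lemma sum_Icc_head {m l : ℕ} (hl : l ≤ m) (f : ℕ → ℂ) :
    ∑ k ∈ Finset.Icc l m, f k = f l + ∑ k ∈ Finset.Icc (l + 1) m, f k := by
  rw [← Finset.insert_Icc_add_one_left_eq_Icc hl, Finset.sum_insert (by simp)]

lemma rows_iff {l L : ℕ} {row row' : ℕ → ℂ} {u v : ℂ} (hu : u ≠ 0) (hv : v ≠ 0)
    (h : ∀ i ≤ L, i ≠ l → i ≠ l + 1 → row' i = row i) (hl : row' l = u * row l)
    (hl1 : l + 1 ≤ L → row' (l + 1) = row l - v * row (l + 1)) :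
    (∀ i ≤ L, row' i = 0) ↔ ∀ i ≤ L, row i = 0 := by
  constructor
  · intro h0 i hi
    by_cases h1 : i = l
    · subst h1
      have := h0 i hi
      rw [hl] at this
      exact (mul_eq_zero.1 this).resolve_left hu
    · by_cases h2 : i = l + 1
      · subst h2
        have h3 := h0 l (by omega)
        rw [hl] at h3
        have h4 := h0 (l + 1) hi
        rw [hl1 hi, (mul_eq_zero.1 h3).resolve_left hu, zero_sub, neg_eq_zero] at h4
        exact (mul_eq_zero.1 h4).resolve_left hv
      · rw [← h i hi h1 h2, h0 i hi]
  · intro h0 i hi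
    by_cases h1 : i = l
    · subst h1
      rw [hl, h0 i hi, mul_zero]
    · by_cases h2 : i = l + 1
      · subst h2
        rw [hl1 hi, h0 l (by omega), h0 (l + 1) hi, mul_zero, sub_zero]
      · rw [h i hi h1 h2, h0 i hi]

namespace TriRep

variable {m : ℕ} {a : ℕ → CSM} {Δ : ℕ → Set ℝ} {lam : Equiv.Perm ℕ} {ρ : ℕ → CSM}
  {A : ℕ → ℕ → ℝ[X]} {h : ℕ → ℕ → ℂ → ℂ}

lemma exists_const (R : TriRep m a Δ lam ρ A h) (hs : Sys m a Δ) {l : ℕ} (hl : l < m)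
    (hlam : lam l < lam (l + 1)) :
    ∃ c : ℝ, ∀ z ∉ cSet (Δ l), h l (l + 1) z = c + ctr (ρ l) (fun _ => 1) z := by
  have hd := R.natDegree_le hs (l := l) (k := l + 1) (by omega) hl
  rw [if_neg (by omega)] at hd
  refine ⟨(A l (l + 1)).coeff 0, fun z hz => ?_⟩
  rw [R.step l (l + 1) (by omega) hl z hz, R.self (l + 1) hl,
    eq_C_of_natDegree_le_zero hd]
  simp

/-- Two consecutive members of a triangular representation may be exchanged. -/
lemma exists_swap (R : TriRep m a Δ lam ρ A h) (hs : Sys m a Δ) {l : ℕ} (hl : l < m)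
    (hlam : lam l < lam (l + 1)) :
    ∃ ρ' A' h', TriRep m a Δ ((Equiv.swap l (l + 1)).trans lam) ρ' A' h' := by
  set s := Equiv.swap l (l + 1) with hsw
  have s_l : s l = l + 1 := Equiv.swap_apply_left _ _
  have s_l1 : s (l + 1) = l := Equiv.swap_apply_right _ _
  have s_ne : ∀ k, k ≠ l → k ≠ l + 1 → s k = k := fun k h1 h2 => Equiv.swap_apply_of_ne_of_ne h1 h2
  obtain ⟨c, hc⟩ := R.exists_const hs hl hlam
  obtain ⟨τ, D, hτ, hinv⟩ := (R.on l hl).exists_inv_linear c (fun x hx => by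
    rw [← hc x (by rwa [mem_cSet_ofReal])]
    exact R.ne_zero hs (Nat.lt_succ_self l) hl hx)
  set U : ℂ → ℂ := fun z => aeval z D + ctr τ (fun _ => 1) z with hUdef
  have hU : ∀ z ∉ cSet (Δ l), h l (l + 1) z * U z = 1 := fun z hz => by rw [hc z hz]; exact hinv z hz
  obtain ⟨ρm, hρm⟩ : ∃ ρm : CSM, ∀ i, i + 1 = l → ρm.On (Δ i) ∧
      ∀ F z, ctr ρm F z = ctr (ρ i) (fun w => h l (l + 1) w * F w) z := by
    cases l with
    | zero => exact ⟨τ, fun i hi => by omega⟩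
    | succ i =>
      have hd := hs.disj i hl
      obtain ⟨ρm, h1, h2⟩ := (R.on i (by omega)).exists_dens
        ((R.reg hs (Nat.lt_succ_self (i + 1)) hl).cr hd.symm) fun x hx =>
          R.ne_zero hs (Nat.lt_succ_self (i + 1)) hl fun h' => hd.le_bot ⟨hx, h'⟩
      exact ⟨ρm, fun j hj => by
        obtain rfl : j = i := by omega
        exact ⟨h1, h2⟩⟩
  obtain ⟨ν, hν⟩ : ∃ ν : CSM, l + 1 < m → ν.On (Δ (l + 1)) ∧ ∀ F z, ctr ν F z
      = ctr (ρ (l + 1)) (fun x => -(c + ctr (ρ l) (fun _ => 1) x) * F x) z := by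
    by_cases hl1 : l + 1 < m
    · have hd := hs.disj l hl1
      have hreg : Reg (fun x => -(c + ctr (ρ l) (fun _ => 1) x)) (Δ l) :=
        ((Reg.const c _).add ((R.on l hl).reg_ctr (CR.one _))).neg
      obtain ⟨ν, h1, h2⟩ := (R.on (l + 1) hl1).exists_dens (hreg.cr hd) fun x hx => by
        have hx' : x ∉ Δ l := fun h' => hd.le_bot ⟨h', hx⟩
        rw [← hc x (by rwa [mem_cSet_ofReal])]
        exact neg_ne_zero.2 (R.ne_zero hs (Nat.lt_succ_self l) hl hx')
      exact ⟨ν, fun _ => ⟨h1, h2⟩⟩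
    · exact ⟨τ, fun h' => absurd h' hl1⟩
  have hex : ∀ k, ∃ A' B' : ℝ[X], l + 1 < k → k ≤ m →
      (∀ z ∉ cSet (Δ l), z ∉ cSet (Δ (l + 1)) → h l k z = h (l + 1) k z * h l (l + 1) z
        + (aeval z B' + ctr ν (h (l + 2) k) z)) ∧
      ∀ z ∉ cSet (Δ l), h l k z * U z
        = aeval z A' + ctr τ (fun x => aeval x B' + ctr ν (h (l + 2) k) x) z := by
    intro k
    by_cases hk : l + 1 < k ∧ k ≤ m
    · have hd := hs.disj l (by omega)
      obtain ⟨A', B', h1, h2⟩ := exists_exchange (R.on l hl) (R.on (l + 1) (by omega)) hτ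
        (hν (by omega)).1 hd hinv (hν (by omega)).2 (R.cr hs hk.1 hk.2) (A l k) (A (l + 1) k)
      have e : ∀ z ∉ cSet (Δ l), h l k z = aeval z (A l k)
          + ctr (ρ l) (fun x => aeval x (A (l + 1) k) + ctr (ρ (l + 1)) (h (l + 2) k) x) z := by
        intro z hz
        rw [R.step l k (by omega) hk.2 z hz]
        congr 1
        refine (R.on l hl).ctr_congr (fun x hx => ?_) z
        refine R.step (l + 1) k hk.1 hk.2 x ?_
        rw [mem_cSet_ofReal]
        exact fun h' => hd.le_bot ⟨hx, h'⟩
      refine ⟨A', B', fun _ _ => ⟨fun z hz hz' => ?_, fun z hz => ?_⟩⟩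
      · rw [e z hz, R.step (l + 1) k hk.1 hk.2 z hz', hc z hz]
        exact h1 z hz hz'
      · rw [e z hz]
        exact h2 z hz
    · exact ⟨0, 0, fun h1 h2 => absurd ⟨h1, h2⟩ hk⟩
  choose A' B' hAB using hex
  set ρ' : ℕ → CSM := fun i => if i = l then τ else if i = l + 1 then ν else
    if i + 1 = l then ρm else ρ i with hρ'
  set A₂ : ℕ → ℕ → ℝ[X] := fun i k => if i < l then A i (s k) else if i = l then
    (if k = l + 1 then D else A' k) else if i = l + 1 then B' k else A i k with hA₂
  set h₂ : ℕ → ℕ → ℂ → ℂ := fun i k => if i < l then h i (s k) else if i = l then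
    (if k = l then fun _ => 1 else fun z => h l (s k) z * U z) else if i = l + 1 then
    (if k = l + 1 then fun _ => 1 else fun z => aeval z (B' k) + ctr ν (h (l + 2) k) z)
    else h i k with hh₂
  have h₂_lt : ∀ i k, i < l → h₂ i k = h i (s k) := fun i k hi => by simp [hh₂, hi]
  have h₂_ll : h₂ l l = fun _ => 1 := by simp [hh₂]
  have h₂_l : ∀ k, k ≠ l → h₂ l k = fun z => h l (s k) z * U z := fun k hk => by simp [hh₂, hk]
  have h₂_l1l1 : h₂ (l + 1) (l + 1) = fun _ => 1 := by simp [hh₂]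
  have h₂_l1 : ∀ k, k ≠ l + 1 → h₂ (l + 1) k
      = fun z => aeval z (B' k) + ctr ν (h (l + 2) k) z := fun k hk => by simp [hh₂, hk]
  have h₂_gt : ∀ i k, l + 1 < i → h₂ i k = h i k := fun i k hi => by
    simp [hh₂, show ¬ i < l by omega, show i ≠ l by omega, show i ≠ l + 1 by omega]
  have hone : h l l = fun _ => 1 := R.self l hl.le
  refine ⟨ρ', A₂, h₂, ?_, ?_, ?_, ?_, ?_⟩
  · intro k
    rw [Equiv.trans_apply, R.le, hsw, Equiv.swap_apply_def]
    split_ifs <;> omega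
  · intro i hi
    simp only [hρ']
    split_ifs with h1 h2 h3
    · rw [h1]; exact hτ
    · rw [h2]; exact (hν (by omega)).1
    · exact (hρm i h3).1
    · exact R.on i hi
  · intro i hi
    rcases lt_trichotomy i l with h1 | h1 | h1
    · rw [h₂_lt _ _ h1, s_ne i (by omega) (by omega), R.self i hi]
    · rw [h1, h₂_ll]
    · by_cases h2 : i = l + 1
      · rw [h2, h₂_l1l1]
      · rw [h₂_gt _ _ (by omega), R.self i hi]
  · intro i k hik hk z hz
    rcases lt_trichotomy i l with h1 | h1 | h1
    · have hsk : i < s k ∧ s k ≤ m := by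
        rw [hsw, Equiv.swap_apply_def]
        split_ifs <;> omega
      rw [h₂_lt _ _ h1, R.step i (s k) hsk.1 hsk.2 z hz]
      have eA : A₂ i k = A i (s k) := by simp [hA₂, h1]
      rw [eA]
      congr 1
      by_cases h2 : i + 1 = l
      · have eρ : ρ' i = ρm := by
          simp [hρ', show i ≠ l by omega, show i ≠ l + 1 by omega, h2]
        rw [eρ, (hρm i h2).2, h2]
        refine (R.on i (by omega)).ctr_congr (fun x hx => ?_) z
        by_cases h3 : k = l
        · rw [h3, s_l, h₂_ll, mul_one]
        · have hx' : (x : ℂ) ∉ cSet (Δ l) := by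
            rw [mem_cSet_ofReal]
            intro h'
            have hd := hs.disj i (by omega)
            rw [h2] at hd
            exact hd.le_bot ⟨hx, h'⟩
          rw [h₂_l k h3]
          linear_combination -h l (s k) x * hU x hx'
      · have eρ : ρ' i = ρ i := by
          simp [hρ', show i ≠ l by omega, show i ≠ l + 1 by omega, h2]
        rw [eρ, h₂_lt _ _ (by omega)]
    · subst h1
      have eρ : ρ' i = τ := by simp [hρ']
      rw [h₂_l k (by omega), eρ]
      by_cases h2 : k = i + 1
      · subst h2
        have eA : A₂ i (i + 1) = D := by simp [hA₂]
        rw [eA, h₂_l1l1, s_l1, hone]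
        exact one_mul (U z)
      · have eA : A₂ i k = A' k := by simp [hA₂, h2]
        rw [eA, h₂_l1 k h2, s_ne k (by omega) h2]
        exact (hAB k (by omega) hk).2 z hz
    · by_cases h2 : i = l + 1
      · subst h2
        have eρ : ρ' (l + 1) = ν := by simp [hρ']
        have eA : A₂ (l + 1) k = B' k := by simp [hA₂]
        rw [h₂_l1 k (by omega), eρ, eA, h₂_gt _ _ (by omega)]
      · have eρ : ρ' i = ρ i := by
          simp [hρ', show i ≠ l by omega, h2, show i + 1 ≠ l by omega]
        have eA : A₂ i k = A i k := by
          simp [hA₂, h2, show ¬ i < l by omega, show i ≠ l by omega]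
        rw [h₂_gt _ _ (by omega), eρ, eA, h₂_gt _ _ (by omega)]
        exact R.step i k hik hk z hz
  · intro L hL z hz c'
    rw [← R.ker L hL z hz c']
    have hzl : z ∉ cSet (Δ l) := notMem_cSet_of_im hz
    have hUz := hU z hzl
    have hrow : ∀ i < l, ∑ k ∈ Finset.Icc i m, h₂ i k z * c' ((s.trans lam) k)
        = ∑ k ∈ Finset.Icc i m, h i k z * c' (lam k) := by
      intro i hi
      rw [← sum_Icc_swap hi.le hl (fun k => h i k z * c' (lam k))]
      refine Finset.sum_congr rfl fun k _ => ?_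
      rw [h₂_lt _ _ hi, Equiv.trans_apply]
    have hrowl : ∑ k ∈ Finset.Icc l m, h₂ l k z * c' ((s.trans lam) k)
        = U z * ∑ k ∈ Finset.Icc l m, h l k z * c' (lam k) := by
      rw [← sum_Icc_swap le_rfl hl (fun k => h l k z * c' (lam k)), Finset.mul_sum]
      refine Finset.sum_congr rfl fun k _ => ?_
      rw [Equiv.trans_apply, ← hsw]
      by_cases hk : k = l
      · subst hk
        rw [h₂_ll, s_l]
        linear_combination -c' (lam (k + 1)) * hUz
      · rw [h₂_l k hk]
        ring
    have hrowgt : ∀ i, l + 1 < i → ∑ k ∈ Finset.Icc i m, h₂ i k z * c' ((s.trans lam) k)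
        = ∑ k ∈ Finset.Icc i m, h i k z * c' (lam k) := by
      intro i hi
      refine Finset.sum_congr rfl fun k hk => ?_
      have := (Finset.mem_Icc.1 hk).1
      rw [h₂_gt _ _ hi, Equiv.trans_apply, s_ne k (by omega) (by omega)]
    by_cases hlL : l ≤ L
    · refine rows_iff (l := l) (u := U z) (v := h l (l + 1) z) (right_ne_zero_of_mul_eq_one hUz)
        (left_ne_zero_of_mul_eq_one hUz) (fun i hi h1 h2 => ?_) hrowl (fun hL1 => ?_)
      · rcases lt_or_gt_of_ne h1 with h3 | h3
        · exact hrow i h3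
        · exact hrowgt i (by omega)
      · have hzl1 : z ∉ cSet (Δ (l + 1)) := notMem_cSet_of_im hz
        have t1 : ∑ k ∈ Finset.Icc (l + 1) m, h₂ (l + 1) k z * c' ((s.trans lam) k)
            = c' (lam l) + ∑ k ∈ Finset.Icc (l + 2) m,
              (h l k z * c' (lam k) - h l (l + 1) z * (h (l + 1) k z * c' (lam k))) := by
          rw [sum_Icc_head (by omega), h₂_l1l1, Equiv.trans_apply, s_l1, one_mul]
          congr 1
          refine Finset.sum_congr rfl fun k hk => ?_
          rw [Finset.mem_Icc] at hk
          rw [h₂_l1 k (by omega), Equiv.trans_apply, s_ne k (by omega) (by omega),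
            (hAB k (by omega) hk.2).1 z hzl hzl1]
          ring
        have t2 : ∑ k ∈ Finset.Icc l m, h l k z * c' (lam k) = c' (lam l)
            + (h l (l + 1) z * c' (lam (l + 1))
              + ∑ k ∈ Finset.Icc (l + 2) m, h l k z * c' (lam k)) := by
          rw [sum_Icc_head (by omega), sum_Icc_head (by omega), hone, one_mul]
        have t3 : ∑ k ∈ Finset.Icc (l + 1) m, h (l + 1) k z * c' (lam k)
            = c' (lam (l + 1)) + ∑ k ∈ Finset.Icc (l + 2) m, h (l + 1) k z * c' (lam k) := by
          rw [sum_Icc_head (by omega), R.self (l + 1) (by omega), one_mul]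
        rw [t1, t2, t3, Finset.sum_sub_distrib, ← Finset.mul_sum]
        ring
    · have : ∀ i ≤ L, ∑ k ∈ Finset.Icc i m, h₂ i k z * c' ((s.trans lam) k)
          = ∑ k ∈ Finset.Icc i m, h i k z * c' (lam k) := fun i hi => hrow i (by omega)
      exact forall₂_congr fun i hi => by rw [this i hi]

end TriRep

lemma sum_swap_lt {m l : ℕ} (hl : l < m) {f : ℕ → ℕ} (hf : f l < f (l + 1)) :
    ∑ k ∈ Finset.range (m + 1), k * f (Equiv.swap l (l + 1) k)
      < ∑ k ∈ Finset.range (m + 1), k * f k := by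
  have h1 : l ∈ Finset.range (m + 1) := by simp; omega
  have h2 : l + 1 ∈ (Finset.range (m + 1)).erase l := by simp; omega
  rw [← Finset.add_sum_erase _ _ h1, ← Finset.add_sum_erase _ _ h2,
    ← Finset.add_sum_erase _ (fun k => k * f k) h1, ← Finset.add_sum_erase _ (fun k => k * f k) h2,
    Equiv.swap_apply_left, Equiv.swap_apply_right]
  have : ∑ k ∈ ((Finset.range (m + 1)).erase l).erase (l + 1), k * f (Equiv.swap l (l + 1) k)
      = ∑ k ∈ ((Finset.range (m + 1)).erase l).erase (l + 1), k * f k := by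
    refine Finset.sum_congr rfl fun k hk => ?_
    simp only [Finset.mem_erase] at hk
    rw [Equiv.swap_apply_of_ne_of_ne hk.2.1 hk.1]
  rw [this]
  nlinarith

namespace TriRep

variable {m : ℕ} {a : ℕ → CSM} {Δ : ℕ → Set ℝ} {lam : Equiv.Perm ℕ} {ρ : ℕ → CSM}
  {A : ℕ → ℕ → ℝ[X]} {h : ℕ → ℕ → ℂ → ℂ}

lemma sys (R : TriRep m a Δ lam ρ A h) (hs : Sys m a Δ) : Sys m ρ Δ := ⟨R.on, hs.disj⟩

lemma exists_sorted (hs : Sys m a Δ) (n : ℕ → ℕ) (N : ℕ) :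
    ∀ (lam : Equiv.Perm ℕ) (ρ : ℕ → CSM) (A : ℕ → ℕ → ℝ[X]) (h : ℕ → ℕ → ℂ → ℂ),
    TriRep m a Δ lam ρ A h → (∀ i j, i < j → j ≤ m → lam j < lam i → n (lam j) < n (lam i)) →
    ∑ k ∈ Finset.range (m + 1), k * n (lam k) ≤ N →
    ∃ (lam : Equiv.Perm ℕ) (ρ : ℕ → CSM) (A : ℕ → ℕ → ℝ[X]) (h : ℕ → ℕ → ℂ → ℂ),
    TriRep m a Δ lam ρ A h ∧ (∀ i j, i < j → j ≤ m → lam j < lam i → n (lam j) < n (lam i)) ∧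
    ∀ l < m, n (lam (l + 1)) ≤ n (lam l) := by
  induction N with
  | zero =>
    intro lam ρ A h R hinv hN
    refine ⟨lam, ρ, A, h, R, hinv, fun l hl => ?_⟩
    by_contra! hlt
    have := sum_swap_lt hl (f := fun k => n (lam k)) hlt
    omega
  | succ N ih =>
    intro lam ρ A h R hinv hN
    by_cases hex : ∃ l < m, n (lam l) < n (lam (l + 1))
    · obtain ⟨l, hl, hlt⟩ := hex
      have hlam : lam l < lam (l + 1) := by
        rcases lt_trichotomy (lam l) (lam (l + 1)) with h1 | h1 | h1
        · exact h1
        · rw [h1] at hlt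
          exact absurd hlt (lt_irrefl _)
        · exact absurd (hinv l (l + 1) (by omega) hl h1) (by omega)
      obtain ⟨ρ', A', h', R'⟩ := R.exists_swap hs hl hlam
      refine ih _ ρ' A' h' R' (fun i j hij hj hlt' => ?_) ?_
      · simp only [Equiv.trans_apply] at hlt' ⊢
        by_cases hc : i = l ∧ j = l + 1
        · obtain ⟨rfl, rfl⟩ := hc
          rw [Equiv.swap_apply_left, Equiv.swap_apply_right]
          exact hlt
        · refine hinv _ _ ?_ ?_ hlt'
          · simp only [Equiv.swap_apply_def]
            split_ifs <;> omega
          · simp only [Equiv.swap_apply_def]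
            split_ifs <;> omega
      · have := sum_swap_lt hl (f := fun k => n (lam k)) hlt
        simp only [Equiv.trans_apply]
        omega
    · push Not at hex
      exact ⟨lam, ρ, A, h, R, hinv, hex⟩

lemma nikFun_label (R : TriRep m a Δ lam ρ A h) (hs : Sys m a Δ) {k : ℕ} (hk : k ≤ m) {z : ℂ}
    (hz : 0 < m → z ∉ cSet (Δ 0)) :
    nikFun a 0 (lam k) z = nikFun a 0 (lam 0) z * h 0 k z := by
  rcases Nat.eq_zero_or_pos k with rfl | hk0
  · rw [R.self 0 hk, mul_one]
  have hm : 0 < m := by omega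
  have hc : ∀ p ≤ m, ContinuousOn (nikFun a 0 p) (cSet (Δ 0))ᶜ := by
    intro p hp
    rcases Nat.eq_zero_or_pos p with rfl | hp0
    · rw [nikFun_self]
      exact continuousOn_const
    · exact (hs.reg_nikFun hp0 hp).cont
  refine eq_of_eq_im (hs.on 0 hm).cpt (hc _ ((R.le k).2 hk))
    ((hc _ ((R.le 0).2 (by omega))).mul (R.reg hs hk0 hk).cont) (fun z hz => ?_) (hz hm)
  set c : ℕ → ℂ := fun b => if b = lam k then 1 else if b = lam 0 then -h 0 k z else 0 with hcdef
  have hne : lam k ≠ lam 0 := fun e => by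
    have := lam.injective e
    omega
  have hck : c (lam k) = 1 := by simp [hcdef]
  have hc0 : c (lam 0) = -h 0 k z := by simp [hcdef, hne.symm]
  have hco : ∀ b, b ≠ lam k → b ≠ lam 0 → c b = 0 := fun b h1 h2 => by simp [hcdef, h1, h2]
  have e1 := (hs.kernel_iff hz c 0 hm).2 ((R.ker 0 hm z hz c).1 (fun i hi => by
    obtain rfl : i = 0 := by omega
    rw [Finset.sum_eq_add_of_mem 0 k (by simp) (by simp; omega) (by omega), hck, hc0,
      R.self 0 (by omega)]
    · ring
    · intro j _ hj
      rw [hco _ (fun e => hj.2 (lam.injective e)) (fun e => hj.1 (lam.injective e)), mul_zero])) 0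
        le_rfl
  rw [Finset.sum_eq_add_of_mem (lam 0) (lam k) (by simp [R.le]) (by simp [R.le, hk]) hne.symm, hck,
    hc0] at e1
  · show nikFun a 0 (lam k) z = nikFun a 0 (lam 0) z * h 0 k z
    linear_combination e1
  · intro j _ hj
    rw [hco j hj.2 hj.1, mul_zero]

lemma exists_forms (R : TriRep m a Δ lam ρ A h) (hs : Sys m a Δ) {N : ℕ → ℕ}
    (hN : ∀ l k, l < k → k ≤ m → (A l k).natDegree + N k ≤ N l) (d : ℕ) : ∀ l, l + d = m →
    ∀ p : ℕ → ℝ[X], (∀ k, l ≤ k → k ≤ m → (p k).degree < N k) →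
    ∃ q : ℕ → ℝ[X], (∀ k, l ≤ k → k ≤ m → (q k).degree < N k) ∧
      ∀ z : ℂ, (l < m → z ∉ cSet (Δ l)) →
        ∑ k ∈ Finset.Icc l m, aeval z (p k) * h l k z
          = ∑ k ∈ Finset.Icc l m, aeval z (q k) * nikFun ρ l k z := by
  induction d with
  | zero =>
    intro l hl p hp
    obtain rfl : l = m := by omega
    refine ⟨p, hp, fun z _ => ?_⟩
    simp [R.self]
  | succ d ih =>
    intro l hl p hp
    have hlm : l < m := by omega
    have hon := R.on l hlm
    obtain ⟨q, hq, hqe⟩ := ih (l + 1) (by omega) p fun k h1 h2 => hp k (by omega) h2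
    have hR1 : ∀ k, ∃ T : ℝ[X], l < k → k ≤ m → T.degree < N k ∧ ∀ z ∉ cSet (Δ l),
        ctr (ρ l) (fun w => aeval w (p k) * h (l + 1) k w) z
          = aeval z (p k) * ctr (ρ l) (h (l + 1) k) z - aeval z T := by
      intro k
      by_cases hk : l < k ∧ k ≤ m
      · obtain ⟨T, hT, hTe⟩ := hon.exists_ctr_poly (R.cr hs hk.1 hk.2) (N k) (p k)
          (hp k hk.1.le hk.2).le
        exact ⟨T, fun _ _ => ⟨hT, hTe⟩⟩
      · exact ⟨0, fun h1 h2 => absurd ⟨h1, h2⟩ hk⟩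
    have hR2 : ∀ k, ∃ T : ℝ[X], l < k → k ≤ m → T.degree < N k ∧ ∀ z ∉ cSet (Δ l),
        ctr (ρ l) (fun w => aeval w (q k) * nikFun ρ (l + 1) k w) z
          = aeval z (q k) * nikFun ρ l k z - aeval z T := by
      intro k
      by_cases hk : l < k ∧ k ≤ m
      · obtain ⟨T, hT, hTe⟩ := hon.exists_ctr_poly ((R.sys hs).cr_nikFun hk.1 hk.2) (N k) (q k)
          (hq k hk.1 hk.2).le
        refine ⟨T, fun _ _ => ⟨hT, fun z hz => ?_⟩⟩
        rw [nikFun_of_lt ρ hk.1]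
        exact hTe z hz
      · exact ⟨0, fun h1 h2 => absurd ⟨h1, h2⟩ hk⟩
    choose S hS using hR1
    choose T hT using hR2
    set q0 : ℝ[X] := p l + ∑ k ∈ Finset.Icc (l + 1) m, (p k * A l k + S k - T k) with hq0
    refine ⟨Function.update q l q0, fun k h1 h2 => ?_, fun z hz => ?_⟩
    · by_cases hk : k = l
      · subst hk
        rw [Function.update_self, hq0]
        have hmono : ∀ j, k < j → j ≤ m → ((N j : ℕ) : WithBot ℕ) ≤ N k := fun j h3 h4 => by
          have := hN k j h3 h4
          exact_mod_cast (by omega : N j ≤ N k)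
        rw [← mem_degreeLT]
        refine add_mem (mem_degreeLT.2 (hp k le_rfl h2)) (sum_mem fun j hj => ?_)
        rw [Finset.mem_Icc] at hj
        refine sub_mem (add_mem ?_ ?_) ?_ <;> rw [mem_degreeLT]
        · by_cases h0 : p j = 0
          · rw [h0, zero_mul, degree_zero]
            exact WithBot.bot_lt_coe _
          · have h5 := hp j (by omega) hj.2
            rw [degree_eq_natDegree h0] at h5
            have h5' : (p j).natDegree < N j := by exact_mod_cast h5
            refine (degree_le_natDegree.trans (Nat.cast_le.2 natDegree_mul_le)).trans_lt ?_
            have := hN k j (by omega) hj.2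
            exact_mod_cast (by omega : (p j).natDegree + (A k j).natDegree < N k)
        · exact ((hS j (by omega) hj.2).1).trans_le (hmono j (by omega) hj.2)
        · exact ((hT j (by omega) hj.2).1).trans_le (hmono j (by omega) hj.2)
      · rw [Function.update_of_ne hk]
        exact hq k (by omega) h2
    · have hz' := hz hlm
      have e1 : ∑ k ∈ Finset.Icc (l + 1) m, ctr (ρ l) (fun w => aeval w (p k) * h (l + 1) k w) z
          = ∑ k ∈ Finset.Icc (l + 1) m,
            ctr (ρ l) (fun w => aeval w (q k) * nikFun ρ (l + 1) k w) z := by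
        rw [← hon.ctr_sum _ (fun k hk => ?_) hz', ← hon.ctr_sum _ (fun k hk => ?_) hz']
        · refine hon.ctr_congr (fun x hx => hqe x fun hl1 => ?_) z
          rw [mem_cSet_ofReal]
          exact fun h' => (hs.disj l hl1).le_bot ⟨hx, h'⟩
        · rw [Finset.mem_Icc] at hk
          exact ((CR.poly (q k) _).mul ((R.sys hs).cr_nikFun hk.1 hk.2)).cont
        · rw [Finset.mem_Icc] at hk
          exact ((CR.poly (p k) _).mul (R.cr hs hk.1 hk.2)).cont
      rw [sum_Icc_head hlm.le, sum_Icc_head hlm.le, R.self l hlm.le, nikFun_self,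
        Function.update_self]
      have e2 : ∑ k ∈ Finset.Icc (l + 1) m, aeval z (p k) * h l k z
          = ∑ k ∈ Finset.Icc (l + 1) m, (aeval z (p k * A l k + S k)
            + ctr (ρ l) (fun w => aeval w (p k) * h (l + 1) k w) z) := by
        refine Finset.sum_congr rfl fun k hk => ?_
        rw [Finset.mem_Icc] at hk
        rw [(hS k hk.1 hk.2).2 z hz', R.step l k hk.1 hk.2 z hz', map_add, map_mul]
        ring
      have e3 : ∑ k ∈ Finset.Icc (l + 1) m, aeval z (Function.update q l q0 k) * nikFun ρ l k z
          = ∑ k ∈ Finset.Icc (l + 1) m, (aeval z (T k)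
            + ctr (ρ l) (fun w => aeval w (q k) * nikFun ρ (l + 1) k w) z) := by
        refine Finset.sum_congr rfl fun k hk => ?_
        rw [Finset.mem_Icc] at hk
        rw [Function.update_of_ne (by omega), (hT k hk.1 hk.2).2 z hz']
        ring
      rw [e2, e3, Finset.sum_add_distrib, Finset.sum_add_distrib, e1, hq0, map_add, map_sum]
      simp only [map_sub, Finset.sum_sub_distrib]
      ring

end TriRep

lemma Sys.exists_reordering {m : ℕ} {a : ℕ → CSM} {Δ : ℕ → Set ℝ} (hs : Sys m a Δ) (n : ℕ → ℕ) :
    ∃ lam : Equiv.Perm ℕ, (∀ k, lam k ≤ m ↔ k ≤ m) ∧ (∀ l < m, n (lam (l + 1)) ≤ n (lam l)) ∧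
    ∃ ρ : ℕ → CSM, Sys m ρ Δ ∧ ∀ p : ℕ → ℝ[X], (∀ k ≤ m, (p k).degree < n k) →
    ∃ q : ℕ → ℝ[X], (∀ k ≤ m, (q k).degree < n (lam k)) ∧
      ∀ z : ℂ, (0 < m → z ∉ cSet (Δ 0)) →
        ∑ k ∈ Finset.range (m + 1), aeval z (p k) * nikFun a 0 k z
          = (∑ k ∈ Finset.range (m + 1), aeval z (q k) * nikFun ρ 0 k z)
            * nikFun a 0 (lam 0) z := by
  obtain ⟨lam, ρ, A, h, R, hinv, hsort⟩ := TriRep.exists_sorted hs n _ _ _ _ _ hs.rep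
    (fun i j hij _ hlt => absurd hlt (by simp; omega)) le_rfl
  have hmono : ∀ i j, i ≤ j → j ≤ m → n (lam j) ≤ n (lam i) := by
    intro i j hij
    induction j, hij using Nat.le_induction with
    | base => exact fun _ => le_rfl
    | succ j hij ih => exact fun hj => (hsort j (by omega)).trans (ih (by omega))
  refine ⟨lam, R.le, hsort, ρ, R.sys hs, fun p hp => ?_⟩
  obtain ⟨q, hq, hqe⟩ := R.exists_forms hs (N := fun k => n (lam k)) (fun l k hl hk => by
    have h1 := R.natDegree_le hs hl hk
    have h2 := hmono l k hl.le hk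
    split_ifs at h1 with h3
    · have := hinv l k hl hk (by omega)
      show _ + n (lam k) ≤ n (lam l)
      omega
    · show _ + n (lam k) ≤ n (lam l)
      omega) m 0 (by omega) (fun k => p (lam k)) fun k _ hk => hp _ ((R.le k).2 hk)
  refine ⟨q, fun k hk => hq k (by omega) hk, fun z hz => ?_⟩
  have hr : Finset.range (m + 1) = Finset.Icc 0 m := by
    ext x
    simp
  rw [hr, ← hqe z hz, Finset.sum_mul]
  symm
  refine Finset.sum_equiv lam (fun k => by simp [R.le]) fun k hk => ?_
  rw [R.nikFun_label hs (Finset.mem_Icc.1 hk).2 hz]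
  ring

lemma msupport_eq (μ : Measure ℝ) : SignedM.msupport μ = μ.support := by
  ext x
  rw [Measure.mem_support_iff_forall]
  constructor
  · intro h U hU
    obtain ⟨V, hVU, hV, hx⟩ := mem_nhds_iff.1 hU
    exact (pos_iff_ne_zero.2 (h V hV hx)).trans_le (measure_mono hVU)
  · exact fun h U hU hx => (h U (hU.mem_nhds hx)).ne'

/-- The pair of measures `s` is the constant sign measure `c`. -/
def SignedM.Is (s : SignedM) (c : CSM) : Prop :=
  (c.ε = 1 ∧ s.pos = c.μ ∧ s.neg = 0) ∨ (c.ε = -1 ∧ s.pos = 0 ∧ s.neg = c.μ)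

lemma SignedM.Is.supp_eq {s : SignedM} {c : CSM} (h : s.Is c) : s.supp = c.μ.support := by
  unfold SignedM.supp
  rcases h with ⟨_, h1, h2⟩ | ⟨_, h1, h2⟩ <;> simp [h1, h2, msupport_eq]

lemma IsM.exists_csm {s : SignedM} {Δ : Set ℝ} (h : IsM s Δ) : ∃ c : CSM, c.On Δ ∧ s.Is c := by
  obtain ⟨c, hc⟩ : ∃ c : CSM, s.Is c := by
    rcases h.constSign with h0 | h0
    · exact ⟨⟨s.neg, -1⟩, Or.inr ⟨rfl, h0, rfl⟩⟩
    · exact ⟨⟨s.pos, 1⟩, Or.inl ⟨rfl, rfl, h0⟩⟩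
  have hsub : c.μ.support ⊆ Δ := by
    rw [h.hullEq, ← hc.supp_eq]
    exact fun x hx => ⟨csInf_le h.compactSupp.bddBelow hx, le_csSup h.compactSupp.bddAbove hx⟩
  refine ⟨c, ⟨?_, ?_, ?_, ?_, ?_, ?_⟩, hc⟩
  · rw [h.hullEq]
    exact isCompact_Icc
  · rw [h.hullEq]
    exact ordConnected_Icc
  · rcases hc with ⟨_, h1, _⟩ | ⟨_, _, h1⟩ <;> rw [← h1]
    exacts [h.posFinite, h.negFinite]
  · rcases hc with ⟨h1, _⟩ | ⟨h1, _⟩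
    exacts [Or.inl h1, Or.inr h1]
  · exact measure_mono_null (compl_subset_compl.2 hsub) Measure.measure_compl_support
  · rw [← hc.supp_eq]
    exact h.infiniteSupp

lemma CSM.On.exists_isM {c : CSM} {Δ : Set ℝ} (h : c.On Δ) :
    ∃ (s : SignedM) (Δ' : Set ℝ), Δ' ⊆ Δ ∧ IsM s Δ' ∧ s.Is c := by
  have hfin := h.fin
  obtain ⟨s, hs⟩ : ∃ s : SignedM, s.Is c := by
    rcases h.sgn with h0 | h0
    · exact ⟨⟨c.μ, 0⟩, Or.inl ⟨h0, rfl, rfl⟩⟩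
    · exact ⟨⟨0, c.μ⟩, Or.inr ⟨h0, rfl, rfl⟩⟩
  have hcpt : IsCompact s.supp := by
    rw [hs.supp_eq]
    exact h.cpt.of_isClosed_subset Measure.isClosed_support h.support_subset
  have hinf : s.supp.Infinite := by
    rw [hs.supp_eq]
    exact h.inf
  have hsub : s.supp ⊆ Δ := by
    rw [hs.supp_eq]
    exact h.support_subset
  refine ⟨s, Icc (sInf s.supp) (sSup s.supp),
    h.cvx.out (hsub (hcpt.sInf_mem hinf.nonempty)) (hsub (hcpt.sSup_mem hinf.nonempty)),
    ⟨?_, ?_, ?_, hcpt, hinf, rfl⟩, hs⟩ <;>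
  rcases hs with ⟨_, h1, h2⟩ | ⟨_, h1, h2⟩ <;> simp only [h1, h2, true_or, or_true] <;>
  infer_instance

namespace SignedM.Is

variable {s : SignedM} {c : CSM} {Δ : Set ℝ} {E : Type*} [NormedAddCommGroup E] [NormedSpace ℝ E]

lemma integral_eq (h : s.Is c) (f : ℝ → E) :
    ∫ x, f x ∂s.pos - ∫ x, f x ∂s.neg = c.ε • ∫ x, f x ∂c.μ := by
  rcases h with ⟨h0, h1, h2⟩ | ⟨h0, h1, h2⟩ <;> simp [h0, h1, h2]

lemma integral_withDensityR (h : s.Is c) (hc : c.On Δ) {g : ℝ → ℝ} (hg : ContinuousOn g Δ)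
    {f : ℝ → E} (hf : ContinuousOn f Δ) :
    ∫ x, f x ∂(s.withDensityR g).pos - ∫ x, f x ∂(s.withDensityR g).neg
      = c.ε • ∫ x, g x • f x ∂c.μ := by
  have hd : ∀ k : ℝ → ℝ, ContinuousOn k Δ →
      ∫ x, f x ∂(c.μ.withDensity fun x => ENNReal.ofReal (k x)) = ∫ x, max (k x) 0 • f x ∂c.μ := by
    intro k hk
    have hkm : AEMeasurable k c.μ := by
      rw [← hc.restrict]
      exact hk.aemeasurable hc.cpt.measurableSet
    rw [integral_withDensity_eq_integral_toReal_smul₀ hkm.ennreal_ofReal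
      (Eventually.of_forall fun _ => ENNReal.ofReal_lt_top)]
    simp only [ENNReal.toReal_ofReal']
  have hsub : ∫ x, max (g x) 0 • f x ∂c.μ - ∫ x, max (-g x) 0 • f x ∂c.μ
      = ∫ x, g x • f x ∂c.μ := by
    have i1 : Integrable (fun x => max (g x) 0 • f x) c.μ :=
      hc.integrable ((hg.sup continuousOn_const).smul hf)
    have i2 : Integrable (fun x => max (-g x) 0 • f x) c.μ :=
      hc.integrable ((hg.neg.sup continuousOn_const).smul hf)
    rw [← integral_sub i1 i2]
    congr 1
    funext x
    rw [← sub_smul]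
    congr 1
    rcases le_total (g x) 0 with h0 | h0
    · rw [max_eq_right h0, max_eq_left (by linarith)]
      ring
    · rw [max_eq_left h0, max_eq_right (by linarith)]
      ring
  rw [← hsub, ← hd g hg, ← hd (fun x => -g x) hg.neg]
  rcases h with ⟨h0, h1, h2⟩ | ⟨h0, h1, h2⟩ <;>
    simp [SignedM.withDensityR, h0, h1, h2, withDensity_zero_left]

lemma cauchy_eq (h : s.Is c) (z : ℂ) : s.cauchy z = ctr c (fun _ => 1) z := by
  unfold SignedM.cauchy SignedM.cintegral ctr
  rw [h.integral_eq]
  simp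

lemma cauchyR_eq (h : s.Is c) (hc : c.On Δ) (x : ℝ) :
    (s.cauchyR x : ℂ) = ctr c (fun _ => 1) x := by
  unfold SignedM.cauchyR SignedM.rintegral
  rw [hc.ctr_ofReal (CR.one Δ), h.integral_eq]
  simp

lemma cauchy_withDensityR (h : s.Is c) (hc : c.On Δ) {g : ℝ → ℝ} {F : ℂ → ℂ} (hF : CR F Δ)
    (hgF : ∀ x ∈ Δ, (g x : ℂ) = F x) {z : ℂ} (hz : z ∉ cSet Δ) :
    (s.withDensityR g).cauchy z = ctr c F z := by
  have hg : ContinuousOn g Δ := (Complex.continuous_re.comp_continuousOn hF.cont).congr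
    fun x hx => by simp [← hgF x hx]
  unfold SignedM.cauchy SignedM.cintegral
  rw [h.integral_withDensityR hc hg
    (by simpa using CSM.On.cont_kernel (fun _ => 1) continuousOn_const hz),
    ← hc.ctr_congr (F := fun w => (g w.re : ℂ)) fun x hx => by simpa using hgF x hx]
  simp [ctr]

lemma cauchyR_withDensityR (h : s.Is c) (hc : c.On Δ) {g : ℝ → ℝ} {F : ℂ → ℂ} (hF : CR F Δ)
    (hgF : ∀ x ∈ Δ, (g x : ℂ) = F x) {x : ℝ} (hx : x ∉ Δ) :
    ((s.withDensityR g).cauchyR x : ℂ) = ctr c F x := by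
  have hg : ContinuousOn g Δ := (Complex.continuous_re.comp_continuousOn hF.cont).congr
    fun x hx => by simp [← hgF x hx]
  have hf : ContinuousOn (fun t : ℝ => (x - t)⁻¹) Δ := ContinuousOn.inv₀ (by fun_prop)
    fun t ht h0 => hx (by rw [sub_eq_zero.1 h0]; exact ht)
  unfold SignedM.cauchyR SignedM.rintegral
  rw [h.integral_withDensityR hc hg hf, hc.ctr_ofReal hF]
  congr 2
  refine hc.integral_congr fun t ht => ?_
  simp [← hgF t ht]

end SignedM.Is

lemma nikSys_cauchy_aux {m : ℕ} {σ : ℕ → SignedM} {a : ℕ → CSM} {Δ : ℕ → Set ℝ} (hs : Sys m a Δ)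
    (hσ : ∀ i < m, (σ (i + 1)).Is (a i)) (d : ℕ) : ∀ i, i + d + 1 ≤ m →
    (∀ z ∉ cSet (Δ i), (nikSys σ (i + 1) (i + d + 1)).cauchy z = nikFun a i (i + d + 1) z) ∧
    ∀ x : ℝ, x ∉ Δ i →
      ((nikSys σ (i + 1) (i + d + 1)).cauchyR x : ℂ) = nikFun a i (i + d + 1) x := by
  induction d with
  | zero =>
    intro i hi
    rw [nikSys, dif_neg (by omega), nikFun_of_lt a (by omega), Nat.add_zero, nikFun_self]
    exact ⟨fun z _ => (hσ i hi).cauchy_eq z, fun x _ => (hσ i hi).cauchyR_eq (hs.on i hi) x⟩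
  | succ d ih =>
    intro i hi
    have h1 := (ih (i + 1) (by omega)).2
    rw [show i + 1 + d + 1 = i + (d + 1) + 1 by omega] at h1
    rw [nikSys, dif_pos (by omega), nikFun_of_lt a (by omega)]
    have hCR : CR (nikFun a (i + 1) (i + (d + 1) + 1)) (Δ i) := hs.cr_nikFun (by omega) hi
    have hg : ∀ x ∈ Δ i, ((nikSys σ (i + 1 + 1) (i + (d + 1) + 1)).cauchyR x : ℂ)
        = nikFun a (i + 1) (i + (d + 1) + 1) x :=
      fun x hx => h1 x fun h' => (hs.disj i (by omega)).le_bot ⟨hx, h'⟩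
    exact ⟨fun z hz => (hσ i (by omega)).cauchy_withDensityR (hs.on i (by omega)) hCR hg hz,
      fun x hx => (hσ i (by omega)).cauchyR_withDensityR (hs.on i (by omega)) hCR hg hx⟩

lemma nikSys_cauchy {m : ℕ} {σ : ℕ → SignedM} {a : ℕ → CSM} {Δ : ℕ → Set ℝ} (hs : Sys m a Δ)
    (hσ : ∀ i < m, (σ (i + 1)).Is (a i)) {k : ℕ} (hk : 1 ≤ k) (hkm : k ≤ m) {z : ℂ}
    (hz : z ∉ cSet (Δ 0)) : (nikSys σ 1 k).cauchy z = nikFun a 0 k z := by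
  obtain ⟨d, rfl⟩ := Nat.exists_eq_add_of_le' hk
  simpa using (nikSys_cauchy_aux hs hσ d 0 (by omega)).1 z hz

lemma sum_range_nikFun {m : ℕ} {σ : ℕ → SignedM} {a : ℕ → CSM} {Δ : ℕ → Set ℝ} (hs : Sys m a Δ)
    (hσ : ∀ i < m, (σ (i + 1)).Is (a i)) {z : ℂ} (hz : z ∉ cSet (Δ 0)) (p : ℕ → ℝ[X]) :
    ∑ k ∈ Finset.range (m + 1), aeval z (p k) * nikFun a 0 k z
      = aeval z (p 0) + ∑ k ∈ Finset.Icc 1 m, aeval z (p k) * (nikSys σ 1 k).cauchy z := by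
  rw [Finset.range_eq_Ico, Finset.Ico_add_one_right_eq_Icc, sum_Icc_head (Nat.zero_le m),
    nikFun_self, mul_one]
  congr 1
  refine Finset.sum_congr rfl fun k hk => ?_
  rw [Finset.mem_Icc] at hk
  rw [nikSys_cauchy hs hσ hk.1 hk.2 hz]

/-- Theorem 3: there exist a permutation `λ` of `{0, …, m}` reordering the components of
`n` decreasingly and an associated Nikishin system `N(ρ₁, …, ρ_m)` (on subintervals of the
original ones) such that every form `p₀ + Σ p_k ŝ_{1,k}` factors as
`(q₀ + Σ q_k r̂_{1,k})·ŝ_{1,λ(0)}` with `deg q_k ≤ n_{λ(k)} − 1` (and `ŝ_{1,0} ≡ 1`). -/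
theorem stmt14
    (m : ℕ) (hm : 1 ≤ m)
    (σ : ℕ → SignedM) (Δ : ℕ → Set ℝ)
    (hσ : ∀ j, 1 ≤ j → j ≤ m → IsM (σ j) (Δ j))
    (hdisj : ∀ j, 1 ≤ j → j + 1 ≤ m → Δ j ∩ Δ (j + 1) = ∅)
    (n : ℕ → ℕ) :
    ∃ (e : ℕ → ℕ) (ρ : ℕ → SignedM) (Δ' : ℕ → Set ℝ),
      Set.BijOn e (Set.Iic m) (Set.Iic m) ∧
      (∀ j k, j ≤ k → k ≤ m → n (e k) ≤ n (e j)) ∧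
      (∀ i, 1 ≤ i → i ≤ m → Δ' i ⊆ Δ i ∧ IsM (ρ i) (Δ' i)) ∧
      (∀ i, 1 ≤ i → i + 1 ≤ m → Δ' i ∩ Δ' (i + 1) = ∅) ∧
      (∀ p : ℕ → Polynomial ℝ, (∀ k ≤ m, (p k).degree < (n k : WithBot ℕ)) →
        ∃ q : ℕ → Polynomial ℝ, (∀ k ≤ m, (q k).degree < (n (e k) : WithBot ℕ)) ∧
          ∀ z : ℂ, z ∉ cSet (Δ 1) →
            aeval z (p 0) +
                ∑ k ∈ Finset.Icc 1 m, aeval z (p k) * (nikSys σ 1 k).cauchy z =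
              (aeval z (q 0) +
                  ∑ k ∈ Finset.Icc 1 m, aeval z (q k) * (nikSys ρ 1 k).cauchy z) *
                sh1C σ (e 0) z) := by
  have : Nonempty CSM := ⟨⟨0, 0⟩⟩
  have : Nonempty SignedM := ⟨⟨0, 0⟩⟩
  choose! a' ha' using fun j (h1 : 1 ≤ j) (h2 : j ≤ m) => (hσ j h1 h2).exists_csm
  have hs : Sys m (fun i => a' (i + 1)) fun i => Δ (i + 1) :=
    ⟨fun l hl => (ha' (l + 1) (by omega) hl).1, fun l hl => disjoint_iff_inter_eq_empty.2
      (hdisj (l + 1) (by omega) (by omega))⟩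
  obtain ⟨lam, hle, hsort, ρ, hρ, hform⟩ := hs.exists_reordering n
  choose! s Δ' hs' using fun i (hi : i < m) => (hρ.on i hi).exists_isM
  refine ⟨lam, fun j => s (j - 1), fun j => Δ' (j - 1), ?_, ?_, ?_, ?_, ?_⟩
  · refine ⟨fun k hk => (hle k).2 hk, lam.injective.injOn, fun k hk => ⟨lam.symm k, ?_, by simp⟩⟩
    rw [mem_Iic, ← hle]
    simpa using hk
  · intro j k hjk
    induction k, hjk using Nat.le_induction with
    | base => exact fun _ => le_rfl
    | succ k _ ih => exact fun hk => (hsort k (by omega)).trans (ih (by omega))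
  · intro i h1 h2
    obtain ⟨i, rfl⟩ := Nat.exists_eq_add_of_le' h1
    exact ⟨(hs' i h2).1, (hs' i h2).2.1⟩
  · intro i h1 h2
    obtain ⟨i, rfl⟩ := Nat.exists_eq_add_of_le' h1
    rw [← disjoint_iff_inter_eq_empty]
    exact (hρ.disj i h2).mono (hs' i (by omega)).1 (hs' (i + 1) h2).1
  · intro p hp
    obtain ⟨q, hq, hqe⟩ := hform p hp
    refine ⟨q, hq, fun z hz => ?_⟩
    have hlab : nikFun (fun i => a' (i + 1)) 0 (lam 0) z = sh1C σ (lam 0) z := by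
      unfold sh1C
      split_ifs with h0
      · rw [h0, nikFun_self]
      · exact (nikSys_cauchy hs (fun i hi => (ha' (i + 1) (by omega) hi).2) (by omega)
          ((hle 0).2 (by omega)) hz).symm
    rw [← hlab, ← sum_range_nikFun hs (fun i hi => (ha' (i + 1) (by omega) hi).2) hz,
      ← sum_range_nikFun (σ := fun j => s (j - 1)) hρ (fun i hi => (hs' i hi).2.2) hz]
    exact hqe z fun _ => hz
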